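/- Let k ⊆ K be number fields with K/k Galois and Gal(K/k) cyclic of prime order q. Let P_q be the set of nonzero prime ideals 𝔭 of the ring of integers of k that are unramified in K and do not split in K (equivalently, 𝔭 is inert in K, i.e., the Frobenius of 𝔭 generates Gal(K/k)), and define ζ_{P_q}(s) = ∏_{𝔭 ∈ P_q} (1 − N(𝔭)^{-s})^{-1} for Re s > 1, where N(𝔭) is the absolute norm of 𝔭. Then for every integer r ≥ 1 there exists a meromorphic function F_r on {Re s > 1/q^r} with F_r(s) = ζ_{P_q}(s)^{q^r} for Re s > 1. Moreover, if both k and K are abelian extensions of ℚ, then ζ_{P_q} has a natural boundary on the line Re s = 0: for every r ≥ 1, the continuation F_r admits no meromorphic extension to any open neighborhood of any point of the imaginary axis {Re s = 0}. -/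

import Mathlib

section
open MeasureTheory Set Filter Topology

namespace NB

/-- summability of a product function over `ι → ℤ` -/
lemma summable_pi_prod {ι : Type*} [Fintype ι] (f : ℤ → ℝ) (hf0 : ∀ n, 0 ≤ f n) (hf : Summable f) :
    Summable (fun m : ι → ℤ => ∏ i, f (m i)) := by
  classical
  refine summable_of_sum_le (c := (∑' n, f n) ^ Fintype.card ι)
    (fun m => Finset.prod_nonneg fun i _ => hf0 _) ?_
  intro s
  set T : Finset ℤ := s.biUnion (fun m => Finset.univ.image m) with hT
  have hsub : s ⊆ Fintype.piFinset (fun _ : ι => T) := by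
    intro m hm
    rw [Fintype.mem_piFinset]
    intro i
    rw [hT, Finset.mem_biUnion]
    exact ⟨m, hm, Finset.mem_image.2 ⟨i, Finset.mem_univ _, rfl⟩⟩
  calc ∑ m ∈ s, ∏ i, f (m i) ≤ ∑ m ∈ Fintype.piFinset (fun _ : ι => T), ∏ i, f (m i) :=
        Finset.sum_le_sum_of_subset_of_nonneg hsub
          (fun m _ _ => Finset.prod_nonneg fun i _ => hf0 _)
    _ = ∏ _i : ι, ∑ n ∈ T, f n := (Finset.prod_univ_sum (fun _ : ι => T) (fun _ n => f n)).symm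
    _ = (∑ n ∈ T, f n) ^ Fintype.card ι := by simp
    _ ≤ (∑' n, f n) ^ Fintype.card ι := by
        gcongr
        · exact Finset.sum_nonneg fun i _ => hf0 _
        · exact hf.sum_le_tsum T (fun i _ => hf0 i)

lemma summable_int_gauss {a : ℝ} (ha : 0 < a) : Summable (fun n : ℤ => Real.exp (-a * (n : ℝ) ^ 2)) := by
  have h := summable_pow_mul_jacobiTheta₂_term_bound 0 (T := a / Real.pi) (by positivity) 0
  refine h.congr ?_
  intro n
  simp only [pow_zero, one_mul, mul_zero, zero_mul, sub_zero]
  congr 1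
  field_simp

lemma summable_pi_gauss {ι : Type*} [Fintype ι] {a : ℝ} (ha : 0 < a) :
    Summable (fun m : ι → ℤ => Real.exp (-a * ∑ i, (m i : ℝ) ^ 2)) := by
  refine (summable_pi_prod (ι := ι) _ (fun n => (Real.exp_pos _).le) (summable_int_gauss ha)).congr ?_
  intro m
  rw [← Real.exp_sum, Finset.mul_sum]

/-- the half-open unit cube -/
def cube (ι : Type*) : Set (ι → ℝ) := {x | ∀ i, x i ∈ Ioc (0:ℝ) 1}

lemma measurableSet_cube {ι : Type*} [Fintype ι] : MeasurableSet (cube ι) := by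
  have : cube ι = Set.pi univ (fun _ => Ioc (0:ℝ) 1) := by ext; simp [cube]
  rw [this]
  exact MeasurableSet.univ_pi fun i => measurableSet_Ioc

/-- translated cube -/
def tcube {ι : Type*} (m : ι → ℤ) : Set (ι → ℝ) := {x | (fun i => x i - m i) ∈ cube ι}

lemma measurableSet_tcube {ι : Type*} [Fintype ι] (m : ι → ℤ) : MeasurableSet (tcube m) := by
  have : Measurable (fun x : ι → ℝ => (fun i => x i - (m i : ℝ))) := by fun_prop
  exact this measurableSet_cube

lemma iUnion_tcube {ι : Type*} : (⋃ m : ι → ℤ, tcube m) = univ := by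
  ext x
  simp only [mem_iUnion, mem_univ, iff_true]
  refine ⟨fun i => ⌈x i⌉ - 1, fun i => ?_⟩
  have h1 := Int.ceil_lt_add_one (x i)
  have h2 := Int.le_ceil (x i)
  simp only [mem_Ioc, Int.cast_sub, Int.cast_one]
  constructor <;> linarith

lemma disjoint_tcube {ι : Type*} : Pairwise (Function.onFun Disjoint (tcube (ι := ι))) := by
  intro m m' hmm
  rw [Function.onFun, Set.disjoint_left]
  intro x hx hx'
  apply hmm
  ext i
  have h1 := hx i
  have h2 := hx' i
  simp only [mem_Ioc] at h1 h2
  have h3 : (m i : ℝ) < m' i + 1 := by linarith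
  have h4 : (m' i : ℝ) < m i + 1 := by linarith
  norm_cast at h3 h4
  omega

lemma preimage_tcube {ι : Type*} (m : ι → ℤ) :
    (fun x : ι → ℝ => x + (fun i => (m i : ℝ))) ⁻¹' (tcube m) = cube ι := by
  ext x; simp [tcube]

lemma lintegral_tcube {ι : Type*} [Fintype ι] (f : (ι → ℝ) → ENNReal) (m : ι → ℤ) :
    ∫⁻ x in tcube m, f x = ∫⁻ x in cube ι, f (x + (fun i => (m i : ℝ))) := by
  have := (measurePreserving_add_right (volume : Measure (ι → ℝ)) (fun i => (m i : ℝ))).setLIntegral_comp_preimage_emb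
    (measurableEmbedding_addRight _) f (tcube m)
  rw [preimage_tcube] at this
  exact this.symm

lemma integral_tcube {ι : Type*} [Fintype ι] (f : (ι → ℝ) → ℂ) (m : ι → ℤ) :
    ∫ x in tcube m, f x = ∫ x in cube ι, f (x + (fun i => (m i : ℝ))) := by
  have := (measurePreserving_add_right (volume : Measure (ι → ℝ)) (fun i => (m i : ℝ))).setIntegral_preimage_emb
    (measurableEmbedding_addRight _) f (tcube m)
  rw [preimage_tcube] at this
  exact this.symm

lemma lintegral_eq_tsum_cube {ι : Type*} [Fintype ι] (f : (ι → ℝ) → ENNReal) :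
    ∫⁻ x, f x = ∑' m : ι → ℤ, ∫⁻ x in cube ι, f (x + (fun i => (m i : ℝ))) := by
  rw [← setLIntegral_univ, ← iUnion_tcube, lintegral_iUnion measurableSet_tcube disjoint_tcube]
  exact tsum_congr fun m => lintegral_tcube f m

lemma hasSum_integral_cube {ι : Type*} [Fintype ι] (f : (ι → ℝ) → ℂ) (hf : Integrable f) :
    HasSum (fun m : ι → ℤ => ∫ x in cube ι, f (x + (fun i => (m i : ℝ)))) (∫ x, f x) := by
  have := hasSum_integral_iUnion (μ := volume) (f := f) (measurableSet_tcube (ι := ι)) disjoint_tcube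
    (by rw [iUnion_tcube]; exact hf.integrableOn)
  rw [iUnion_tcube, setIntegral_univ] at this
  simpa only [integral_tcube] using this

end NB
end

section
open MeasureTheory Set Filter Topology

namespace NB

lemma isOpenQuotientMap_torus {ι : Type*} [Fintype ι] :
    IsOpenQuotientMap (fun (x : ι → ℝ) => (fun i => (x i : UnitAddCircle))) := by
  exact IsOpenQuotientMap.piMap (fun i => QuotientAddGroup.isOpenQuotientMap_mk)

/-- A crude n-dimensional Poisson summation formula. -/
theorem poisson {ι : Type*} [Fintype ι] (φ : (ι → ℝ) → ℂ) (hφ : Continuous φ)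
    (hb : ∀ R : ℝ, ∃ b : (ι → ℤ) → ℝ, Summable b ∧
      ∀ m : ι → ℤ, ∀ x : ι → ℝ, (∀ i, |x i| ≤ R) → ‖φ (x + fun i => (m i : ℝ))‖ ≤ b m)
    (hInteg : Integrable φ)
    (ψ : (ι → ℤ) → ℂ) (hψ : ∀ m, ψ m = ∫ x, Complex.exp (-(2 * Real.pi * Complex.I * ∑ i, (m i : ℂ) * x i)) * φ x)
    (hψs : Summable ψ) :
    ∑' m : ι → ℤ, φ (fun i => (m i : ℝ)) = ∑' m, ψ m := by
  classical
  set P : (ι → ℝ) → ℂ := fun x => ∑' m : ι → ℤ, φ (x + fun i => (m i : ℝ)) with hP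
  have hsum : ∀ x, Summable (fun m : ι → ℤ => φ (x + fun i => (m i : ℝ))) := by
    intro x
    obtain ⟨b, hbs, hb'⟩ := hb ‖x‖
    exact Summable.of_norm_bounded hbs (fun m => hb' m x (fun i => norm_le_pi_norm x i))
  have hPc : Continuous P := by
    rw [continuous_iff_continuousAt]
    intro x0
    obtain ⟨b, hbs, hb'⟩ := hb (‖x0‖ + 1)
    have : ContinuousOn P (Metric.ball x0 1) := by
      refine continuousOn_tsum (u := b) (fun m => ?_) hbs (fun m x hx => hb' m x fun i => ?_)
      · exact (hφ.comp (continuous_add_const _)).continuousOn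
      · have h1 : ‖x‖ ≤ ‖x0‖ + 1 := by
          have := mem_ball_iff_norm.1 hx
          have h2 := norm_le_norm_add_norm_sub x0 x
          rw [norm_sub_rev] at h2
          linarith
        exact (norm_le_pi_norm x i).trans h1
    exact this.continuousAt (Metric.ball_mem_nhds _ one_pos)
  have hPper : ∀ (x : ι → ℝ) (a : ι → ℤ), P (x + fun i => (a i : ℝ)) = P x := by
    intro x a
    simp only [hP]
    rw [← (Equiv.addLeft a).tsum_eq (fun m : ι → ℤ => φ (x + fun i => (m i : ℝ)))]
    refine tsum_congr fun m => ?_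
    congr 1
    ext i
    simp [add_assoc]
  set F0 : UnitAddTorus ι → ℂ := fun y => P (fun i => (y i).out) with hF0
  have hF0P : ∀ x : ι → ℝ, F0 (fun i => (x i : UnitAddCircle)) = P x := by
    intro x
    have : ∀ i, ∃ a : ℤ, ((x i : UnitAddCircle)).out = x i + a := by
      intro i
      have h : (((x i : UnitAddCircle)).out : UnitAddCircle) = (x i : UnitAddCircle) :=
        Quotient.out_eq _
      have h' := (QuotientAddGroup.eq).1 h.symm
      obtain ⟨a, ha⟩ := AddSubgroup.mem_zmultiples_iff.1 h'
      refine ⟨a, ?_⟩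
      have : (a : ℝ) = -x i + ((x i : UnitAddCircle)).out := by simpa using ha
      linarith
    choose a ha using this
    simp only [hF0]
    rw [← hPper x a]
    congr 1
    ext i
    exact ha i
  have hF0c : Continuous F0 := by
    rw [isOpenQuotientMap_torus.isQuotientMap.continuous_iff]
    convert hPc using 1
    ext x
    exact hF0P x
  set F : C(UnitAddTorus ι, ℂ) := ⟨F0, hF0c⟩ with hF
  have hcoef : ∀ n, UnitAddTorus.mFourierCoeff F n = ψ n := by
    intro n
    rw [UnitAddTorus.mFourierCoeff_eq_integral _ n 0, hψ n]
    set e : (ι → ℝ) → ℂ := fun x => Complex.exp (-(2 * Real.pi * Complex.I * ∑ i, (n i : ℂ) * x i)) with he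
    have hen : ∀ x, ‖e x‖ = 1 := by
      intro x
      have : e x = Complex.exp ((-(2 * Real.pi * ∑ i, (n i : ℝ) * x i) : ℝ) * Complex.I) := by
        simp only [he]
        congr 1
        push_cast
        ring
      rw [this, Complex.norm_exp_ofReal_mul_I]
    have hec : Continuous e := by
      simp only [he]
      fun_prop
    have hem : ∀ x, (UnitAddTorus.mFourier (-n)) (fun i => (x i : UnitAddCircle)) = e x := by
      intro x
      simp only [UnitAddTorus.mFourier, ContinuousMap.coe_mk, he]
      simp_rw [fourier_coe_apply]
      rw [← Complex.exp_sum, Finset.mul_sum, ← Finset.sum_neg_distrib]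
      congr 1
      refine Finset.sum_congr rfl fun i _ => ?_
      simp
      ring
    have hper : ∀ x (a : ι → ℤ), e (x + fun i => (a i : ℝ)) = e x := by
      intro x a
      rw [← hem, ← hem]
      congr 1
      ext i
      simp
    have hcube : {x : ι → ℝ | ∀ i, x i ∈ Ioc ((0 : ι → ℝ) i) ((0 : ι → ℝ) i + 1)} = cube ι := by
      ext x; simp [cube]
    rw [hcube]
    have h1 : ∫ x in cube ι, (UnitAddTorus.mFourier (-n)) (fun i => (x i : UnitAddCircle)) • F (fun i => (x i : UnitAddCircle))
        = ∫ x in cube ι, ∑' m : ι → ℤ, e (x + fun i => (m i : ℝ)) * φ (x + fun i => (m i : ℝ)) := by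
      congr 1
      ext x
      rw [hem, hF, ContinuousMap.coe_mk, hF0P, hP, smul_eq_mul]
      simp_rw [hper]
      rw [tsum_mul_left]
    rw [h1]
    have hIntE : Integrable (fun x => e x * φ x) := by
      refine (hInteg.bdd_mul (c := 1) hec.aestronglyMeasurable ?_)
      exact Filter.Eventually.of_forall fun x => (hen x).le
    obtain ⟨b, hbs, hb'⟩ := hb 1
    have hbd : ∀ (m : ι → ℤ), ∀ x ∈ cube ι, ‖e (x + fun i => (m i : ℝ)) * φ (x + fun i => (m i : ℝ))‖ ≤ b m := by
      intro m x hx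
      rw [norm_mul, hen, one_mul]
      refine hb' m x fun i => ?_
      have := hx i
      rw [abs_le]; constructor <;> linarith [this.1, this.2]
    have hvol : (volume : Measure (ι → ℝ)) (cube ι) = 1 := by
      have : cube ι = Set.pi univ (fun _ => Ioc (0:ℝ) 1) := by ext; simp [cube]
      rw [this, volume_pi_pi]; simp
    have hintm : ∀ m : ι → ℤ, IntegrableOn (fun x => e (x + fun i => (m i : ℝ)) * φ (x + fun i => (m i : ℝ))) (cube ι) := by
      intro m
      exact (hIntE.comp_add_right _).integrableOn
    rw [← integral_tsum_of_summable_integral_norm hintm]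
    · exact (hasSum_integral_cube _ hIntE).tsum_eq
    · refine Summable.of_nonneg_of_le (fun m => integral_nonneg fun x => norm_nonneg _) (fun m => ?_) hbs
      have : ∫ x in cube ι, ‖e (x + fun i => (m i : ℝ)) * φ (x + fun i => (m i : ℝ))‖ ≤ ∫ x in cube ι, b m := by
        refine setIntegral_mono_on (hintm m).norm ?_ measurableSet_cube (hbd m)
        exact integrableOn_const (by rw [hvol]; simp)
      refine this.trans ?_
      simp [Measure.real, hvol]
  have hs : Summable (UnitAddTorus.mFourierCoeff F) := by
    convert hψs using 1
    ext n; exact hcoef n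
  have := UnitAddTorus.hasSum_mFourier_series_apply_of_summable hs 0
  have h0 : F 0 = ∑' m : ι → ℤ, φ (fun i => (m i : ℝ)) := by
    have := hF0P 0
    simp only [hP, zero_add] at this
    rw [← this]
    rfl
  rw [← h0, ← this.tsum_eq]
  refine tsum_congr fun m => ?_
  rw [hcoef]
  simp [UnitAddTorus.mFourier]

end NB
end

section
open MeasureTheory Set Filter Topology

namespace NB
open Matrix
open scoped MatrixOrder

lemma quad_lower {ι : Type*} [Fintype ι] [DecidableEq ι] (B : Matrix ι ι ℝ) (hB : B.det ≠ 0) :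
    ∃ c : ℝ, 0 < c ∧ ∀ y : ι → ℝ, c * ∑ i, y i ^ 2 ≤ ∑ i, (B *ᵥ y) i ^ 2 := by
  set C : ℝ := ∑ j, ∑ i, (B⁻¹ j i) ^ 2 with hC
  have hC0 : 0 ≤ C := Finset.sum_nonneg fun j _ => Finset.sum_nonneg fun i _ => sq_nonneg _
  refine ⟨(C + 1)⁻¹, by positivity, fun y => ?_⟩
  rw [inv_mul_le_iff₀ (by positivity)]
  have hy : y = B⁻¹ *ᵥ (B *ᵥ y) := by
    rw [mulVec_mulVec, nonsing_inv_mul _ (by simpa using hB), one_mulVec]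
  set w := B *ᵥ y with hw
  have hq0 : 0 ≤ ∑ i, w i ^ 2 := Finset.sum_nonneg fun i _ => sq_nonneg _
  have : ∀ j, y j ^ 2 ≤ (∑ i, (B⁻¹ j i) ^ 2) * ∑ i, w i ^ 2 := by
    intro j
    have : y j = ∑ i, B⁻¹ j i * w i := by
      conv_lhs => rw [hy]
      simp [mulVec, dotProduct]
    rw [this]
    exact Finset.sum_mul_sq_le_sq_mul_sq _ _ _
  calc ∑ j, y j ^ 2 ≤ ∑ j, (∑ i, (B⁻¹ j i) ^ 2) * ∑ i, w i ^ 2 := Finset.sum_le_sum fun j _ => this j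
    _ = C * ∑ i, w i ^ 2 := by rw [hC, Finset.sum_mul]
    _ ≤ (C + 1) * ∑ i, w i ^ 2 := by nlinarith

lemma gauss_bound {ι : Type*} [Fintype ι] [DecidableEq ι] (B : Matrix ι ι ℝ) (hB : B.det ≠ 0) (R : ℝ) :
    ∃ b : (ι → ℤ) → ℝ, Summable b ∧
      ∀ m : ι → ℤ, ∀ x : ι → ℝ, (∀ i, |x i| ≤ R) →
        Real.exp (-Real.pi * ∑ i, (B *ᵥ (x + fun i => (m i : ℝ))) i ^ 2) ≤ b m := by
  obtain ⟨c, hc, hq⟩ := quad_lower B hB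
  have hS : Summable (fun m : ι → ℤ => Real.exp (Real.pi * c * ∑ _i : ι, R ^ 2) * Real.exp (-(Real.pi * c / 2) * ∑ i, (m i : ℝ) ^ 2)) :=
    (summable_pi_gauss (by positivity)).mul_left _
  refine ⟨_, hS, fun m x hx => ?_⟩
  have h1 := hq (x + fun i => (m i : ℝ))
  have h2 : ∑ i, ((m i : ℝ) ^ 2 / 2 - R ^ 2) ≤ ∑ i, ((x + fun i => (m i : ℝ)) i) ^ 2 := by
    refine Finset.sum_le_sum fun i _ => ?_
    have h3 : (x i) ^ 2 ≤ R ^ 2 := by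
      have := hx i
      exact sq_le_sq' (by linarith [(abs_le.1 this).1]) (abs_le.1 this).2
    have h4 : (x + fun i => (m i : ℝ)) i = x i + m i := rfl
    rw [h4]
    nlinarith [sq_nonneg (2 * x i + m i)]
  rw [Finset.sum_sub_distrib, ← Finset.sum_div] at h2
  generalize (∑ i, (B *ᵥ (x + fun i => (m i : ℝ))) i ^ 2) = Q at *
  generalize (∑ i, ((x + fun i => (m i : ℝ)) i) ^ 2) = Y at *
  generalize (∑ i, (m i : ℝ) ^ 2) = S at *
  generalize (∑ _i : ι, R ^ 2) = T at *
  rw [← Real.exp_add]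
  apply Real.exp_le_exp.2
  have h4 : c * (S / 2 - T) ≤ Q := (mul_le_mul_of_nonneg_left h2 hc.le).trans h1
  have h5 := mul_le_mul_of_nonneg_left h4 Real.pi_pos.le
  have e : Real.pi * (c * (S / 2 - T)) = Real.pi * c / 2 * S - Real.pi * c * T := by ring
  rw [e] at h5
  linarith

lemma integral_comp_matrix {ι : Type*} [Fintype ι] [DecidableEq ι] (B : Matrix ι ι ℝ) (hB : B.det ≠ 0)
    (g : (ι → ℝ) → ℂ) (hg : Continuous g) :
    ∫ x, g (B *ᵥ x) = ((|B.det|⁻¹ : ℝ) : ℂ) * ∫ v, g v := by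
  have h := Real.map_matrix_volume_pi_eq_smul_volume_pi hB
  have h1 : ∫ v, g v ∂(Measure.map (toLin' B) volume) = ∫ x, g (B *ᵥ x) := by
    rw [integral_map]
    · simp
    · exact (LinearMap.continuous_of_finiteDimensional (toLin' B)).aemeasurable
    · exact hg.aestronglyMeasurable
  rw [← h1, h, integral_smul_measure, ENNReal.toReal_ofReal (abs_nonneg _), abs_inv, Complex.real_smul]

lemma gauss_fourier {ι : Type*} [Fintype ι] [DecidableEq ι] (B : Matrix ι ι ℝ) (hB : B.det ≠ 0)
    (m : ι → ℝ) :
    ∫ x : ι → ℝ, Complex.exp (-(2 * Real.pi * Complex.I * ∑ i, (m i : ℂ) * x i)) *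
        ((Real.exp (-Real.pi * ∑ i, (B *ᵥ x) i ^ 2) : ℝ) : ℂ)
      = ((|B.det|⁻¹ * Real.exp (-Real.pi * ∑ i, ((B⁻¹)ᵀ *ᵥ m) i ^ 2) : ℝ) : ℂ) := by
  set w := (B⁻¹)ᵀ *ᵥ m with hw
  have hdot : ∀ x : ι → ℝ, ∑ i, m i * x i = ∑ i, w i * (B *ᵥ x) i := by
    intro x
    have : w ⬝ᵥ (B *ᵥ x) = m ⬝ᵥ x := by
      rw [hw, mulVec_transpose, dotProduct_mulVec, vecMul_vecMul, nonsing_inv_mul _ (by simpa using hB),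
        vecMul_one]
    exact this.symm
  set g : (ι → ℝ) → ℂ := fun v => Complex.exp (-(Real.pi : ℂ) * ∑ i, (v i : ℂ) ^ 2 + ∑ i, (-(2 * Real.pi * Complex.I * w i)) * v i) with hg
  have h1 : ∀ x : ι → ℝ, Complex.exp (-(2 * Real.pi * Complex.I * ∑ i, (m i : ℂ) * x i)) *
        ((Real.exp (-Real.pi * ∑ i, (B *ᵥ x) i ^ 2) : ℝ) : ℂ) = g (B *ᵥ x) := by
    intro x
    rw [Complex.ofReal_exp, ← Complex.exp_add, hg]
    congr 1
    have : (∑ i, (m i : ℂ) * x i) = ∑ i, (w i : ℂ) * ((B *ᵥ x) i : ℝ) := by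
      exact_mod_cast congrArg (fun r : ℝ => (r : ℂ)) (hdot x)
    rw [this, Finset.mul_sum, ← Finset.sum_neg_distrib, add_comm]
    push_cast
    congr 1
    refine Finset.sum_congr rfl fun i _ => ?_
    ring
  simp_rw [h1]
  rw [integral_comp_matrix B hB g (by simp only [hg]; fun_prop), hg,
    GaussianFourier.integral_cexp_neg_mul_sum_add (b := (Real.pi : ℂ)) (by simpa using Real.pi_pos),
    div_self (by exact_mod_cast Real.pi_ne_zero), Complex.one_cpow, one_mul, Complex.ofReal_mul, Complex.ofReal_exp]
  congr 2
  push_cast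
  rw [Finset.mul_sum, Finset.sum_div]
  refine Finset.sum_congr rfl fun i _ => ?_
  have : (Real.pi : ℂ) ≠ 0 := by exact_mod_cast Real.pi_ne_zero
  field_simp
  rw [Complex.I_sq]
  ring

lemma summable_gauss {ι : Type*} [Fintype ι] [DecidableEq ι] (B : Matrix ι ι ℝ) (hB : B.det ≠ 0) :
    Summable (fun m : ι → ℤ => Real.exp (-Real.pi * ∑ i, (B *ᵥ (fun i => (m i : ℝ))) i ^ 2)) := by
  obtain ⟨b, hb, h⟩ := gauss_bound B hB 0
  refine Summable.of_nonneg_of_le (fun m => (Real.exp_pos _).le) (fun m => ?_) hb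
  simpa using h m 0 (by simp)

theorem theta_matrix {ι : Type*} [Fintype ι] [DecidableEq ι] (B : Matrix ι ι ℝ) (hB : B.det ≠ 0) :
    ∑' m : ι → ℤ, Real.exp (-Real.pi * ∑ i, (B *ᵥ (fun i => (m i : ℝ))) i ^ 2) =
      |B.det|⁻¹ * ∑' m : ι → ℤ, Real.exp (-Real.pi * ∑ i, ((B⁻¹)ᵀ *ᵥ (fun i => (m i : ℝ))) i ^ 2) := by
  set φ : (ι → ℝ) → ℂ := fun x => ((Real.exp (-Real.pi * ∑ i, (B *ᵥ x) i ^ 2) : ℝ) : ℂ) with hφ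
  have hB' : ((B⁻¹)ᵀ).det ≠ 0 := by
    rw [det_transpose, det_nonsing_inv]
    simpa using hB
  have hInteg : Integrable φ := by
    have := gauss_fourier B hB 0
    by_contra h
    have h0 : ∫ x, φ x = 0 := integral_undef h
    simp only [Pi.zero_apply, Complex.ofReal_zero, zero_mul, Finset.sum_const_zero, mul_zero, neg_zero,
      Complex.exp_zero, one_mul] at this
    have h2 : ((|B.det|⁻¹ * Real.exp (-Real.pi * ∑ i, ((B⁻¹)ᵀ *ᵥ (0 : ι → ℝ)) i ^ 2) : ℝ) : ℂ) = 0 := by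
      rw [← this]; exact h0
    have h3 : |B.det|⁻¹ * Real.exp (-Real.pi * ∑ i, ((B⁻¹)ᵀ *ᵥ (0 : ι → ℝ)) i ^ 2) ≠ 0 := by positivity
    exact h3 (by exact_mod_cast h2)
  have hcont : Continuous φ := by
    simp only [hφ]
    refine Complex.continuous_ofReal.comp (Real.continuous_exp.comp (continuous_const.mul ?_))
    refine continuous_finsetSum _ fun i _ => ?_
    have : Continuous (fun x : ι → ℝ => B *ᵥ x) := Continuous.matrix_mulVec continuous_const continuous_id
    exact ((continuous_apply i).comp this).pow 2
  have key := poisson φ hcont (fun R => by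
      obtain ⟨b, hb, h⟩ := gauss_bound B hB R
      refine ⟨b, hb, fun m x hx => ?_⟩
      simp only [hφ]
      rw [Complex.norm_real, Real.norm_of_nonneg (Real.exp_pos _).le]
      exact h m x hx) hInteg
    (fun m => ((|B.det|⁻¹ * Real.exp (-Real.pi * ∑ i, ((B⁻¹)ᵀ *ᵥ (fun i => (m i : ℝ))) i ^ 2) : ℝ) : ℂ))
    (fun m => by rw [← gauss_fourier B hB]; simp [hφ])
    (by exact_mod_cast ((summable_gauss _ hB').mul_left _))
  rw [← tsum_mul_left]
  simp only [hφ] at key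
  exact_mod_cast key

theorem theta_posDef {ι : Type*} [Fintype ι] [DecidableEq ι] (A : Matrix ι ι ℝ) (hA : A.PosDef) :
    Summable (fun m : ι → ℤ => Real.exp (-Real.pi * ((fun i => (m i : ℝ)) ⬝ᵥ A *ᵥ (fun i => (m i : ℝ))))) ∧
    ∑' m : ι → ℤ, Real.exp (-Real.pi * ((fun i => (m i : ℝ)) ⬝ᵥ A *ᵥ (fun i => (m i : ℝ)))) =
      (√A.det)⁻¹ * ∑' m : ι → ℤ, Real.exp (-Real.pi * ((fun i => (m i : ℝ)) ⬝ᵥ A⁻¹ *ᵥ (fun i => (m i : ℝ)))) := by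
  obtain ⟨B, hBA⟩ : ∃ B : Matrix ι ι ℝ, A = Bᵀ * B := by
    obtain ⟨B, h⟩ := CStarAlgebra.nonneg_iff_eq_star_mul_self.1 hA.posSemidef.nonneg
    exact ⟨B, by rw [h, star_eq_conjTranspose, conjTranspose_eq_transpose_of_trivial]⟩
  have hdet : A.det = B.det ^ 2 := by rw [hBA, det_mul, det_transpose]; ring
  have hB : B.det ≠ 0 := by
    intro h
    have := hA.det_pos
    rw [hdet, h] at this
    simp at this
  have hq : ∀ x : ι → ℝ, x ⬝ᵥ A *ᵥ x = ∑ i, (B *ᵥ x) i ^ 2 := by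
    intro x
    rw [hBA, ← mulVec_mulVec, dotProduct_mulVec, vecMul_transpose]
    simp [dotProduct, sq]
  have hq' : ∀ x : ι → ℝ, x ⬝ᵥ A⁻¹ *ᵥ x = ∑ i, ((B⁻¹)ᵀ *ᵥ x) i ^ 2 := by
    intro x
    rw [hBA, Matrix.mul_inv_rev, ← mulVec_mulVec, dotProduct_mulVec, ← transpose_nonsing_inv, ← mulVec_transpose]
    simp [dotProduct, sq]
  simp_rw [hq, hq']
  refine ⟨summable_gauss B hB, ?_⟩
  rw [theta_matrix B hB, hdet, Real.sqrt_sq_eq_abs]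

end NB
end

section
open MeasureTheory Set Filter Topology

set_option linter.unusedSectionVars false
set_option linter.unusedSimpArgs false
set_option linter.unusedVariables false
namespace NB
open Matrix NumberField
open scoped ComplexConjugate

section nf
variable {K : Type*} [Field K] [NumberField K]

/-- weighted quadratic form `∑_τ t_τ |τ x|²` -/
noncomputable def qf (t : InfinitePlace K → ℝ) (x : K) : ℝ :=
  ∑ v : InfinitePlace K, (v.mult : ℝ) * (t v * (v x) ^ 2)

lemma sum_embeddings (f : InfinitePlace K → ℝ) :
    ∑ τ : K →+* ℂ, f (InfinitePlace.mk τ) = ∑ v : InfinitePlace K, (v.mult : ℝ) * f v := by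
  classical
  rw [← Finset.sum_fiberwise Finset.univ InfinitePlace.mk]
  refine Finset.sum_congr rfl fun v _ => ?_
  rw [Finset.sum_congr rfl (g := fun _ => f v), Finset.sum_const, InfinitePlace.card_filter_mk_eq, nsmul_eq_mul]
  intro τ hτ
  rw [(Finset.mem_filter.1 hτ).2]

lemma prod_embeddings (f : InfinitePlace K → ℝ) :
    ∏ τ : K →+* ℂ, f (InfinitePlace.mk τ) = ∏ v : InfinitePlace K, f v ^ v.mult := by
  classical
  rw [← Finset.prod_fiberwise Finset.univ InfinitePlace.mk]
  refine Finset.prod_congr rfl fun v _ => ?_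
  rw [Finset.prod_congr rfl (g := fun _ => f v), Finset.prod_const, InfinitePlace.card_filter_mk_eq]
  intro τ hτ
  rw [(Finset.mem_filter.1 hτ).2]

lemma qf_eq (t : InfinitePlace K → ℝ) (x : K) :
    qf t x = ∑ τ : K →+* ℂ, t (InfinitePlace.mk τ) * ‖τ x‖ ^ 2 := by
  rw [qf, ← sum_embeddings (fun v => t v * (v x) ^ 2)]
  rfl

variable {ι : Type*} [Fintype ι] [DecidableEq ι]

/-- embedding matrix -/
noncomputable def embMat (b : ι → K) (e : ι ≃ (K →+* ℂ)) : Matrix ι ι ℂ := Matrix.of fun i j => e j (b i)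

/-- Gram matrix -/
noncomputable def gram (b : ι → K) (t : InfinitePlace K → ℝ) : Matrix ι ι ℝ :=
  Matrix.of fun i j => ∑ τ : K →+* ℂ, t (InfinitePlace.mk τ) * (τ (b i) * conj (τ (b j))).re

lemma gram_sum_real (b : ι → K) (t : InfinitePlace K → ℝ) (i j : ι) :
    ((gram b t i j : ℝ) : ℂ) = ∑ τ : K →+* ℂ, (t (InfinitePlace.mk τ) : ℂ) * (τ (b i) * conj (τ (b j))) := by
  set S := ∑ τ : K →+* ℂ, (t (InfinitePlace.mk τ) : ℂ) * (τ (b i) * conj (τ (b j))) with hS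
  have h1 : conj S = S := by
    rw [hS, map_sum]
    refine Fintype.sum_equiv (ComplexEmbedding.involutive_conjugate K).toPerm _ _ ?_
    intro τ
    simp [ComplexEmbedding.conjugate]
  have h2 : ((S.re : ℝ) : ℂ) = S := Complex.conj_eq_iff_re.1 h1
  rw [← h2, hS, Complex.re_sum]
  simp [gram]

lemma gram_map (b : ι → K) (t : InfinitePlace K → ℝ) (e : ι ≃ (K →+* ℂ)) :
    (gram b t).map (fun r : ℝ => (r : ℂ)) =
      embMat b e * diagonal (fun i => ((t (InfinitePlace.mk (e i)) : ℝ) : ℂ)) * (embMat b e)ᴴ := by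
  ext i j
  rw [map_apply, gram_sum_real, mul_apply, ← e.sum_comp]
  refine Finset.sum_congr rfl fun l _ => ?_
  simp only [mul_diagonal, conjTranspose_apply, embMat, of_apply, RCLike.star_def]
  ring

lemma gram_quad (b : ι → K) (t : InfinitePlace K → ℝ) (x : ι → ℝ) :
    x ⬝ᵥ gram b t *ᵥ x = ∑ τ : K →+* ℂ, t (InfinitePlace.mk τ) * ‖∑ i, (x i : ℂ) * τ (b i)‖ ^ 2 := by
  have h : ∀ τ : K →+* ℂ, ‖∑ i, (x i : ℂ) * τ (b i)‖ ^ 2 = ∑ i, ∑ j, x i * ((τ (b i) * conj (τ (b j))).re * x j) := by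
    intro τ
    have : (‖∑ i, (x i : ℂ) * τ (b i)‖ ^ 2 : ℝ) = ((∑ i, (x i : ℂ) * τ (b i)) * conj (∑ i, (x i : ℂ) * τ (b i))).re := by
      rw [Complex.mul_conj, Complex.normSq_eq_norm_sq]
      simp [← Complex.ofReal_pow]
    rw [this, map_sum, Finset.sum_mul_sum, Complex.re_sum]
    refine Finset.sum_congr rfl fun i _ => ?_
    rw [Complex.re_sum]
    refine Finset.sum_congr rfl fun j _ => ?_
    simp
    ring
  simp_rw [h, dotProduct, mulVec, dotProduct, gram, of_apply, Finset.mul_sum, Finset.sum_mul, Finset.mul_sum]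
  have h2 : ∀ i : ι, ∑ j, ∑ τ : K →+* ℂ, x i * (t (InfinitePlace.mk τ) * (τ (b i) * conj (τ (b j))).re * x j)
     = ∑ τ : K →+* ℂ, ∑ j, x i * (t (InfinitePlace.mk τ) * (τ (b i) * conj (τ (b j))).re * x j) := fun i => Finset.sum_comm
  simp_rw [h2]
  rw [Finset.sum_comm]
  refine Finset.sum_congr rfl fun τ _ => Finset.sum_congr rfl fun i _ => Finset.sum_congr rfl fun j _ => ?_
  ring

lemma gram_quad_int (b : ι → K) (t : InfinitePlace K → ℝ) (m : ι → ℤ) :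
    (fun i => (m i : ℝ)) ⬝ᵥ gram b t *ᵥ (fun i => (m i : ℝ)) = qf t (∑ i, m i • b i) := by
  rw [gram_quad, qf_eq]
  refine Finset.sum_congr rfl fun τ _ => ?_
  rw [map_sum]
  congr 3
  refine Finset.sum_congr rfl fun i _ => ?_
  rw [zsmul_eq_mul, map_mul, map_intCast]
  simp

lemma embMat_mul_dual (b : Module.Basis ι ℚ K) (e : ι ≃ (K →+* ℂ)) :
    embMat b e * (embMat b.traceDual e)ᵀ = 1 := by
  ext i j
  rw [mul_apply]
  simp only [embMat, of_apply, transpose_apply, ← map_mul]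
  rw [e.sum_comp (fun τ => τ (b i * b.traceDual j))]
  have h := trace_eq_sum_embeddings (K := ℚ) (L := K) ℂ (x := b i * b.traceDual j)
  rw [b.trace_mul_traceDual] at h
  rw [Fintype.sum_equiv (RingHom.equivRatAlgHom K ℂ) (fun f => f (b i * b.traceDual j))
      (fun φ => φ (b i * b.traceDual j)) fun _ => by simp [RingHom.equivRatAlgHom_apply], ← h, one_apply]
  split_ifs <;> simp

lemma det_embMat_ne_zero (b : Module.Basis ι ℚ K) (e : ι ≃ (K →+* ℂ)) : (embMat b e).det ≠ 0 := by
  have := congrArg det (embMat_mul_dual b e)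
  rw [det_mul, det_one] at this
  exact left_ne_zero_of_mul (this ▸ one_ne_zero)

lemma gram_det (b : ι → K) (t : InfinitePlace K → ℝ) (e : ι ≃ (K →+* ℂ)) :
    (gram b t).det = ‖(embMat b e).det‖ ^ 2 * ∏ v : InfinitePlace K, t v ^ v.mult := by
  have h := congrArg det (gram_map b t e)
  rw [det_mul, det_mul, det_diagonal, det_conjTranspose] at h
  have h1 : ((gram b t).map (fun r : ℝ => (r : ℂ))).det = ((gram b t).det : ℝ) :=
    (RingHom.map_det Complex.ofRealHom (gram b t)).symm
  rw [h1] at h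
  have h2 : ∏ i, ((t (InfinitePlace.mk (e i)) : ℝ) : ℂ) = ((∏ v : InfinitePlace K, t v ^ v.mult : ℝ) : ℂ) := by
    rw [← prod_embeddings, ← e.prod_comp]
    push_cast
    rfl
  rw [h2, mul_right_comm, RCLike.star_def, Complex.mul_conj, Complex.normSq_eq_norm_sq] at h
  exact_mod_cast h

lemma gram_posDef (b : Module.Basis ι ℚ K) (e : ι ≃ (K →+* ℂ)) (t : InfinitePlace K → ℝ) (ht : ∀ v, 0 < t v) :
    (gram b t).PosDef := by
  have hs : (gram b t).PosSemidef := by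
    refine PosSemidef.of_dotProduct_mulVec_nonneg ?_ ?_
    · ext i j
      simp only [gram, conjTranspose_apply, of_apply, star_trivial]
      refine Finset.sum_congr rfl fun τ _ => ?_
      simp
      left
      ring
    · intro x
      rw [star_trivial, gram_quad]
      exact Finset.sum_nonneg fun τ _ => mul_nonneg (ht _).le (sq_nonneg _)
  rw [hs.posDef_iff_isUnit, isUnit_iff_isUnit_det, gram_det _ _ e, isUnit_iff_ne_zero]
  have := det_embMat_ne_zero b e
  have h2 : 0 < ∏ v : InfinitePlace K, t v ^ v.mult := Finset.prod_pos fun v _ => pow_pos (ht v) _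
  positivity

lemma gram_inv (b : Module.Basis ι ℚ K) (e : ι ≃ (K →+* ℂ)) (t : InfinitePlace K → ℝ) (ht : ∀ v, 0 < t v) :
    (gram b t)⁻¹ = gram b.traceDual (fun v => (t v)⁻¹) := by
  apply inv_eq_right_inv
  have h := embMat_mul_dual b e
  have h' : (embMat b.traceDual e)ᵀ * embMat b e = 1 := mul_eq_one_comm.1 h
  have hsymm : gram b.traceDual (fun v => (t v)⁻¹) = (gram b.traceDual (fun v => (t v)⁻¹))ᵀ := by
    ext i j
    simp only [gram, transpose_apply, of_apply]
    refine Finset.sum_congr rfl fun τ _ => ?_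
    simp
    left
    ring
  have hinj : Function.Injective (fun A : Matrix ι ι ℝ => A.map (fun r : ℝ => (r : ℂ))) :=
    Matrix.map_injective Complex.ofReal_injective
  apply hinj
  have hm : ∀ A B : Matrix ι ι ℝ, (A * B).map (fun r : ℝ => (r : ℂ)) = A.map (fun r : ℝ => (r : ℂ)) * B.map (fun r : ℝ => (r : ℂ)) :=
    fun A B => Matrix.map_mul (f := Complex.ofRealHom)
  have h1 : (1 : Matrix ι ι ℝ).map (fun r : ℝ => (r : ℂ)) = 1 := Matrix.map_one _ (by simp) (by simp)
  show (gram b t * gram b.traceDual (fun v => (t v)⁻¹)).map (fun r : ℝ => (r : ℂ)) = (1 : Matrix ι ι ℝ).map (fun r : ℝ => (r : ℂ))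
  rw [hm, h1, hsymm, transpose_map, gram_map b t e, gram_map b.traceDual _ e]
  simp only [transpose_mul, diagonal_transpose, conjTranspose]
  set M := embMat b e
  set N := embMat b.traceDual e
  have h3 : (Mᵀ.map star) * ((Nᵀ.map star)ᵀ) = 1 := by
    have := congrArg (fun A : Matrix ι ι ℂ => (Aᵀ).map star) h'
    simp only [transpose_mul, transpose_transpose, transpose_one] at this
    have e1 : ∀ A B : Matrix ι ι ℂ, (A * B).map star = A.map star * B.map star := 
      fun A B => Matrix.map_mul (f := starRingEnd ℂ)
    rw [e1] at this
    have e2 : (Nᵀ.map star)ᵀ = N.map star := rfl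
    rw [e2, this]
    exact Matrix.map_one _ (by simp) (by simp)
  have h4 : diagonal (fun i => ((t (InfinitePlace.mk (e i)) : ℝ) : ℂ)) *
      diagonal (fun i => (((t (InfinitePlace.mk (e i)))⁻¹ : ℝ) : ℂ)) = 1 := by
    rw [diagonal_mul_diagonal, ← diagonal_one]
    congr 1
    ext i
    rw [← Complex.ofReal_mul, mul_inv_cancel₀ (ht _).ne', Complex.ofReal_one]
  calc M * diagonal (fun i => ((t (InfinitePlace.mk (e i)) : ℝ) : ℂ)) * (Mᵀ.map star) *
        ((Nᵀ.map star)ᵀ * (diagonal (fun i => (((t (InfinitePlace.mk (e i)))⁻¹ : ℝ) : ℂ)) * Nᵀ))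
      = M * diagonal (fun i => ((t (InfinitePlace.mk (e i)) : ℝ) : ℂ)) * ((Mᵀ.map star) *
        ((Nᵀ.map star)ᵀ)) * (diagonal (fun i => (((t (InfinitePlace.mk (e i)))⁻¹ : ℝ) : ℂ)) * Nᵀ) := by
          simp only [Matrix.mul_assoc]
    _ = M * (diagonal (fun i => ((t (InfinitePlace.mk (e i)) : ℝ) : ℂ)) * diagonal (fun i => (((t (InfinitePlace.mk (e i)))⁻¹ : ℝ) : ℂ))) * Nᵀ := by
          rw [h3]; simp only [Matrix.mul_assoc, Matrix.one_mul]
    _ = 1 := by rw [h4, Matrix.mul_one, h]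

end nf
end NB
end

section
open MeasureTheory Set Filter Topology

set_option linter.unusedSectionVars false
set_option linter.unusedSimpArgs false
set_option linter.unusedVariables false
namespace NB
open Matrix NumberField
open scoped ComplexConjugate nonZeroDivisors

section nf
variable {K : Type*} [Field K] [NumberField K]

/-- theta series of a fractional ideal -/
noncomputable def theta (I : FractionalIdeal (𝓞 K)⁰ K) (t : InfinitePlace K → ℝ) : ℝ :=
  ∑' x : I, Real.exp (-Real.pi * qf t (x : K))

lemma tsum_span {ι : Type*} [Fintype ι] (b : Module.Basis ι ℚ K) (I : FractionalIdeal (𝓞 K)⁰ K)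
    (hI : ∀ x : K, x ∈ Submodule.span ℤ (Set.range b) ↔ x ∈ I) (f : K → ℝ) :
    (Summable (fun x : I => f x) ↔ Summable (fun m : ι → ℤ => f (∑ i, m i • b i))) ∧
    ∑' x : I, f x = ∑' m : ι → ℤ, f (∑ i, m i • b i) := by
  have hli : LinearIndependent ℤ b := by
    have := b.linearIndependent
    exact this.restrict_scalars (R := ℤ) (by
      intro a c h
      simpa using h)
  let b' := Module.Basis.span hli
  let E : (ι → ℤ) ≃ {x : K // x ∈ I} := (b'.equivFun.symm.toEquiv).trans
    (Equiv.subtypeEquivRight hI)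
  have hE : ∀ m : ι → ℤ, ((E m : {x : K // x ∈ I}) : K) = ∑ i, m i • b i := by
    intro m
    show ((b'.equivFun.symm m : Submodule.span ℤ (Set.range b)) : K) = _
    rw [Module.Basis.equivFun_symm_apply]
    simp only [Submodule.coe_sum, Submodule.coe_smul]
    refine Finset.sum_congr rfl fun i _ => ?_
    rw [Module.Basis.span_apply]
  constructor
  · rw [← E.summable_iff]
    refine summable_congr fun m => ?_
    simp [hE]
  · rw [← E.tsum_eq]
    exact tsum_congr fun m => by rw [hE]

/-- dual ideal as unit -/
noncomputable def dualU (I : (FractionalIdeal (𝓞 K)⁰ K)ˣ) : (FractionalIdeal (𝓞 K)⁰ K)ˣ :=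
  Units.mk0 (FractionalIdeal.dual ℤ ℚ I.1) (FractionalIdeal.dual_ne_zero ℤ ℚ I.ne_zero)

theorem theta_fe (K : Type*) [Field K] [NumberField K] :
    ∃ D : ℝ, 0 < D ∧ ∀ (I : (FractionalIdeal (𝓞 K)⁰ K)ˣ) (t : InfinitePlace K → ℝ) (ht : ∀ v, 0 < t v),
      Summable (fun x : I.1 => Real.exp (-Real.pi * qf t (x : K))) ∧
      theta I.1 t = (D * (FractionalIdeal.absNorm I.1 : ℝ) * √(∏ v : InfinitePlace K, t v ^ v.mult))⁻¹ *
        theta (dualU I).1 (fun v => (t v)⁻¹) := by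
  classical
  let ι := Module.Free.ChooseBasisIndex ℤ (𝓞 K)
  have hcard : Fintype.card ι = Fintype.card (K →+* ℂ) := by
    rw [Embeddings.card, Module.finrank_eq_card_basis (integralBasis K)]
  let e : ι ≃ (K →+* ℂ) := Fintype.equivOfCardEq hcard
  refine ⟨‖(embMat (integralBasis K) e).det‖, norm_pos_iff.2 (det_embMat_ne_zero _ _), ?_⟩
  intro I t ht
  have hc2 : Fintype.card ι = Fintype.card (Module.Free.ChooseBasisIndex ℤ I) := by
    rw [← Module.finrank_eq_card_basis (integralBasis K), ← Module.finrank_eq_card_basis (basisOfFractionalIdeal K I)]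
  let e2 : ι ≃ (Module.Free.ChooseBasisIndex ℤ I) := Fintype.equivOfCardEq hc2
  let b : Module.Basis ι ℚ K := (basisOfFractionalIdeal K I).reindex e2.symm
  have hrange : Set.range b = Set.range (basisOfFractionalIdeal K I) := by
    simp only [b, Module.Basis.range_reindex]
  have hbI : ∀ x : K, x ∈ Submodule.span ℤ (Set.range b) ↔ x ∈ I.1 := by
    intro x
    rw [hrange, mem_span_basisOfFractionalIdeal]
    rfl
  have hbI' : ∀ x : K, x ∈ Submodule.span ℤ (Set.range b.traceDual) ↔ x ∈ (dualU I).1 := by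
    intro x
    have := Submodule.traceDual_span_of_basis (A := ℤ) (K := ℚ) (I : Submodule (𝓞 K) K) b (by
      ext x
      rw [Submodule.restrictScalars_mem, hbI]
      rfl)
    rw [← this, Submodule.restrictScalars_mem, ← FractionalIdeal.coe_dual ℤ ℚ I.ne_zero]
    rfl
  have hdet : ‖(embMat b e).det‖ = ‖(embMat (integralBasis K) e).det‖ * (FractionalIdeal.absNorm I.1 : ℝ) := by
    have h1 : embMat b e = (((integralBasis K).toMatrix b)ᵀ).map (fun r : ℚ => (r : ℂ)) * embMat (integralBasis K) e := by
      ext i j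
      rw [mul_apply]
      simp only [embMat, of_apply, map_apply, transpose_apply, Module.Basis.toMatrix_apply]
      conv_lhs => rw [← (integralBasis K).sum_repr (b i)]
      rw [map_sum]
      refine Finset.sum_congr rfl fun l _ => ?_
      rw [Algebra.smul_def, map_mul]
      simp
    have h2 : ((((integralBasis K).toMatrix b)ᵀ).map (fun r : ℚ => (r : ℂ))).det = (((integralBasis K).det b : ℚ) : ℂ) := by
      have := (RingHom.map_det (algebraMap ℚ ℂ) (((integralBasis K).toMatrix b)ᵀ)).symm
      rw [det_transpose] at this
      rw [Module.Basis.det_apply]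
      exact this
    have h3 := det_basisOfFractionalIdeal_eq_absNorm K I e2
    rw [h1, det_mul, h2, norm_mul, mul_comm, ← h3]
    congr 1
    rw [Complex.norm_ratCast]
    simp [b]
  have hq : ∀ m : ι → ℤ, Real.exp (-Real.pi * ((fun i => (m i : ℝ)) ⬝ᵥ gram b t *ᵥ (fun i => (m i : ℝ))))
      = Real.exp (-Real.pi * qf t (∑ i, m i • b i)) := fun m => by rw [gram_quad_int]
  have hq' : ∀ m : ι → ℤ, Real.exp (-Real.pi * ((fun i => (m i : ℝ)) ⬝ᵥ (gram b t)⁻¹ *ᵥ (fun i => (m i : ℝ))))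
      = Real.exp (-Real.pi * qf (fun v => (t v)⁻¹) (∑ i, m i • b.traceDual i)) := fun m => by
    rw [gram_inv b e t ht, gram_quad_int]
  obtain ⟨hs, hth⟩ := theta_posDef (gram b t) (gram_posDef b e t ht)
  simp_rw [hq] at hs hth
  simp_rw [hq'] at hth
  refine ⟨(tsum_span b I.1 hbI (fun x => Real.exp (-Real.pi * qf t x))).1.2 hs, ?_⟩
  rw [theta, theta, (tsum_span b I.1 hbI (fun x => Real.exp (-Real.pi * qf t x))).2,
    (tsum_span b.traceDual _ hbI' (fun x => Real.exp (-Real.pi * qf (fun v => (t v)⁻¹) x))).2, hth,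
    gram_det b t e, Real.sqrt_mul (by positivity), Real.sqrt_sq (norm_nonneg _), hdet]

end nf
end NB
end

section
open MeasureTheory Set Filter Topology

set_option linter.unusedSectionVars false
set_option linter.unusedSimpArgs false
set_option linter.unusedVariables false
namespace NB
open Matrix NumberField
open scoped ComplexConjugate nonZeroDivisors

section nf
variable {K : Type*} [Field K] [NumberField K]

/-- the logarithmic unit directions -/
noncomputable def ell (c : Fin (Units.rank K) → ℝ) (v : InfinitePlace K) : ℝ :=
  ∑ j, c j * (2 * Real.log (v (Units.fundSystem K j : K)))

lemma ell_add (a b : Fin (Units.rank K) → ℝ) (v : InfinitePlace K) :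
    ell (a + b) v = ell a v + ell b v := by
  simp [ell, add_mul, Finset.sum_add_distrib]

lemma ell_neg (a : Fin (Units.rank K) → ℝ) (v : InfinitePlace K) :
    ell (-a) v = - ell a v := by
  simp [ell, neg_mul, Finset.sum_neg_distrib]

lemma ell_smul (r : ℝ) (a : Fin (Units.rank K) → ℝ) (v : InfinitePlace K) :
    ell (r • a) v = r * ell a v := by
  simp only [ell, Finset.mul_sum, Pi.smul_apply, smul_eq_mul, mul_assoc]

lemma sum_mult_ell (c : Fin (Units.rank K) → ℝ) :
    ∑ v : InfinitePlace K, (v.mult : ℝ) * ell c v = 0 := by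
  simp only [ell, Finset.mul_sum]
  rw [Finset.sum_comm]
  refine Finset.sum_eq_zero fun j _ => ?_
  have := Units.sum_mult_mul_log (Units.fundSystem K j)
  calc _ = (c j * 2) * ∑ v : InfinitePlace K, (v.mult : ℝ) * Real.log (v (Units.fundSystem K j : K)) := by
        rw [Finset.mul_sum]; refine Finset.sum_congr rfl fun v _ => ?_; ring
    _ = 0 := by rw [this, mul_zero]

lemma sum_mult_pos : (0:ℝ) < Module.finrank ℚ K := by exact_mod_cast Module.finrank_pos

lemma sum_mult_vec (s : ℝ) (c : Fin (Units.rank K) → ℝ) :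
    ∑ v : InfinitePlace K, (v.mult : ℝ) * (s + ell c v) = Module.finrank ℚ K * s := by
  simp only [mul_add, Finset.sum_add_distrib, sum_mult_ell, add_zero]
  rw [← Finset.sum_mul, ← Nat.cast_sum, InfinitePlace.sum_mult_eq]

variable (K) in
/-- the linear coordinates -/
noncomputable def vecL : (ℝ × (Fin (Units.rank K) → ℝ)) →ₗ[ℝ] (InfinitePlace K → ℝ) where
  toFun p v := p.1 + ell p.2 v
  map_add' p q := by ext v; simp [ell_add]; ring
  map_smul' r p := by ext v; simp [ell_smul]; ring

lemma vecL_injective : Function.Injective (vecL K) := by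
  classical
  rw [← LinearMap.ker_eq_bot, LinearMap.ker_eq_bot']
  rintro ⟨s, c⟩ h
  have h1 : ∀ v : InfinitePlace K, s + ell c v = 0 := fun v => congrFun h v
  have hs : s = 0 := by
    have := sum_mult_vec s c
    simp only [h1, mul_zero, Finset.sum_const_zero] at this
    have hp := sum_mult_pos (K := K)
    rcases mul_eq_zero.1 this.symm with h | h
    · exact absurd h hp.ne'
    · exact h
  have hli := ((Units.basisUnitLattice K).ofZLatticeBasis ℝ (Units.unitLattice K)).linearIndependent
  rw [Fintype.linearIndependent_iff] at hli
  have hc := hli c (by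
    ext w
    simp only [Finset.sum_apply, Pi.smul_apply, Module.Basis.ofZLatticeBasis_apply,
      ← Units.logEmbedding_fundSystem, Units.dirichletUnitTheorem.logEmbedding_component, smul_eq_mul, Pi.zero_apply]
    have := h1 w.1
    rw [hs, zero_add, ell] at this
    calc _ = (w.1.mult / 2 : ℝ) * ∑ j, c j * (2 * Real.log (w.1 (Units.fundSystem K j : K))) := by
            rw [Finset.mul_sum]; refine Finset.sum_congr rfl fun v _ => ?_; ring
      _ = 0 := by rw [this, mul_zero])
  ext <;> simp [hs, hc]

variable (K) in
/-- the coordinates as equivalence -/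
noncomputable def vecE : (ℝ × (Fin (Units.rank K) → ℝ)) ≃L[ℝ] (InfinitePlace K → ℝ) :=
  (LinearEquiv.ofInjectiveOfFinrankEq (vecL K) vecL_injective (by
    rw [Module.finrank_prod, Module.finrank_self, Module.finrank_fintype_fun_eq_card, Module.finrank_fintype_fun_eq_card, Fintype.card_fin, Units.rank]
    have : 0 < Fintype.card (InfinitePlace K) := Fintype.card_pos
    omega)).toContinuousLinearEquiv

lemma vecE_apply (s : ℝ) (c : Fin (Units.rank K) → ℝ) (v : InfinitePlace K) :
    vecE K (s, c) v = s + ell c v := rfl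

/-- one gaussian term -/
noncomputable def thx (u : InfinitePlace K → ℝ) (x : K) : ℝ :=
  Real.exp (-Real.pi * qf (fun v => Real.exp (u v)) x)

/-- theta in log coordinates -/
noncomputable def th (I : FractionalIdeal (𝓞 K)⁰ K) (u : InfinitePlace K → ℝ) : ℝ :=
  ∑' x : I, thx u (x : K)

lemma th_eq (I : FractionalIdeal (𝓞 K)⁰ K) (u : InfinitePlace K → ℝ) :
    th I u = theta I (fun v => Real.exp (u v)) := rfl

lemma thx_pos (u : InfinitePlace K → ℝ) (x : K) : 0 < thx u x := Real.exp_pos _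

lemma thx_zero (u : InfinitePlace K → ℝ) : thx u (0:K) = 1 := by
  simp [thx, qf]

lemma continuous_thx (x : K) : Continuous (fun u : InfinitePlace K → ℝ => thx u x) := by
  unfold thx qf; fun_prop

lemma summable_thx (I : (FractionalIdeal (𝓞 K)⁰ K)ˣ) (u : InfinitePlace K → ℝ) :
    Summable (fun x : I.1 => thx u (x : K)) := by
  obtain ⟨D, hD, h⟩ := theta_fe K
  exact (h I (fun v => Real.exp (u v)) (fun v => Real.exp_pos _)).1

lemma qf_mono {t t' : InfinitePlace K → ℝ} (h : ∀ v, t v ≤ t' v) (x : K) : qf t x ≤ qf t' x := by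
  unfold qf
  gcongr with v _
  exact h v

lemma thx_anti {t t' : InfinitePlace K → ℝ} (h : ∀ v, t v ≤ t' v) (x : K) : thx t' x ≤ thx t x := by
  unfold thx
  have := qf_mono (fun v => Real.exp_le_exp.2 (h v)) x
  apply Real.exp_le_exp.2
  have := Real.pi_pos
  nlinarith

lemma continuous_th (I : (FractionalIdeal (𝓞 K)⁰ K)ˣ) : Continuous (th I.1) := by
  rw [continuous_iff_continuousAt]
  intro u
  have : ContinuousOn (th I.1) {w : InfinitePlace K → ℝ | ∀ v, u v - 1 < w v} := by
    refine continuousOn_tsum (fun x => (continuous_thx _).continuousOn)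
      (summable_thx I (fun v => u v - 1)) ?_
    intro x w hw
    rw [Real.norm_of_nonneg (thx_pos _ _).le]
    exact thx_anti (fun v => (hw v).le) _
  refine this.continuousAt (IsOpen.mem_nhds ?_ (fun v => by linarith))
  simp only [Set.ofPred_forall]
  exact isOpen_iInter_of_finite fun v => isOpen_lt continuous_const (continuous_apply v)

/-- units given by exponents -/
noncomputable def eps (a : Fin (Units.rank K) → ℤ) : (𝓞 K)ˣ := ∏ j, Units.fundSystem K j ^ a j

lemma qf_mul (u : InfinitePlace K → ℝ) (y x : K) (hy : y ≠ 0) :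
    qf (fun v => Real.exp (u v)) (y * x) = qf (fun v => Real.exp (u v + 2 * Real.log (v y))) x := by
  unfold qf
  refine Finset.sum_congr rfl fun v _ => ?_
  have hv : 0 < v y := InfinitePlace.pos_iff.2 hy
  beta_reduce
  rw [map_mul, Real.exp_add, mul_comm 2, Real.exp_mul, Real.exp_log hv]
  norm_cast
  ring

lemma thx_mul (u : InfinitePlace K → ℝ) (y x : K) (hy : y ≠ 0) :
    thx u (y * x) = thx (fun v => u v + 2 * Real.log (v y)) x := by
  rw [thx, qf_mul u y x hy]; rfl

lemma log_eps (a : Fin (Units.rank K) → ℤ) (v : InfinitePlace K) :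
    2 * Real.log (v (eps a : K)) = ell (fun j => (a j : ℝ)) v := by
  have : v (eps a : K) = ∏ j, v (Units.fundSystem K j : K) ^ a j := by
    simp [eps, Units.coe_prod, Units.coe_zpow]
  rw [this, Real.log_prod, Finset.mul_sum, ell]
  · refine Finset.sum_congr rfl fun j _ => ?_
    rw [Real.log_zpow]; ring
  · intro j _
    refine zpow_ne_zero _ ?_
    simp

lemma thx_unit (u : InfinitePlace K → ℝ) (a : Fin (Units.rank K) → ℤ) (x : K) :
    thx (fun v => u v + ell (fun j => (a j : ℝ)) v) x = thx u ((eps a : K) * x) := by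
  rw [thx_mul _ _ _ (by simp)]
  simp only [log_eps]

lemma thx_torsion (u : InfinitePlace K → ℝ) (ζ : (𝓞 K)ˣ) (hζ : ζ ∈ Units.torsion K) (x : K) :
    thx u ((ζ : K) * x) = thx u x := by
  rw [thx_mul _ _ _ (by simp)]
  simp only [(Units.mem_torsion K).1 hζ, Real.log_one, mul_zero, add_zero]

lemma unit_mul_mem (I : FractionalIdeal (𝓞 K)⁰ K) (ε : (𝓞 K)ˣ) (x : K) :
    (ε : K) * x ∈ I ↔ x ∈ I := by
  have h : ∀ (ε : (𝓞 K)ˣ) (x : K), x ∈ I → (ε : K) * x ∈ I := by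
    intro ε x hx
    have : (ε : K) * x = (ε : 𝓞 K) • x := by rw [Algebra.smul_def]
    rw [this]
    exact Submodule.smul_mem (I : Submodule (𝓞 K) K) _ hx
  refine ⟨fun hx => ?_, h ε x⟩
  have := h ε⁻¹ _ hx
  rwa [← mul_assoc, ← Units.coe_mul, inv_mul_cancel, Units.coe_one, one_mul] at this

/-- multiplication by a unit as an equivalence of a fractional ideal -/
noncomputable def unitEquiv (I : FractionalIdeal (𝓞 K)⁰ K) (ε : (𝓞 K)ˣ) : I ≃ I where
  toFun x := ⟨(ε : K) * x, (unit_mul_mem I ε x).2 x.2⟩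
  invFun x := ⟨((ε⁻¹ : (𝓞 K)ˣ) : K) * x, (unit_mul_mem I _ x).2 x.2⟩
  left_inv x := by
    ext; simp only; rw [← mul_assoc, ← Units.coe_mul, inv_mul_cancel, Units.coe_one, one_mul]
  right_inv x := by
    ext; simp only; rw [← mul_assoc, ← Units.coe_mul, mul_inv_cancel, Units.coe_one, one_mul]

lemma th_unit (I : FractionalIdeal (𝓞 K)⁰ K) (u : InfinitePlace K → ℝ) (a : Fin (Units.rank K) → ℤ) :
    th I (fun v => u v + ell (fun j => (a j : ℝ)) v) = th I u := by
  unfold th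
  refine Eq.trans ?_ ((unitEquiv I (eps a)).tsum_eq (fun x : I => thx u (x:K)))
  refine tsum_congr fun x => ?_
  rw [thx_unit]
  rfl

end nf
end NB
end

section
open MeasureTheory Set Filter Topology

set_option linter.unusedSectionVars false
set_option linter.unusedSimpArgs false
set_option linter.unusedVariables false
namespace NB
open Matrix NumberField
open scoped ComplexConjugate nonZeroDivisors

section nf
variable {K : Type*} [Field K] [NumberField K]

lemma cube_ae_Icc (ι : Type*) [Fintype ι] :
    (cube ι : Set (ι → ℝ)) =ᵐ[volume] Icc (0 : ι → ℝ) 1 := by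
  have : cube ι = Set.pi univ (fun i => Ioc ((0 : ι → ℝ) i) ((1 : ι → ℝ) i)) := by ext; simp [cube]
  rw [this]
  exact Measure.univ_pi_Ioc_ae_eq_Icc

lemma volume_cube (ι : Type*) [Fintype ι] : volume (cube ι) = 1 := by
  rw [measure_congr (cube_ae_Icc ι), Real.volume_Icc_pi]
  simp

lemma integral_cube_neg {ι : Type*} [Fintype ι] (g : (ι → ℝ) → ℝ)
    (hg : ∀ x, g (x + fun _ => 1) = g x) :
    ∫ c in cube ι, g (-c) = ∫ c in cube ι, g c := by
  rw [setIntegral_congr_set (cube_ae_Icc ι), setIntegral_congr_set (cube_ae_Icc ι)]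
  have h := (Measure.measurePreserving_sub_left (volume : Measure (ι → ℝ)) (fun _ => (1:ℝ))).setIntegral_preimage_emb
    (measurableEmbedding_subLeft _) g (Icc 0 1)
  have h2 : (fun x : ι → ℝ => (fun _ => (1:ℝ)) - x) ⁻¹' (Icc 0 1) = Icc 0 1 := by
    ext x
    simp only [mem_preimage, mem_Icc, Pi.le_def, Pi.sub_apply, Pi.zero_apply, Pi.one_apply]
    constructor
    · rintro ⟨h1, h2⟩; exact ⟨fun i => by linarith [h2 i], fun i => by linarith [h1 i]⟩
    · rintro ⟨h1, h2⟩; exact ⟨fun i => by linarith [h2 i], fun i => by linarith [h1 i]⟩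
  rw [h2] at h
  rw [← h]
  congr 1
  ext c
  rw [← hg (-c)]
  congr 1
  ext i; simp; ring

lemma qf_lower (I : (FractionalIdeal (𝓞 K)⁰ K)ˣ) :
    ∃ q0 : ℝ, 0 < q0 ∧ ∀ x : K, x ∈ I.1 → x ≠ 0 → q0 ≤ qf (fun _ => 1) x := by
  have hs := (summable_thx I (fun _ => 0)).tendsto_cofinite_zero
  have hfin : {x : I.1 | ¬ thx (fun _ => 0) (x:K) < Real.exp (-Real.pi)}.Finite :=
    hs.eventually (Iio_mem_nhds (Real.exp_pos _))
  have hpos : ∀ x : K, x ≠ 0 → 0 < qf (fun _ => 1) x := by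
    intro x hx
    refine Finset.sum_pos (fun v _ => ?_) Finset.univ_nonempty
    have := InfinitePlace.pos_iff (w := v).2 hx
    have h2 : (0:ℝ) < v.mult := by exact_mod_cast InfinitePlace.mult_pos
    positivity
  classical
  let S : Finset ℝ := insert 1 ((hfin.toFinset.image (fun x : I.1 => qf (fun _ => 1) (x:K))).filter (0 < ·))
  have hS : S.Nonempty := ⟨1, by simp [S]⟩
  refine ⟨S.min' hS, ?_, fun x hx h0 => ?_⟩
  · have := S.min'_mem hS
    simp only [S, Finset.mem_insert, Finset.mem_filter] at this
    rcases this with h | h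
    · rw [h]; exact one_pos
    · exact h.2
  · by_cases h : thx (fun _ => 0) x < Real.exp (-Real.pi)
    · refine (S.min'_le 1 (by simp [S])).trans ?_
      unfold thx at h
      simp only [Real.exp_zero, Real.exp_lt_exp] at h
      have := Real.pi_pos
      by_contra hlt
      push Not at hlt
      nlinarith
    · refine S.min'_le _ ?_
      simp only [S, Finset.mem_insert, Finset.mem_filter, Finset.mem_image]
      right
      exact ⟨⟨⟨x, hx⟩, by simpa using h, rfl⟩, hpos x h0⟩

lemma qf_scale (s : ℝ) (t : InfinitePlace K → ℝ) (x : K) :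
    qf (fun v => s * t v) x = s * qf t x := by
  unfold qf
  rw [Finset.mul_sum]
  refine Finset.sum_congr rfl fun v _ => by ring

variable (K) in
lemma ell_lower : ∃ B : ℝ, ∀ c ∈ cube (Fin (Units.rank K)), ∀ v : InfinitePlace K, -B ≤ ell c v := by
  refine ⟨∑ v : InfinitePlace K, ∑ j, |2 * Real.log (v (Units.fundSystem K j : K))|, fun c hc v => ?_⟩
  have h1 : ∑ j, |2 * Real.log (v (Units.fundSystem K j : K))| ≤
      ∑ v : InfinitePlace K, ∑ j, |2 * Real.log (v (Units.fundSystem K j : K))| :=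
    Finset.single_le_sum (f := fun v : InfinitePlace K => ∑ j, |2 * Real.log (v (Units.fundSystem K j : K))|)
      (fun v _ => Finset.sum_nonneg fun j _ => abs_nonneg _) (Finset.mem_univ v)
  have h2 : -(∑ j, |2 * Real.log (v (Units.fundSystem K j : K))|) ≤ ell c v := by
    rw [← Finset.sum_neg_distrib, ell]
    refine Finset.sum_le_sum fun j _ => ?_
    have := hc j
    have h3 := neg_abs_le (2 * Real.log (v (Units.fundSystem K j : K)))
    have h4 := abs_nonneg (2 * Real.log (v (Units.fundSystem K j : K)))
    nlinarith [this.1, this.2]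
  linarith

lemma th_sub_one (I : (FractionalIdeal (𝓞 K)⁰ K)ˣ) (u : InfinitePlace K → ℝ) :
    HasSum (fun x : {x : K // x ∈ I.1 ∧ x ≠ 0} => thx u (x:K)) (th I.1 u - 1) := by
  classical
  have h := (summable_thx I u).hasSum
  have hz : (0:K) ∈ I.1 := FractionalIdeal.zero_mem _
  have h0 : HasSum (fun x : I.1 => if (x:K) = 0 then (1:ℝ) else 0) 1 := by
    have := hasSum_single (f := fun x : I.1 => if (x:K) = 0 then (1:ℝ) else 0) ⟨0, hz⟩ (by
      intro x hx
      rw [if_neg (fun h => hx (Subtype.ext h))])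
    simpa using this
  have h1 := h.sub h0
  let i : {x : K // x ∈ I.1 ∧ x ≠ 0} → I.1 := fun x => ⟨x.1, x.2.1⟩
  have hi : Function.Injective i := fun a b hab => Subtype.ext (congrArg (fun y : I.1 => (y:K)) hab)
  have h2 := (hi.hasSum_iff (f := fun x : I.1 => thx u ((x : I.1):K) - if (x:K) = 0 then 1 else 0)
    (a := th I.1 u - 1) (by
      intro x hx
      have : (x:K) = 0 := by
        by_contra hne
        exact hx ⟨⟨x, x.2, hne⟩, rfl⟩
      rw [this, thx_zero]; simp)).2 h1
  have h3 : (fun x : I.1 => thx u ((x : I.1):K) - if (x:K) = 0 then 1 else 0) ∘ i =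
      (fun x : {x : K // x ∈ I.1 ∧ x ≠ 0} => thx u (x:K)) := by
    ext x
    have : ((i x : I.1) : K) ≠ 0 := x.2.2
    simp only [Function.comp_apply, if_neg this, sub_zero]
    rfl
  rwa [h3] at h2

/-- integrated theta function -/
noncomputable def fI (I : FractionalIdeal (𝓞 K)⁰ K) (τ : ℝ) : ℝ :=
  ∫ c in cube (Fin (Units.rank K)), th I (vecE K (τ, c))

lemma continuous_fI (I : (FractionalIdeal (𝓞 K)⁰ K)ˣ) : Continuous (fI I.1) := by
  unfold fI
  simp_rw [setIntegral_congr_set (cube_ae_Icc _)]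
  refine continuous_parametric_integral_of_continuous
    (f := fun τ c => th I.1 (vecE K (τ, c))) ?_ isCompact_Icc
  exact (continuous_th I).comp (vecE K).continuous

lemma integrableOn_th (I : (FractionalIdeal (𝓞 K)⁰ K)ˣ) (τ : ℝ) :
    IntegrableOn (fun c => th I.1 (vecE K (τ, c))) (cube (Fin (Units.rank K))) := by
  rw [integrableOn_congr_set_ae (cube_ae_Icc _)]
  refine Continuous.integrableOn_Icc ?_
  exact (continuous_th I).comp ((vecE K).continuous.comp (by fun_prop))

lemma fI_sub_one (I : (FractionalIdeal (𝓞 K)⁰ K)ˣ) (τ : ℝ) :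
    fI I.1 τ - 1 = ∫ c in cube (Fin (Units.rank K)), (th I.1 (vecE K (τ, c)) - 1) := by
  rw [integral_sub (integrableOn_th I τ) (by simp [integrableOn_const, volume_cube, integrable_const_iff, IsFiniteMeasure, isFiniteMeasure_iff])]
  simp [fI, Measure.real, volume_cube]

lemma th_sub_one_nonneg (I : (FractionalIdeal (𝓞 K)⁰ K)ˣ) (u : InfinitePlace K → ℝ) :
    0 ≤ th I.1 u - 1 := (th_sub_one I u).nonneg fun x => (thx_pos _ _).le

lemma fI_decay (I : (FractionalIdeal (𝓞 K)⁰ K)ˣ) :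
    ∃ C q : ℝ, 0 < q ∧ ∀ t : ℝ, 1 ≤ t → |fI I.1 (Real.log t) - 1| ≤ C * Real.exp (-q * t) := by
  obtain ⟨q0, hq0, hq⟩ := qf_lower I
  obtain ⟨B, hB⟩ := ell_lower K
  set q1 := Real.exp (-B) * q0 with hq1
  have hq1' : 0 < q1 := by positivity
  refine ⟨Real.exp (Real.pi * q1) * (fI I.1 0 - 1), Real.pi * q1, by positivity, fun t ht => ?_⟩
  have ht0 : 0 < t := by linarith
  rw [fI_sub_one, fI_sub_one, abs_of_nonneg (setIntegral_nonneg measurableSet_cube fun c _ => th_sub_one_nonneg I _)]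
  have key : ∀ c ∈ cube (Fin (Units.rank K)), th I.1 (vecE K (Real.log t, c)) - 1 ≤
      (Real.exp (Real.pi * q1) * Real.exp (-(Real.pi * q1) * t)) * (th I.1 (vecE K (0, c)) - 1) := by
    intro c hc
    refine hasSum_le ?_ (th_sub_one I _) ((th_sub_one I _).mul_left _)
    intro x
    have hQ : ∀ s, qf (fun v => Real.exp (vecE K (s, c) v)) (x:K)
        = Real.exp s * qf (fun v => Real.exp (ell c v)) (x:K) := by
      intro s
      rw [← qf_scale]
      congr 1; ext v; rw [vecE_apply, Real.exp_add]
    have hQ1 : q1 ≤ qf (fun v => Real.exp (ell c v)) (x:K) := by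
      calc q1 ≤ Real.exp (-B) * qf (fun _ => 1) (x:K) := by
            rw [hq1]; gcongr; exact hq x x.2.1 x.2.2
        _ = qf (fun _ => Real.exp (-B) * 1) (x:K) := by rw [qf_scale]
        _ ≤ _ := qf_mono (fun v => by rw [mul_one]; exact Real.exp_le_exp.2 (hB c hc v)) _
    unfold thx
    rw [hQ, hQ, Real.exp_log ht0, Real.exp_zero, one_mul, ← Real.exp_add, ← Real.exp_add]
    apply Real.exp_le_exp.2
    have := Real.pi_pos
    have h3 : 0 ≤ (t - 1) * (Real.pi * (qf (fun v => Real.exp (ell c v)) (x:K) - q1)) := by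
      apply mul_nonneg (by linarith)
      apply mul_nonneg this.le (by linarith)
    nlinarith
  calc _ ≤ ∫ c in cube (Fin (Units.rank K)), (Real.exp (Real.pi * q1) * Real.exp (-(Real.pi * q1) * t)) * (th I.1 (vecE K (0, c)) - 1) := by
        refine setIntegral_mono_on ?_ ?_ measurableSet_cube key
        · exact (integrableOn_th I _).sub (by simp [integrableOn_const, volume_cube, integrable_const_iff, IsFiniteMeasure, isFiniteMeasure_iff])
        · exact ((integrableOn_th I _).sub (by simp [integrableOn_const, volume_cube, integrable_const_iff, IsFiniteMeasure, isFiniteMeasure_iff])).const_mul _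
    _ = _ := by rw [integral_const_mul]; ring

lemma fI_bigO (I : (FractionalIdeal (𝓞 K)⁰ K)ˣ) (μ r : ℝ) :
    (fun t => fI I.1 (Real.log t - μ) - 1) =O[atTop] (fun t : ℝ => t ^ r) := by
  obtain ⟨C, q, hq, h⟩ := fI_decay I
  have h1 : (fun t => fI I.1 (Real.log t - μ) - 1) =O[atTop] (fun t : ℝ => Real.exp (-(q * Real.exp (-μ)) * t)) := by
    refine Asymptotics.IsBigO.of_bound C ?_
    filter_upwards [eventually_ge_atTop (Real.exp μ)] with t ht
    have ht0 : 0 < t := (Real.exp_pos _).trans_le ht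
    have h2 := h (t * Real.exp (-μ)) (by
      rw [Real.exp_neg, ← div_eq_mul_inv, one_le_div (Real.exp_pos _)]; exact ht)
    rw [Real.log_mul ht0.ne' (Real.exp_ne_zero _), Real.log_exp, ← sub_eq_add_neg] at h2
    rw [Real.norm_eq_abs, Real.norm_eq_abs, abs_of_pos (Real.exp_pos _)]
    convert h2 using 3
    ring
  refine h1.trans ?_
  exact (isLittleO_exp_neg_mul_rpow_atTop (by positivity) r).isBigO

lemma fI_fe : ∃ D : ℝ, 0 < D ∧ ∀ (I : (FractionalIdeal (𝓞 K)⁰ K)ˣ) (τ : ℝ),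
    fI I.1 τ = (D * (FractionalIdeal.absNorm I.1 : ℝ))⁻¹ * Real.exp (-(Module.finrank ℚ K) * τ / 2)
      * fI (dualU I).1 (-τ) := by
  obtain ⟨D, hD, h⟩ := theta_fe K
  refine ⟨D, hD, fun I τ => ?_⟩
  have h1 : ∀ c, th I.1 (vecE K (τ, c)) = (D * (FractionalIdeal.absNorm I.1 : ℝ))⁻¹ * Real.exp (-(Module.finrank ℚ K) * τ / 2)
      * th (dualU I).1 (vecE K (-τ, -c)) := by
    intro c
    rw [th_eq, (h I _ (fun v => Real.exp_pos _)).2]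
    have h2 : √(∏ v : InfinitePlace K, Real.exp (vecE K (τ, c) v) ^ v.mult) = Real.exp (Module.finrank ℚ K * τ / 2) := by
      have : ∏ v : InfinitePlace K, Real.exp (vecE K (τ, c) v) ^ v.mult = Real.exp (Module.finrank ℚ K * τ) := by
        rw [← sum_mult_vec τ c, Real.exp_sum]
        refine Finset.prod_congr rfl fun v _ => ?_
        rw [vecE_apply, Real.exp_nat_mul]
      rw [this, Real.sqrt_eq_rpow, ← Real.exp_mul]
      congr 1; ring
    rw [h2, mul_inv]
    congr 1
    · rw [← Real.exp_neg]; congr 2; ring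
    · rw [th_eq]
      congr 1
      ext v
      rw [← Real.exp_neg]
      congr 1
      rw [vecE_apply, vecE_apply, ell_neg]; ring
  unfold fI
  rw [setIntegral_congr_fun measurableSet_cube (fun c _ => h1 c), integral_const_mul]
  congr 1
  refine integral_cube_neg (fun c => th (dualU I).1 (vecE K (-τ, c))) ?_
  intro c
  have := th_unit (dualU I).1 (vecE K (-τ, c)) (fun _ => 1)
  rw [← this]
  congr 1
  ext v
  simp only [vecE_apply, ell_add]
  push_cast
  ring

end nf
end NB
end

section
open MeasureTheory Set Filter Topology

set_option linter.unusedSectionVars false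
set_option linter.unusedSimpArgs false
set_option linter.unusedVariables false
namespace NB
open Matrix NumberField
open scoped ComplexConjugate nonZeroDivisors

section nf
variable {K : Type*} [Field K] [NumberField K]

open FractionalIdeal in
lemma spanSingleton_unit (ε : (𝓞 K)ˣ) (x : K) :
    spanSingleton (𝓞 K)⁰ ((ε : K) * x) = spanSingleton (𝓞 K)⁰ x := by
  symm
  rw [spanSingleton_eq_spanSingleton]
  refine ⟨ε, ?_⟩
  rw [Units.smul_def, Algebra.smul_def]

open FractionalIdeal in
lemma exists_gen (R : ClassGroup (𝓞 K) → (FractionalIdeal (𝓞 K)⁰ K)ˣ)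
    (hR : Function.Bijective (fun c => ClassGroup.mk K (R c))) (J : (Ideal (𝓞 K))⁰) :
    ∃ (c : ClassGroup (𝓞 K)) (x : K), x ≠ 0 ∧ x ∈ (R c).1 ∧
      spanSingleton (𝓞 K)⁰ x = ((J : Ideal (𝓞 K)) : FractionalIdeal (𝓞 K)⁰ K) * (R c).1 := by
  obtain ⟨c, hc⟩ := hR.2 (ClassGroup.mk K (FractionalIdeal.mk0 K J))⁻¹
  have h1 : ClassGroup.mk K (FractionalIdeal.mk0 K J * R c) = 1 := by
    rw [map_mul]; simp only at hc; rw [hc, mul_inv_cancel]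
  rw [ClassGroup.mk_eq_one_iff] at h1
  obtain ⟨x, hx⟩ := h1
  have hx' : spanSingleton (𝓞 K)⁰ x = ((J : Ideal (𝓞 K)) : FractionalIdeal (𝓞 K)⁰ K) * (R c).1 := by
    apply coeToSubmodule_injective
    beta_reduce
    rw [coe_spanSingleton]
    exact hx.symm
  refine ⟨c, x, ?_, ?_, hx'⟩
  · rintro rfl
    rw [spanSingleton_zero] at hx'
    exact (FractionalIdeal.mk0 K J * R c).ne_zero hx'.symm
  · have : spanSingleton (𝓞 K)⁰ x ≤ (R c).1 := by
      rw [hx']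
      calc _ ≤ 1 * (R c).1 := mul_left_mono coeIdeal_le_one
        _ = _ := one_mul _
    exact spanSingleton_le_iff_mem.1 this

open FractionalIdeal in
lemma unfold_equiv (R : ClassGroup (𝓞 K) → (FractionalIdeal (𝓞 K)⁰ K)ˣ)
    (hR : Function.Bijective (fun c => ClassGroup.mk K (R c))) :
    ∃ (cc : (Ideal (𝓞 K))⁰ → ClassGroup (𝓞 K)) (xx : (Ideal (𝓞 K))⁰ → K)
      (e : ((Ideal (𝓞 K))⁰ × Units.torsion K × (Fin (Units.rank K) → ℤ)) ≃
        (Σ c : ClassGroup (𝓞 K), {x : K // x ∈ (R c).1 ∧ x ≠ 0})),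
      (∀ J, xx J ≠ 0) ∧
      (∀ J : (Ideal (𝓞 K))⁰, |(Algebra.norm ℚ (xx J) : ℝ)| = Ideal.absNorm (J : Ideal (𝓞 K)) *
        (FractionalIdeal.absNorm (R (cc J)).1 : ℝ)) ∧
      (∀ p, (e p).1 = cc p.1) ∧
      (∀ p, ((e p).2 : K) = ((p.2.1 : (𝓞 K)ˣ) : K) * ((eps p.2.2 : K) * xx p.1)) := by
  choose cc xx h0 hmem hspan using exists_gen R hR
  have hu : ∀ p : ((Ideal (𝓞 K))⁰ × Units.torsion K × (Fin (Units.rank K) → ℤ)),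
      ((p.2.1 : (𝓞 K)ˣ) : K) * ((eps p.2.2 : K) * xx p.1) = (((p.2.1 : (𝓞 K)ˣ) * eps p.2.2 : (𝓞 K)ˣ) : K) * xx p.1 := by
    intro p; rw [Units.coe_mul, mul_assoc]
  let Φ : ((Ideal (𝓞 K))⁰ × Units.torsion K × (Fin (Units.rank K) → ℤ)) →
        (Σ c : ClassGroup (𝓞 K), {x : K // x ∈ (R c).1 ∧ x ≠ 0}) := fun p =>
    ⟨cc p.1, ⟨((p.2.1 : (𝓞 K)ˣ) : K) * ((eps p.2.2 : K) * xx p.1), by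
      rw [hu]; exact ⟨(unit_mul_mem _ _ _).2 (hmem _), mul_ne_zero (by simp) (h0 _)⟩⟩⟩
  have hinj : Function.Injective Φ := by
    intro p p' h
    have h1 : cc p.1 = cc p'.1 := congrArg (fun z => z.1) h
    have h2 : ((p.2.1 : (𝓞 K)ˣ) : K) * ((eps p.2.2 : K) * xx p.1) =
        ((p'.2.1 : (𝓞 K)ˣ) : K) * ((eps p'.2.2 : K) * xx p'.1) := congrArg (fun z => (z.2 : K)) h
    rw [hu, hu] at h2
    have h3 : p.1 = p'.1 := by
      have h4 := congrArg (spanSingleton (𝓞 K)⁰) h2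
      rw [spanSingleton_unit, spanSingleton_unit, hspan, hspan, h1] at h4
      have h5 := mul_right_cancel₀ (R (cc p'.1)).ne_zero h4
      exact Subtype.ext (coeIdeal_injective h5)
    rw [h3] at h2
    have h6 := mul_right_cancel₀ (h0 _) h2
    have h7 : ((p.2.1 : (𝓞 K)ˣ) * eps p.2.2 : (𝓞 K)ˣ) = (p'.2.1 : (𝓞 K)ˣ) * eps p'.2.2 := by
      apply Units.ext
      exact RingOfIntegers.ext h6
    have h8 := (Units.exist_unique_eq_mul_prod K ((p.2.1 : (𝓞 K)ˣ) * eps p.2.2)).unique (y₁ := p.2) (y₂ := p'.2) rfl h7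
    exact Prod.ext h3 h8
  have hsurj : Function.Surjective Φ := by
    rintro ⟨c, x, hx, hx0⟩
    have h1 : spanSingleton (𝓞 K)⁰ x * ((R c)⁻¹).1 ≤ 1 := by
      calc _ ≤ (R c).1 * ((R c)⁻¹).1 := mul_left_mono (spanSingleton_le_iff_mem.2 hx)
        _ = 1 := by rw [← Units.val_mul, mul_inv_cancel, Units.val_one]
    obtain ⟨J, hJ⟩ := le_one_iff_exists_coeIdeal.1 h1
    have hJ' : spanSingleton (𝓞 K)⁰ x = (J : FractionalIdeal (𝓞 K)⁰ K) * (R c).1 := by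
      rw [hJ, mul_assoc, ← Units.val_mul, inv_mul_cancel, Units.val_one, mul_one]
    have hJ0 : J ∈ (Ideal (𝓞 K))⁰ := by
      rw [mem_nonZeroDivisors_iff_ne_zero]
      rintro rfl
      rw [show ((0 : Ideal (𝓞 K)) : FractionalIdeal (𝓞 K)⁰ K) = 0 from coeIdeal_bot, zero_mul, spanSingleton_eq_zero_iff] at hJ'
      exact hx0 hJ'
    have hcl : ∀ (c : ClassGroup (𝓞 K)) (x : K), x ≠ 0 → spanSingleton (𝓞 K)⁰ x = (J : FractionalIdeal (𝓞 K)⁰ K) * (R c).1 →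
        ClassGroup.mk K (R c) = (ClassGroup.mk K (FractionalIdeal.mk0 K ⟨J, hJ0⟩))⁻¹ := by
      intro c x hx0 hJ'
      rw [eq_inv_iff_mul_eq_one, mul_comm, ← map_mul, ClassGroup.mk_eq_one_iff]
      refine ⟨x, ?_⟩
      rw [← coe_spanSingleton (𝓞 K)⁰, hJ']
      rfl
    have hc : cc ⟨J, hJ0⟩ = c := hR.1 ((hcl _ _ (h0 _) (hspan ⟨J, hJ0⟩)).trans (hcl _ _ hx0 hJ').symm)
    have h2 := hspan ⟨J, hJ0⟩
    rw [hc] at h2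
    obtain ⟨ε, hε⟩ := spanSingleton_eq_spanSingleton.1 (h2.trans hJ'.symm)
    obtain ⟨⟨ζ, a⟩, hζ, -⟩ := Units.exist_unique_eq_mul_prod K ε
    refine ⟨⟨⟨J, hJ0⟩, ζ, a⟩, ?_⟩
    subst hc
    simp only [Φ]
    congr 2
    have := hu ⟨⟨J, hJ0⟩, ζ, a⟩
    simp only at this
    rw [this, ← hε, Units.smul_def, Algebra.smul_def]
    rw [show ε = (ζ : (𝓞 K)ˣ) * eps a from hζ]
  refine ⟨cc, xx, Equiv.ofBijective Φ ⟨hinj, hsurj⟩, h0, ?_, fun p => rfl, fun p => rfl⟩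
  intro J
  have := congrArg FractionalIdeal.absNorm (hspan J)
  rw [absNorm_span_singleton, map_mul, coeIdeal_absNorm] at this
  exact_mod_cast this

end nf
end NB
end

section
open MeasureTheory Set Filter Topology

set_option linter.unusedSectionVars false
set_option linter.unusedSimpArgs false
set_option linter.unusedVariables false
namespace NB
open Matrix NumberField
open scoped ComplexConjugate nonZeroDivisors

section nf
variable {K : Type*} [Field K] [NumberField K]

lemma exp_image_univ : Real.exp '' univ = Ioi 0 := by rw [image_univ, Real.range_exp]

lemma lintegral_exp (g : ℝ → ENNReal) :
    ∫⁻ t in Ioi (0:ℝ), g t = ∫⁻ u, ENNReal.ofReal (Real.exp u) * g (Real.exp u) := by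
  rw [← exp_image_univ, lintegral_image_eq_lintegral_abs_deriv_mul MeasurableSet.univ
    (fun x _ => (Real.hasDerivAt_exp x).hasDerivWithinAt) Real.exp_injective.injOn]
  simp [abs_of_pos, Real.exp_pos]

lemma integral_exp_cov (g : ℝ → ℝ) :
    ∫ t in Ioi (0:ℝ), g t = ∫ u, Real.exp u * g (Real.exp u) := by
  rw [← exp_image_univ, integral_image_eq_integral_abs_deriv_smul MeasurableSet.univ
    (fun x _ => (Real.hasDerivAt_exp x).hasDerivWithinAt) Real.exp_injective.injOn]
  simp [abs_of_pos, Real.exp_pos]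

lemma integrable_exp_cov (g : ℝ → ℝ) :
    IntegrableOn g (Ioi (0:ℝ)) ↔ Integrable (fun u => Real.exp u * g (Real.exp u)) := by
  rw [← exp_image_univ, integrableOn_image_iff_integrableOn_abs_deriv_smul MeasurableSet.univ
    (fun x _ => (Real.hasDerivAt_exp x).hasDerivWithinAt) Real.exp_injective.injOn]
  simp [abs_of_pos, Real.exp_pos]

lemma gamma_aux (a b : ℝ) (ha : 0 < a) (hb : 0 < b) :
    Integrable (fun u : ℝ => Real.exp (a * u - b * Real.exp u)) ∧
    ∫ u : ℝ, Real.exp (a * u - b * Real.exp u) = b ^ (-a) * Real.Gamma a := by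
  have h : ∀ u : ℝ, Real.exp u * (fun t : ℝ => t ^ (a - 1) * Real.exp (-(b * t))) (Real.exp u)
      = Real.exp (a * u - b * Real.exp u) := by
    intro u
    simp only
    rw [← Real.exp_mul, ← Real.exp_add, ← Real.exp_add]
    congr 1; ring
  constructor
  · have := (integrable_exp_cov (fun t : ℝ => t ^ (a - 1) * Real.exp (-(b * t)))).1 (by
      have := integrableOn_rpow_mul_exp_neg_mul_rpow (s := a - 1) (p := 1) (by linarith) one_pos hb
      simpa using this)
    simpa only [h] using this
  · have := integral_exp_cov (fun t : ℝ => t ^ (a - 1) * Real.exp (-(b * t)))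
    simp only [h] at this
    rw [← this, Real.integral_rpow_mul_exp_neg_mul_Ioi ha hb, one_div, Real.inv_rpow hb.le, Real.rpow_neg hb.le]

variable (K) in
/-- the gamma factor (real variable, weight normalised) -/
noncomputable def gamR (σ : ℝ) : ℝ := ∏ v : InfinitePlace K,
  (Real.pi * v.mult) ^ (-(σ * v.mult / Module.finrank ℚ K)) * Real.Gamma (σ * v.mult / Module.finrank ℚ K)

variable (K) in
/-- the basic orbit integral -/
noncomputable def Corb (σ : ℝ) : ENNReal :=
  ∫⁻ p : ℝ × (Fin (Units.rank K) → ℝ), ENNReal.ofReal (Real.exp (σ * p.1) * thx (vecE K p) 1)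

lemma mult_pos' (v : InfinitePlace K) : (0:ℝ) < v.mult := by exact_mod_cast InfinitePlace.mult_pos

variable (K) in
lemma Corb_eq : ∃ κ : ℝ, 0 < κ ∧ ∀ σ : ℝ, 0 < σ → Corb K σ = ENNReal.ofReal (κ * gamR K σ) := by
  let μ := Measure.map (vecE K) (volume : Measure (ℝ × (Fin (Units.rank K) → ℝ)))
  have : (volume : Measure (ℝ × (Fin (Units.rank K) → ℝ))).IsAddHaarMeasure := by
    rw [Measure.volume_eq_prod]; infer_instance
  have : μ.IsAddHaarMeasure := (vecE K).isAddHaarMeasure_map _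
  have hμ := Measure.isAddLeftInvariant_eq_smul μ (volume : Measure (InfinitePlace K → ℝ))
  set κ := Measure.addHaarScalarFactor μ (volume : Measure (InfinitePlace K → ℝ)) with hκ
  have hκ0 : 0 < κ := Measure.addHaarScalarFactor_pos_of_isAddHaarMeasure _ _
  refine ⟨κ, hκ0, fun σ hσ => ?_⟩
  have hn := sum_mult_pos (K := K)
  let F : (InfinitePlace K → ℝ) → ℝ := fun u => ∏ v, Real.exp ((σ * v.mult / Module.finrank ℚ K) * u v - (Real.pi * v.mult) * Real.exp (u v))
  have hF : ∀ p : ℝ × (Fin (Units.rank K) → ℝ), Real.exp (σ * p.1) * thx (vecE K p) 1 = F (vecE K p) := by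
    rintro ⟨s, c⟩
    simp only [F]
    rw [← Real.exp_sum, thx, ← Real.exp_add, Finset.sum_sub_distrib]
    congr 1
    have h1 : ∑ v : InfinitePlace K, (σ * v.mult / Module.finrank ℚ K) * vecE K (s, c) v = σ * s := by
      have := sum_mult_vec s c
      calc _ = σ / Module.finrank ℚ K * ∑ v : InfinitePlace K, (v.mult : ℝ) * (s + ell c v) := by
            rw [Finset.mul_sum]; refine Finset.sum_congr rfl fun v _ => ?_
            rw [vecE_apply]; ring
        _ = _ := by rw [this]; field_simp
    rw [h1, qf, Finset.mul_sum, sub_eq_add_neg, ← Finset.sum_neg_distrib]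
    congr 1
    refine Finset.sum_congr rfl fun v _ => ?_
    simp only [map_one]; ring
  have hFm : Measurable (fun u => ENNReal.ofReal (F u)) := by
    have : Continuous F := by simp only [F]; fun_prop
    exact ENNReal.measurable_ofReal.comp this.measurable
  have hInteg : ∀ v : InfinitePlace K, _ := fun v => gamma_aux (σ * v.mult / Module.finrank ℚ K) (Real.pi * v.mult)
    (by have := mult_pos' v; positivity) (by have := mult_pos' v; positivity)
  have hFi : Integrable F := by
    rw [volume_pi]
    exact Integrable.fintype_prod (fun v => (hInteg v).1)
  calc Corb K σ = ∫⁻ p : ℝ × (Fin (Units.rank K) → ℝ), ENNReal.ofReal (F (vecE K p)) := by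
        unfold Corb; simp only [hF]
    _ = ∫⁻ u, ENNReal.ofReal (F u) ∂μ := by
        rw [lintegral_map hFm (vecE K).continuous.measurable]
    _ = κ * ∫⁻ u, ENNReal.ofReal (F u) := by
        rw [hμ, lintegral_smul_measure]; rfl
    _ = κ * ENNReal.ofReal (∫ u, F u) := by
        rw [ofReal_integral_eq_lintegral_ofReal hFi (Eventually.of_forall fun u => Finset.prod_nonneg fun v _ => (Real.exp_pos _).le)]
    _ = _ := by
        have : ∫ u, F u = gamR K σ := by
          simp only [F]
          rw [integral_fintype_prod_volume_eq_prod (fun (v : InfinitePlace K) (u : ℝ) => Real.exp ((σ * v.mult / Module.finrank ℚ K) * u - (Real.pi * v.mult) * Real.exp u))]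
          exact Finset.prod_congr rfl fun v _ => (hInteg v).2
        rw [this, ENNReal.ofReal_mul (by positivity)]
        congr 1
        simp

lemma orbit_translate (σ lam : ℝ) (x : K) (hx : x ≠ 0) :
    ∫⁻ p : ℝ × (Fin (Units.rank K) → ℝ), ENNReal.ofReal (Real.exp (σ * p.1) * thx (vecE K (p.1 - lam, p.2)) x)
      = ENNReal.ofReal (Real.exp (σ * (lam - 2 / Module.finrank ℚ K * Real.log |(Algebra.norm ℚ x : ℝ)|))) * Corb K σ := by
  have hn := sum_mult_pos (K := K)
  obtain ⟨⟨μ, b⟩, hb⟩ := (vecE K).surjective (fun v => 2 * Real.log (v x))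
  have hμ : μ = 2 / Module.finrank ℚ K * Real.log |(Algebra.norm ℚ x : ℝ)| := by
    have h1 := sum_mult_vec μ b
    have h2 : ∀ v : InfinitePlace K, μ + ell b v = 2 * Real.log (v x) := fun v => congrFun hb v
    simp only [h2] at h1
    have h3 : Real.log |(Algebra.norm ℚ x : ℝ)| = ∑ v : InfinitePlace K, (v.mult : ℝ) * Real.log (v x) := by
      have := InfinitePlace.prod_eq_abs_norm x
      rw [← Rat.cast_abs, ← this, Real.log_prod]
      · simp [Real.log_pow]
      · intro v _; exact pow_ne_zero _ (InfinitePlace.pos_iff.2 hx).ne'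
    rw [h3]
    have h4 : ∑ v : InfinitePlace K, (v.mult : ℝ) * (2 * Real.log (v x)) = 2 * ∑ v : InfinitePlace K, (v.mult : ℝ) * Real.log (v x) := by
      rw [Finset.mul_sum]; exact Finset.sum_congr rfl fun v _ => by ring
    rw [h4] at h1
    field_simp
    linarith
  have : (volume : Measure (ℝ × (Fin (Units.rank K) → ℝ))).IsAddHaarMeasure := by
    rw [Measure.volume_eq_prod]; infer_instance
  have key : ∀ p : ℝ × (Fin (Units.rank K) → ℝ), ENNReal.ofReal (Real.exp (σ * p.1) * thx (vecE K (p.1 - lam, p.2)) x)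
      = ENNReal.ofReal (Real.exp (σ * (lam - μ))) * (fun p' : ℝ × (Fin (Units.rank K) → ℝ) =>
        ENNReal.ofReal (Real.exp (σ * p'.1) * thx (vecE K p') 1)) (p + (μ - lam, b)) := by
    rintro ⟨s, c⟩
    simp only [Prod.mk_add_mk]
    rw [← ENNReal.ofReal_mul (Real.exp_pos _).le, ← mul_assoc, ← Real.exp_add]
    congr 2
    · congr 1; ring
    · have := thx_mul (vecE K (s - lam, c)) x 1 hx
      rw [mul_one] at this
      rw [this]
      congr 1
      ext v
      have h2 : μ + ell b v = 2 * Real.log (v x) := congrFun hb v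
      rw [← h2, vecE_apply, vecE_apply, ell_add]; ring
  rw [lintegral_congr key, lintegral_const_mul' _ _ ENNReal.ofReal_ne_top]
  rw [(lintegral_add_right_eq_self (μ := volume) (fun p' : ℝ × (Fin (Units.rank K) → ℝ) =>
        ENNReal.ofReal (Real.exp (σ * p'.1) * thx (vecE K p') 1)) (μ - lam, b)), ← hμ]
  rfl

end nf
end NB
end

section
open MeasureTheory Set Filter Topology

set_option linter.unusedSectionVars false
set_option linter.unusedSimpArgs false
set_option linter.unusedVariables false
namespace NB
open Matrix NumberField
open scoped ComplexConjugate nonZeroDivisors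

section nf
variable {K : Type*} [Field K] [NumberField K]

variable (K) in
lemma countable_K : Countable K := (Module.finBasis ℚ K).equivFun.toEquiv.countable_iff.2 inferInstance

/-- normalising shift -/
noncomputable def lamI (I : (FractionalIdeal (𝓞 K)⁰ K)ˣ) : ℝ :=
  2 / Module.finrank ℚ K * Real.log (FractionalIdeal.absNorm I.1 : ℝ)

/-- the sum over ideal classes of the averaged theta functions -/
noncomputable def FR (R : ClassGroup (𝓞 K) → (FractionalIdeal (𝓞 K)⁰ K)ˣ) (τ : ℝ) : ℝ :=
  ∑ c, fI (R c).1 (τ - lamI (R c))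

lemma ofReal_fI (I : (FractionalIdeal (𝓞 K)⁰ K)ˣ) (τ lam a : ℝ) (ha : 0 ≤ a) :
    ENNReal.ofReal (a * (fI I.1 (τ - lam) - 1)) =
      ∫⁻ y in cube (Fin (Units.rank K)), ∑' x : {x : K // x ∈ I.1 ∧ x ≠ 0},
        ENNReal.ofReal (a * thx (vecE K (τ - lam, y)) x) := by
  rw [fI_sub_one, ← integral_const_mul, ofReal_integral_eq_lintegral_ofReal]
  · refine lintegral_congr fun y => ?_
    have h := (th_sub_one I (vecE K (τ - lam, y))).mul_left a
    rw [← h.tsum_eq, ENNReal.ofReal_tsum_of_nonneg (fun x => mul_nonneg ha (thx_pos _ _).le) h.summable]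
  · refine Integrable.const_mul ?_ _
    refine (integrableOn_th I _).sub ?_
    simp [integrableOn_const, volume_cube, integrable_const_iff, IsFiniteMeasure, isFiniteMeasure_iff]
  · exact Eventually.of_forall fun y => mul_nonneg ha (th_sub_one_nonneg I _)

lemma fI_one_le (I : (FractionalIdeal (𝓞 K)⁰ K)ˣ) (τ : ℝ) : 0 ≤ fI I.1 τ - 1 := by
  rw [fI_sub_one]
  exact integral_nonneg fun c => th_sub_one_nonneg I _

lemma FR_sub (R : ClassGroup (𝓞 K) → (FractionalIdeal (𝓞 K)⁰ K)ˣ) (τ : ℝ) :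
    FR R τ - Fintype.card (ClassGroup (𝓞 K)) = ∑ c, (fI (R c).1 (τ - lamI (R c)) - 1) := by
  simp [FR, Finset.sum_sub_distrib]

lemma FR_sub_nonneg (R : ClassGroup (𝓞 K) → (FractionalIdeal (𝓞 K)⁰ K)ˣ) (τ : ℝ) :
    0 ≤ FR R τ - Fintype.card (ClassGroup (𝓞 K)) := by
  rw [FR_sub]; exact Finset.sum_nonneg fun c _ => fI_one_le _ _

lemma mellin_unfold (R : ClassGroup (𝓞 K) → (FractionalIdeal (𝓞 K)⁰ K)ˣ)
    (hR : Function.Bijective (fun c => ClassGroup.mk K (R c))) (σ : ℝ) :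
    ∫⁻ τ : ℝ, ENNReal.ofReal (Real.exp (σ * τ) * (FR R τ - Fintype.card (ClassGroup (𝓞 K)))) =
      (Units.torsionOrder K : ENNReal) * Corb K σ *
        ∑' J : (Ideal (𝓞 K))⁰, ENNReal.ofReal ((Ideal.absNorm (J : Ideal (𝓞 K)) : ℝ) ^ (-(2 * σ / Module.finrank ℚ K))) := by
  obtain ⟨cc, xx, e, h0, hnorm, he1, he2⟩ := unfold_equiv R hR
  have := countable_K K
  have : Countable ((Ideal (𝓞 K))⁰ × Units.torsion K × (Fin (Units.rank K) → ℤ)) := e.countable_iff.2 inferInstance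
  have : Countable ((Ideal (𝓞 K))⁰) := by
    refine Function.Injective.countable (β := ((Ideal (𝓞 K))⁰ × Units.torsion K × (Fin (Units.rank K) → ℤ))) (f := fun J => (J, 1, 0)) ?_
    intro a b h; simpa using h
  let g : (Σ c : ClassGroup (𝓞 K), {x : K // x ∈ (R c).1 ∧ x ≠ 0}) → ℝ → (Fin (Units.rank K) → ℝ) → ENNReal :=
    fun p τ y => ENNReal.ofReal (Real.exp (σ * τ) * thx (vecE K (τ - lamI (R p.1), y)) p.2)
  let Φ : (Ideal (𝓞 K))⁰ → ℝ → (Fin (Units.rank K) → ℝ) → ENNReal :=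
    fun J τ y => ENNReal.ofReal (Real.exp (σ * τ) * thx (vecE K (τ - lamI (R (cc J)), y)) (xx J))
  have hc1 : ∀ (lam : ℝ) (x : K), Continuous (fun p : ℝ × (Fin (Units.rank K) → ℝ) =>
      Real.exp (σ * p.1) * thx (vecE K (p.1 - lam, p.2)) x) := by
    intro lam x
    have : Continuous (fun p : ℝ × (Fin (Units.rank K) → ℝ) => thx (vecE K (p.1 - lam, p.2)) x) :=
      (continuous_thx x).comp ((vecE K).continuous.comp (by fun_prop))
    fun_prop
  have hgm2 : ∀ p, Measurable (fun z : ℝ × (Fin (Units.rank K) → ℝ) => g p z.1 z.2) := fun p =>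
    ENNReal.measurable_ofReal.comp (hc1 _ _).measurable
  have hgm : ∀ p τ, Measurable (g p τ) := fun p τ => (hgm2 p).comp (g := fun z : ℝ × (Fin (Units.rank K) → ℝ) => g p z.1 z.2) (measurable_const.prodMk measurable_id : Measurable (fun y => (τ, y)))
  have hΦ2 : ∀ J, Measurable (fun z : ℝ × (Fin (Units.rank K) → ℝ) => Φ J z.1 z.2) := fun p =>
    ENNReal.measurable_ofReal.comp (hc1 _ _).measurable
  have hΦm : ∀ J τ, Measurable (Φ J τ) := fun p τ => (hΦ2 p).comp (g := fun z : ℝ × (Fin (Units.rank K) → ℝ) => Φ p z.1 z.2) (measurable_const.prodMk measurable_id : Measurable (fun y => (τ, y)))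
  have hge : ∀ J ζ a τ y, g (e (J, ζ, a)) τ y = Φ J τ (y + fun i => (a i : ℝ)) := by
    intro J ζ a τ y
    simp only [g, Φ]
    rw [he2 (J, ζ, a), he1 (J, ζ, a), thx_torsion _ _ ζ.2, ← thx_unit]
    congr 3
    ext v
    rw [vecE_apply, vecE_apply, ell_add]; ring
  have s1 : ∀ τ, ENNReal.ofReal (Real.exp (σ * τ) * (FR R τ - Fintype.card (ClassGroup (𝓞 K)))) =
      ∑' J, ∑' ζ : Units.torsion K, ∫⁻ y, Φ J τ y := by
    intro τ
    rw [FR_sub, Finset.mul_sum, ENNReal.ofReal_sum_of_nonneg (fun c _ => mul_nonneg (Real.exp_pos _).le (fI_one_le _ _))]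
    simp_rw [ofReal_fI _ τ _ _ (Real.exp_pos _).le]
    rw [← lintegral_finsetSum' _ (fun c _ => by
      refine (Measurable.tsum fun x => ?_).aemeasurable
      exact hgm ⟨c, x⟩ τ)]
    have : ∀ y, ∑ c, ∑' x : {x : K // x ∈ (R c).1 ∧ x ≠ 0},
        ENNReal.ofReal (Real.exp (σ * τ) * thx (vecE K (τ - lamI (R c), y)) x) = ∑' p, g (e p) τ y := by
      intro y
      rw [e.tsum_eq (fun p => g p τ y), ENNReal.tsum_sigma', tsum_fintype]
    rw [lintegral_congr this, lintegral_tsum (fun p => (hgm _ _).aemeasurable), ENNReal.tsum_prod']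
    refine tsum_congr fun J => ?_
    rw [ENNReal.tsum_prod']
    refine tsum_congr fun ζ => ?_
    simp_rw [hge]
    rw [lintegral_eq_tsum_cube]
  rw [lintegral_congr s1]
  have hm3 : ∀ J, Measurable (fun τ => ∫⁻ y, Φ J τ y) := fun J => (hΦ2 J).lintegral_prod_right'
  rw [lintegral_tsum (fun J => (Measurable.tsum fun ζ => hm3 J).aemeasurable), ← ENNReal.tsum_mul_left]
  refine tsum_congr fun J => ?_
  rw [lintegral_tsum (fun ζ => (hm3 J).aemeasurable)]
  have hJ : ∫⁻ τ, ∫⁻ y, Φ J τ y = ENNReal.ofReal ((Ideal.absNorm (J : Ideal (𝓞 K)) : ℝ) ^ (-(2 * σ / Module.finrank ℚ K))) * Corb K σ := by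
    rw [← lintegral_prod (fun z : ℝ × (Fin (Units.rank K) → ℝ) => Φ J z.1 z.2) (hΦ2 J).aemeasurable]
    have := orbit_translate σ (lamI (R (cc J))) (xx J) (h0 J)
    rw [Measure.volume_eq_prod] at this
    refine this.trans ?_
    congr 2
    have hN : (0:ℝ) < Ideal.absNorm (J : Ideal (𝓞 K)) := by
      exact_mod_cast Nat.pos_of_ne_zero (Ideal.absNorm_ne_zero_of_nonZeroDivisors J)
    have hN2 : (FractionalIdeal.absNorm (R (cc J)).1 : ℝ) ≠ 0 := by
      have : FractionalIdeal.absNorm (R (cc J)).1 ≠ 0 := by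
        rw [Ne, FractionalIdeal.absNorm_eq_zero_iff]; exact (R (cc J)).ne_zero
      exact_mod_cast this
    rw [hnorm, Real.log_mul hN.ne' hN2, Real.rpow_def_of_pos hN]
    congr 1
    unfold lamI; ring
  have : Fintype (Units.torsion K) := Fintype.ofFinite _
  rw [hJ, tsum_fintype, Finset.sum_const, nsmul_eq_mul]
  have : ((Finset.univ : Finset (Units.torsion K)).card : ENNReal) = (Units.torsionOrder K : ENNReal) := by
    simp [Units.torsionOrder]
  rw [this]
  ring

end nf
end NB
end

section
open MeasureTheory Set Filter Topology

set_option linter.unusedSectionVars false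
set_option linter.unusedSimpArgs false
set_option linter.unusedVariables false
namespace NB
open Matrix NumberField
open scoped ComplexConjugate nonZeroDivisors

section nf
variable {K : Type*} [Field K] [NumberField K]

lemma dualU_eq (I : (FractionalIdeal (𝓞 K)⁰ K)ˣ) : dualU I = dualU 1 * I⁻¹ := by
  ext1
  simp only [dualU, Units.val_mk0, Units.val_mul, Units.val_one, Units.val_inv_eq_inv_val]
  exact FractionalIdeal.dual_eq_mul_inv ℤ ℚ _

variable (K) in
lemma exists_R : ∃ R : ClassGroup (𝓞 K) → (FractionalIdeal (𝓞 K)⁰ K)ˣ,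
    Function.Bijective (fun c => ClassGroup.mk K (R c)) := by
  have hs : Function.Surjective (ClassGroup.mk K (R := 𝓞 K)) := by
    intro c
    exact ClassGroup.induction K (P := fun c => ∃ a, ClassGroup.mk K a = c) (fun I => ⟨I, rfl⟩) c
  choose R hR using hs
  refine ⟨R, ?_⟩
  have : (fun c => ClassGroup.mk K (R c)) = id := funext hR
  rw [this]; exact Function.bijective_id

lemma dual_bij (R : ClassGroup (𝓞 K) → (FractionalIdeal (𝓞 K)⁰ K)ˣ)
    (hR : Function.Bijective (fun c => ClassGroup.mk K (R c))) :
    Function.Bijective (fun c => ClassGroup.mk K ((dualU ∘ R) c)) := by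
  have : (fun c => ClassGroup.mk K ((dualU ∘ R) c)) = (fun x => ClassGroup.mk K (dualU (1 : (FractionalIdeal (𝓞 K)⁰ K)ˣ)) * x) ∘ (fun x => x⁻¹) ∘ (fun c => ClassGroup.mk K (R c)) := by
    ext c
    simp only [Function.comp]
    rw [dualU_eq, map_mul, map_inv]
  rw [this]
  exact (Group.mulLeft_bijective _).comp ((Equiv.inv _).bijective.comp hR)

lemma absNormU_pos (I : (FractionalIdeal (𝓞 K)⁰ K)ˣ) : (0:ℝ) < (FractionalIdeal.absNorm I.1 : ℝ) := by
  have h1 : FractionalIdeal.absNorm I.1 ≠ 0 := by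
    rw [Ne, FractionalIdeal.absNorm_eq_zero_iff]; exact I.ne_zero
  have h2 := FractionalIdeal.absNorm_nonneg I.1
  exact_mod_cast lt_of_le_of_ne h2 h1.symm

lemma lamI_dual (I : (FractionalIdeal (𝓞 K)⁰ K)ˣ) : lamI (dualU I) = lamI (dualU (1 : (FractionalIdeal (𝓞 K)⁰ K)ˣ)) - lamI I := by
  have h : (FractionalIdeal.absNorm (dualU I).1 : ℝ) = (FractionalIdeal.absNorm (dualU (1 : (FractionalIdeal (𝓞 K)⁰ K)ˣ)).1 : ℝ) * (FractionalIdeal.absNorm I.1 : ℝ)⁻¹ := by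
    rw [dualU_eq I, Units.val_mul, map_mul, Units.val_inv_eq_inv_val, map_inv₀]
    push_cast; rfl
  unfold lamI
  rw [h, Real.log_mul (absNormU_pos _).ne' (inv_ne_zero (absNormU_pos _).ne'), Real.log_inv]
  ring

variable (K) in
lemma FR_fe : ∃ D Δ : ℝ, 0 < D ∧ ∀ (R : ClassGroup (𝓞 K) → (FractionalIdeal (𝓞 K)⁰ K)ˣ) (τ : ℝ),
    FR R τ = D⁻¹ * Real.exp (-(Module.finrank ℚ K) * τ / 2) * FR (dualU ∘ R) (Δ - τ) := by
  obtain ⟨D, hD, h⟩ := fI_fe (K := K)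
  refine ⟨D, lamI (dualU (1 : (FractionalIdeal (𝓞 K)⁰ K)ˣ)), hD, fun R τ => ?_⟩
  unfold FR
  rw [Finset.mul_sum]
  refine Finset.sum_congr rfl fun c _ => ?_
  rw [h]
  simp only [Function.comp]
  rw [lamI_dual (R c)]
  have hn := sum_mult_pos (K := K)
  have hN := absNormU_pos (R c)
  have h2 : Real.exp (-(Module.finrank ℚ K) * (τ - lamI (R c)) / 2) =
      Real.exp (-(Module.finrank ℚ K) * τ / 2) * (FractionalIdeal.absNorm (R c).1 : ℝ) := by
    have : (FractionalIdeal.absNorm (R c).1 : ℝ) = Real.exp (Module.finrank ℚ K * lamI (R c) / 2) := by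
      unfold lamI
      rw [show (Module.finrank ℚ K : ℝ) * (2 / Module.finrank ℚ K * Real.log (FractionalIdeal.absNorm (R c).1 : ℝ)) / 2 = Real.log (FractionalIdeal.absNorm (R c).1 : ℝ) by field_simp, Real.exp_log hN]
    rw [this, ← Real.exp_add]; congr 1; ring
  rw [h2, mul_inv]
  rw [show lamI (dualU (1 : (FractionalIdeal (𝓞 K)⁰ K)ˣ)) - τ - (lamI (dualU (1 : (FractionalIdeal (𝓞 K)⁰ K)ˣ)) - lamI (R c)) = -(τ - lamI (R c)) by ring]
  field_simp

lemma continuous_FR (R : ClassGroup (𝓞 K) → (FractionalIdeal (𝓞 K)⁰ K)ˣ) : Continuous (FR R) := by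
  unfold FR
  refine continuous_finsetSum _ fun c _ => (continuous_fI (R c)).comp (by fun_prop)

lemma FR_locInt (R : ClassGroup (𝓞 K) → (FractionalIdeal (𝓞 K)⁰ K)ˣ) (Δ : ℝ) :
    LocallyIntegrableOn (fun t : ℝ => ((FR R (Real.log t + Δ) : ℝ) : ℂ)) (Ioi 0) := by
  refine ContinuousOn.locallyIntegrableOn ?_ measurableSet_Ioi
  refine Complex.continuous_ofReal.comp_continuousOn ((continuous_FR R).comp_continuousOn ?_)
  exact (Real.continuousOn_log.mono (fun x (hx : 0 < x) => hx.ne')).add continuousOn_const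

lemma FR_bigO (R : ClassGroup (𝓞 K) → (FractionalIdeal (𝓞 K)⁰ K)ˣ) (Δ r : ℝ) :
    (fun t : ℝ => ((FR R (Real.log t + Δ) : ℝ) : ℂ) - (Fintype.card (ClassGroup (𝓞 K)) : ℂ)) =O[atTop] (fun t : ℝ => t ^ r) := by
  have : (fun t : ℝ => ((FR R (Real.log t + Δ) : ℝ) : ℂ) - (Fintype.card (ClassGroup (𝓞 K)) : ℂ)) =
      fun t => (((∑ c, (fI (R c).1 (Real.log t - (lamI (R c) - Δ)) - 1)) : ℝ) : ℂ) := by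
    ext t
    have := FR_sub R (Real.log t + Δ)
    rw [show (∑ c, (fI (R c).1 (Real.log t - (lamI (R c) - Δ)) - 1)) = FR R (Real.log t + Δ) - Fintype.card (ClassGroup (𝓞 K)) by
      rw [this]; refine Finset.sum_congr rfl fun c _ => ?_
      congr 2; ring]
    push_cast; rfl
  rw [this, ← Asymptotics.isBigO_norm_left]
  simp_rw [Complex.norm_real, Asymptotics.isBigO_norm_left]
  exact Asymptotics.IsBigO.fun_sum fun c _ => fI_bigO (R c) _ r

/-- the FE pair -/
noncomputable def feP (R : ClassGroup (𝓞 K) → (FractionalIdeal (𝓞 K)⁰ K)ˣ) (D Δ : ℝ) (hD : 0 < D)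
    (h : ∀ τ : ℝ, FR R τ = D⁻¹ * Real.exp (-(Module.finrank ℚ K) * τ / 2) * FR (dualU ∘ R) (Δ - τ)) :
    WeakFEPair ℂ where
  f t := ((FR R (Real.log t + 0) : ℝ) : ℂ)
  g t := ((FR (dualU ∘ R) (Real.log t + Δ) : ℝ) : ℂ)
  k := Module.finrank ℚ K / 2
  ε := (D⁻¹ : ℝ)
  f₀ := Fintype.card (ClassGroup (𝓞 K))
  g₀ := Fintype.card (ClassGroup (𝓞 K))
  hf_int := FR_locInt R 0
  hg_int := FR_locInt _ Δ
  hk := by have := sum_mult_pos (K := K); positivity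
  hε := by exact_mod_cast (inv_pos.2 hD).ne'
  h_feq := by
    intro x hx
    have hx : 0 < x := hx
    rw [h, one_div, Real.log_inv, smul_eq_mul, Real.rpow_def_of_pos hx]
    rw [show Δ - (-Real.log x + 0) = Real.log x + Δ by ring]
    push_cast
    congr 3
    ring_nf
  hf_top r := FR_bigO R 0 r
  hg_top r := FR_bigO _ Δ r

lemma mellin_real (R : ClassGroup (𝓞 K) → (FractionalIdeal (𝓞 K)⁰ K)ˣ) (Δ σ : ℝ) (hc : MellinConvergent (fun t : ℝ => ((FR R (Real.log t + Δ) : ℝ) : ℂ) - (Fintype.card (ClassGroup (𝓞 K)) : ℂ)) σ) :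
    ∃ M : ℝ, 0 ≤ M ∧ mellin (fun t : ℝ => ((FR R (Real.log t + Δ) : ℝ) : ℂ) - (Fintype.card (ClassGroup (𝓞 K)) : ℂ)) σ = (M : ℂ) ∧
      ENNReal.ofReal M = ENNReal.ofReal (Real.exp (-σ * Δ)) * ∫⁻ τ : ℝ, ENNReal.ofReal (Real.exp (σ * τ) * (FR R τ - Fintype.card (ClassGroup (𝓞 K)))) := by
  let φ : ℝ → ℝ := fun t => t ^ (σ - 1) * (FR R (Real.log t + Δ) - Fintype.card (ClassGroup (𝓞 K)))
  have hφ : EqOn (fun t : ℝ => (t : ℂ) ^ ((σ : ℂ) - 1) • (((FR R (Real.log t + Δ) : ℝ) : ℂ) - (Fintype.card (ClassGroup (𝓞 K)) : ℂ)))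
      (fun t => ((φ t : ℝ) : ℂ)) (Ioi 0) := by
    intro t ht
    simp only [φ, smul_eq_mul]
    rw [Complex.ofReal_mul, Complex.ofReal_cpow (le_of_lt ht)]
    push_cast; rfl
  have hi : IntegrableOn φ (Ioi 0) := by
    have h1 : IntegrableOn (fun t => ((φ t : ℝ) : ℂ)) (Ioi 0) := hc.congr_fun hφ measurableSet_Ioi
    have := h1.re
    simp only [RCLike.re_to_complex, Complex.ofReal_re] at this
    exact this
  have hpos : ∀ t ∈ Ioi (0:ℝ), 0 ≤ φ t := fun t ht => mul_nonneg (Real.rpow_nonneg (le_of_lt ht) _) (FR_sub_nonneg _ _)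
  refine ⟨∫ t in Ioi 0, φ t, setIntegral_nonneg measurableSet_Ioi hpos, ?_, ?_⟩
  · rw [mellin, setIntegral_congr_fun measurableSet_Ioi hφ]
    exact integral_ofReal
  · rw [ofReal_integral_eq_lintegral_ofReal hi ((ae_restrict_iff' measurableSet_Ioi).2 (Eventually.of_forall hpos)), lintegral_exp]
    have h1 : ∀ u : ℝ, ENNReal.ofReal (Real.exp u) * ENNReal.ofReal (φ (Real.exp u)) =
        ENNReal.ofReal (Real.exp (-σ * Δ)) * (fun τ => ENNReal.ofReal (Real.exp (σ * τ) * (FR R τ - Fintype.card (ClassGroup (𝓞 K))))) (u + Δ) := by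
      intro u
      simp only [φ]
      rw [← ENNReal.ofReal_mul (Real.exp_pos _).le, ← ENNReal.ofReal_mul (Real.exp_pos _).le, Real.log_exp,
        ← Real.exp_mul, ← mul_assoc, ← mul_assoc, ← Real.exp_add, ← Real.exp_add]
      congr 3; ring
    rw [lintegral_congr h1, lintegral_const_mul' _ _ ENNReal.ofReal_ne_top]
    rw [lintegral_add_right_eq_self (μ := volume) (fun τ : ℝ => ENNReal.ofReal (Real.exp (σ * τ) * (FR R τ - Fintype.card (ClassGroup (𝓞 K))))) Δ]

end nf
end NB
end

section
open MeasureTheory Set Filter Topology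

set_option linter.unusedSectionVars false
set_option linter.unusedSimpArgs false
set_option linter.unusedVariables false
namespace NB
open Matrix NumberField
open scoped ComplexConjugate nonZeroDivisors

section nf
variable {K : Type*} [Field K] [NumberField K]

lemma ident_real {U : Set ℂ} (hU : IsOpen U) (hc : IsPreconnected U) {f g : ℂ → ℂ}
    (hf : DifferentiableOn ℂ f U) (hg : DifferentiableOn ℂ g U) (a b : ℝ) (hab : a < b) (hb : (b : ℂ) ∈ U)
    (h : ∀ σ : ℝ, a < σ → f σ = g σ) : EqOn f g U := by
  refine (hf.analyticOnNhd hU).eqOn_of_preconnected_of_frequently_eq (hg.analyticOnNhd hU) hc hb ?_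
  have ht : Tendsto (fun x : ℝ => (x : ℂ)) (𝓝[≠] b) (𝓝[≠] (b : ℂ)) := by
    refine tendsto_nhdsWithin_iff.2 ⟨?_, ?_⟩
    · exact (Complex.continuous_ofReal.tendsto b).mono_left nhdsWithin_le_nhds
    · filter_upwards [self_mem_nhdsWithin] with x hx
      simpa using hx
  refine ht.frequently ?_
  refine Eventually.frequently ?_
  filter_upwards [mem_nhdsWithin_of_mem_nhds (lt_mem_nhds hab)] with x hx
  exact h x hx

lemma compl_pair_preconnected (a b : ℂ) : IsPreconnected ({a, b}ᶜ : Set ℂ) :=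
  ((Set.toFinite {a, b}).countable.isPathConnected_compl_of_one_lt_rank (by
    rw [Complex.rank_real_complex]; norm_num)).isConnected.isPreconnected

lemma strip_bound (f : ℝ → ℂ) (a b : ℝ) (ha : MellinConvergent f a) (hb : MellinConvergent f b) :
    ∃ C, ∀ s : ℂ, a ≤ s.re → s.re ≤ b → ‖mellin f s‖ ≤ C := by
  have key : ∀ c : ℝ, ∀ t ∈ Ioi (0:ℝ), ∀ s : ℂ, s.re = c → ‖(t:ℂ) ^ (s - 1) • f t‖ = t ^ (c - 1) * ‖f t‖ := by
    intro c t ht s hs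
    rw [norm_smul, Complex.norm_cpow_eq_rpow_re_of_pos ht]
    simp [hs]
  have h1 : ∀ c : ℝ, MellinConvergent f c → IntegrableOn (fun t : ℝ => t ^ (c - 1) * ‖f t‖) (Ioi 0) := by
    intro c hc
    exact IntegrableOn.congr_fun (Integrable.norm hc) (fun t ht => key c t ht c (by simp)) measurableSet_Ioi
  refine ⟨∫ t in Ioi (0:ℝ), (t ^ (a - 1) * ‖f t‖ + t ^ (b - 1) * ‖f t‖), fun s hs1 hs2 => ?_⟩
  refine norm_integral_le_of_norm_le ((h1 a ha).add (h1 b hb)) ?_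
  refine (ae_restrict_iff' measurableSet_Ioi).2 (Eventually.of_forall fun t ht => ?_)
  rw [key s.re t ht s rfl, ← add_mul]
  refine mul_le_mul_of_nonneg_right ?_ (norm_nonneg _)
  have ht : 0 < t := ht
  rcases le_total 1 t with h | h
  · have := Real.rpow_le_rpow_of_exponent_le h (show s.re - 1 ≤ b - 1 by linarith)
    have := Real.rpow_nonneg ht.le (a - 1)
    linarith
  · have := Real.rpow_le_rpow_of_exponent_ge ht h (show a - 1 ≤ s.re - 1 by linarith)
    have := Real.rpow_nonneg ht.le (b - 1)
    linarith

variable (K) in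
lemma exists_completed : ∃ (P : ℂ → ℂ) (A B M ε Δ : ℝ), Differentiable ℂ P ∧ 0 < A ∧ 0 < B ∧ 0 < M ∧ 0 < ε ∧
    (∀ σ : ℝ, 1 < σ → Summable (fun J : (Ideal (𝓞 K))⁰ => (Ideal.absNorm (J : Ideal (𝓞 K)) : ℝ) ^ (-σ)) ∧
      P σ - A / σ - B / (1 - σ) = ((M * gamR K (Module.finrank ℚ K * σ / 2) *
        ∑' J : (Ideal (𝓞 K))⁰, (Ideal.absNorm (J : Ideal (𝓞 K)) : ℝ) ^ (-σ) : ℝ) : ℂ)) ∧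
    (∀ s : ℂ, s ≠ 0 → s ≠ 1 → P (1 - s) - A / (1 - s) - B / s = ε * Complex.exp (-Δ * s) * (P s - A / s - B / (1 - s))) ∧
    (∀ a b : ℝ, ∃ C, ∀ s : ℂ, a ≤ s.re → s.re ≤ b → ‖P s‖ ≤ C) := by
  obtain ⟨R, hR⟩ := exists_R K
  obtain ⟨D, Δ, hD, hfe⟩ := FR_fe K
  obtain ⟨κ, hκ, hCorb⟩ := Corb_eq K
  let Q := feP R D Δ hD (hfe R)
  have hn := sum_mult_pos (K := K)
  set n : ℝ := (Module.finrank ℚ K : ℝ) with hndef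
  set h : ℕ := Fintype.card (ClassGroup (𝓞 K)) with hh
  have hhpos : (0:ℝ) < h := by
    have : 0 < h := Fintype.card_pos
    exact_mod_cast this
  set w : ℕ := Units.torsionOrder K with hw
  have hwpos : (0:ℝ) < w := by
    have : 0 < w := Units.torsionOrder_pos K
    exact_mod_cast this
  have hnC : (n : ℂ) ≠ 0 := by exact_mod_cast hn.ne'
  have hgam : ∀ σ : ℝ, 0 < σ → 0 < gamR K σ := by
    intro σ hσ
    refine Finset.prod_pos fun v _ => mul_pos ?_ ?_
    · have := mult_pos' v; positivity
    · have := mult_pos' v; exact Real.Gamma_pos_of_pos (by positivity)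
  -- real values
  have hreal : ∀ σ : ℝ, 1 < σ → Summable (fun J : (Ideal (𝓞 K))⁰ => (Ideal.absNorm (J : Ideal (𝓞 K)) : ℝ) ^ (-σ)) ∧
      Q.Λ (n * σ / 2 : ℝ) = ((w * κ * gamR K (n * σ / 2) *
        ∑' J : (Ideal (𝓞 K))⁰, (Ideal.absNorm (J : Ideal (𝓞 K)) : ℝ) ^ (-σ) : ℝ) : ℂ) ∧
      Q.symm.Λ (n * σ / 2 : ℝ) = Complex.exp (-Δ * (n * σ / 2 : ℝ)) * Q.Λ (n * σ / 2 : ℝ) := by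
    intro σ hσ
    have hk : Q.k < ((n * σ / 2 : ℝ) : ℂ).re := by
      change n / 2 < _
      rw [Complex.ofReal_re]; nlinarith
    have hσ0 : 0 < n * σ / 2 := by positivity
    have hm1 := Q.hasMellin hk
    have hm2 := Q.symm.hasMellin (s := ((n * σ / 2 : ℝ) : ℂ)) hk
    obtain ⟨M1, hM1, e1, i1⟩ := mellin_real R 0 (n * σ / 2) hm1.1
    obtain ⟨M2, hM2, e2, i2⟩ := mellin_real (dualU ∘ R) Δ (n * σ / 2) hm2.1
    rw [mellin_unfold _ hR, hCorb _ hσ0] at i1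
    rw [mellin_unfold _ (dual_bij R hR), hCorb _ hσ0] at i2
    have hexp : 2 * (n * σ / 2) / n = σ := by field_simp
    rw [hexp] at i1 i2
    simp only [mul_zero, Real.exp_zero, ENNReal.ofReal_one, one_mul] at i1
    have hg := hgam _ hσ0
    have hsum : Summable (fun J : (Ideal (𝓞 K))⁰ => (Ideal.absNorm (J : Ideal (𝓞 K)) : ℝ) ^ (-σ)) := by
      refine (ENNReal.summable_toReal (f := fun J : (Ideal (𝓞 K))⁰ => ENNReal.ofReal ((Ideal.absNorm (J : Ideal (𝓞 K)) : ℝ) ^ (-σ))) ?_).congr (fun J => ENNReal.toReal_ofReal (Real.rpow_nonneg (Nat.cast_nonneg _) _))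
      intro htop
      rw [htop, ENNReal.mul_top] at i1
      · exact ENNReal.ofReal_ne_top i1
      · refine mul_ne_zero ?_ ?_
        · exact_mod_cast (Units.torsionOrder_ne_zero K)
        · simp only [ne_eq, ENNReal.ofReal_eq_zero, not_le]; positivity
    have hts : ∑' J : (Ideal (𝓞 K))⁰, ENNReal.ofReal ((Ideal.absNorm (J : Ideal (𝓞 K)) : ℝ) ^ (-σ)) =
        ENNReal.ofReal (∑' J : (Ideal (𝓞 K))⁰, (Ideal.absNorm (J : Ideal (𝓞 K)) : ℝ) ^ (-σ)) := 
      (ENNReal.ofReal_tsum_of_nonneg (fun J => Real.rpow_nonneg (Nat.cast_nonneg _) _) hsum).symm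
    have hSpos : 0 ≤ ∑' J : (Ideal (𝓞 K))⁰, (Ideal.absNorm (J : Ideal (𝓞 K)) : ℝ) ^ (-σ) := tsum_nonneg fun J => Real.rpow_nonneg (Nat.cast_nonneg _) _
    have hw' : (w : ENNReal) = ENNReal.ofReal (w : ℝ) := by simp
    rw [hts, ← hw, hw', ← ENNReal.ofReal_mul (by positivity), ← ENNReal.ofReal_mul (by positivity)] at i1 i2
    rw [← ENNReal.ofReal_mul (by positivity)] at i2
    rw [ENNReal.ofReal_eq_ofReal_iff hM1 (by positivity)] at i1
    rw [ENNReal.ofReal_eq_ofReal_iff hM2 (by positivity)] at i2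
    have e1' : Q.Λ (n * σ / 2 : ℝ) = (M1 : ℂ) := hm1.2.symm.trans e1
    have e2' : Q.symm.Λ (n * σ / 2 : ℝ) = (M2 : ℂ) := hm2.2.symm.trans e2
    refine ⟨hsum, ?_, ?_⟩
    · rw [e1', i1]; congr 1; ring
    · rw [e1', e2', i1, i2]; push_cast
      congr 2; ring
  have hU : IsOpen ({0, ((n / 2 : ℝ) : ℂ)}ᶜ : Set ℂ) := (Set.toFinite _).isClosed.isOpen_compl
  have hsym : ∀ s : ℂ, s ≠ 0 → s ≠ ((n / 2 : ℝ) : ℂ) → Q.symm.Λ s = Complex.exp (-Δ * s) * Q.Λ s := by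
    have := ident_real hU (compl_pair_preconnected _ _) (f := Q.symm.Λ) (g := fun s => Complex.exp (-Δ * s) * Q.Λ s)
      (fun s hs => by
        simp only [mem_compl_iff, mem_insert_iff, mem_singleton_iff, not_or] at hs
        exact (Q.symm.differentiableAt_Λ (Or.inl hs.1) (Or.inl hs.2)).differentiableWithinAt)
      (fun s hs => by
        simp only [mem_compl_iff, mem_insert_iff, mem_singleton_iff, not_or] at hs
        have : DifferentiableAt ℂ (fun s : ℂ => Complex.exp (-Δ * s)) s := by fun_prop
        exact (this.mul (Q.differentiableAt_Λ (Or.inl hs.1) (Or.inl hs.2))).differentiableWithinAt)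
      (n / 2) n (by linarith) (by
        simp only [mem_compl_iff, mem_insert_iff, mem_singleton_iff, not_or]
        refine ⟨hnC, ?_⟩
        norm_cast; intro h; linarith)
      (fun σ hσ => by
        have := (hreal (2 * σ / n) (by rw [lt_div_iff₀ hn]; linarith)).2.2
        rw [show n * (2 * σ / n) / 2 = σ by field_simp] at this
        exact this)
    intro s h1 h2
    exact this (by
      simp only [mem_compl_iff, mem_insert_iff, mem_singleton_iff, not_or]
      exact ⟨h1, h2⟩)
  have hΛ : ∀ s : ℂ, Q.Λ (n * s / 2) = Q.Λ₀ (n * s / 2) - ((2 * h / n : ℝ) : ℂ) / s - ((2 * h * D⁻¹ / n : ℝ) : ℂ) / (1 - s) := by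
    intro s
    unfold WeakFEPair.Λ
    have hk : (Q.k : ℂ) = n / 2 := by change ((n / 2 : ℝ) : ℂ) = _; push_cast; rfl
    have h1 : Q.f₀ = h := rfl
    have h2 : Q.g₀ = h := rfl
    have h3 : Q.ε = ((D⁻¹ : ℝ) : ℂ) := rfl
    rw [hk, h1, h2, h3]
    have e1 : (1 / (n * s / 2) : ℂ) • (h : ℂ) = ((2 * h / n : ℝ) : ℂ) / s := by
      rw [smul_eq_mul]; push_cast
      rcases eq_or_ne s 0 with rfl | hs
      · simp
      · field_simp
    have e2 : (((D⁻¹ : ℝ) : ℂ) / (n / 2 - n * s / 2)) • (h : ℂ) = ((2 * h * D⁻¹ / n : ℝ) : ℂ) / (1 - s) := by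
      have : (n / 2 - n * s / 2 : ℂ) = n / 2 * (1 - s) := by ring
      rw [smul_eq_mul, this]; push_cast
      rcases eq_or_ne (1 - s) 0 with hs | hs
      · simp [hs]
      · have : (D : ℂ) ≠ 0 := by exact_mod_cast hD.ne'
        field_simp
    rw [e1, e2]
  refine ⟨fun s => Q.Λ₀ (n * s / 2), 2 * h / n, 2 * h * D⁻¹ / n, w * κ, D⁻¹, Δ * n / 2, ?_, by positivity, by positivity, by positivity, by positivity, ?_, ?_, ?_⟩
  · exact Q.differentiable_Λ₀.comp (by fun_prop)
  · intro σ hσ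
    obtain ⟨h1, h2, -⟩ := hreal σ hσ
    refine ⟨h1, ?_⟩
    rw [← h2, ← hΛ]
    congr 1; push_cast; ring
  · intro s h0 h1
    have e1 := hΛ (1 - s)
    rw [sub_sub_cancel] at e1
    rw [← e1, ← hΛ]
    have := Q.functional_equation (n * s / 2)
    have hk : (Q.k : ℂ) = n / 2 := by change ((n / 2 : ℝ) : ℂ) = _; push_cast; rfl
    have h3 : Q.ε = ((D⁻¹ : ℝ) : ℂ) := rfl
    rw [hk, h3, hsym, show (n / 2 - n * s / 2 : ℂ) = n * (1 - s) / 2 by ring, smul_eq_mul] at this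
    · rw [this, mul_assoc]
      congr 3; push_cast; ring
    · simp [hnC, h0]
    · push_cast
      intro h; apply h1
      field_simp at h
      exact h
  · intro a b
    obtain ⟨C, hC⟩ := strip_bound Q.f_modif (n * a / 2) (n * b / 2)
      (Q.isStrongFEPair_toStrongFEPair.hasMellin _).1 (Q.isStrongFEPair_toStrongFEPair.hasMellin _).1
    refine ⟨C, fun s h1 h2 => hC _ ?_ ?_⟩
    · have : (n * s / 2 : ℂ).re = n * s.re / 2 := by simp
      rw [this]; gcongr
    · have : (n * s / 2 : ℂ).re = n * s.re / 2 := by simp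
      rw [this]; gcongr

end nf
end NB
end

section
open MeasureTheory Set Filter Topology

set_option linter.unusedSectionVars false
set_option linter.unusedSimpArgs false
set_option linter.unusedVariables false
namespace NB
open Matrix NumberField
open scoped ComplexConjugate nonZeroDivisors

section nf
variable {K : Type*} [Field K] [NumberField K]

lemma euler_finite {ι : Type*} [DecidableEq ι] (x : ι → ℂ) (hx : ∀ i, ‖x i‖ < 1) (S : Finset ι) :
    HasSum (fun e : {e : ι →₀ ℕ // e.support ⊆ S} => e.1.prod fun i n => x i ^ n) (∏ i ∈ S, (1 - x i)⁻¹) ∧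
    Summable (fun e : {e : ι →₀ ℕ // e.support ⊆ S} => ‖e.1.prod fun i n => x i ^ n‖) := by
  induction S using Finset.induction_on with
  | empty =>
    have : Unique {e : ι →₀ ℕ // e.support ⊆ (∅ : Finset ι)} :=
      { default := ⟨0, by simp⟩
        uniq := by
          rintro ⟨e, he⟩
          apply Subtype.ext
          simpa using he }
    have hd : ((default : {e : ι →₀ ℕ // e.support ⊆ (∅ : Finset ι)}) : ι →₀ ℕ) = 0 := by
      have := (default : {e : ι →₀ ℕ // e.support ⊆ (∅ : Finset ι)}).2
      simpa using this
    constructor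
    · have := hasSum_unique (fun e : {e : ι →₀ ℕ // e.support ⊆ (∅ : Finset ι)} => e.1.prod fun i n => x i ^ n)
      simp only [hd, Finsupp.prod_zero_index] at this
      simpa using this
    · exact (hasSum_fintype _).summable
  | insert a S ha ih =>
    let E : (ℕ × {e : ι →₀ ℕ // e.support ⊆ S}) ≃ {e : ι →₀ ℕ // e.support ⊆ insert a S} :=
      { toFun := fun p => ⟨p.2.1 + Finsupp.single a p.1, by
          refine Finsupp.support_add.trans ?_
          refine Finset.union_subset (p.2.2.trans (Finset.subset_insert _ _)) ?_
          exact Finsupp.support_single_subset.trans (by simp)⟩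
        invFun := fun e => (e.1 a, ⟨e.1.erase a, by
          rw [Finsupp.support_erase]
          intro i hi
          simp only [Finset.mem_erase] at hi
          have := e.2 hi.2
          simpa [hi.1] using this⟩)
        left_inv := by
          rintro ⟨n, e, he⟩
          have h0 : e a = 0 := by
            by_contra h
            exact ha (he (Finsupp.mem_support_iff.2 h))
          refine Prod.ext ?_ (Subtype.ext ?_)
          · simp [h0]
          · simp only
            ext i
            rcases eq_or_ne i a with rfl | hi
            · simp [h0]
            · simp [Finsupp.erase_ne hi, Finsupp.single_eq_of_ne hi]
        right_inv := by
          rintro ⟨e, he⟩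
          apply Subtype.ext
          simp only
          rw [add_comm, Finsupp.single_add_erase] }
    have hE : ∀ p, ((E p).1.prod fun i n => x i ^ n) = x a ^ p.1 * (p.2.1.prod fun i n => x i ^ n) := by
      rintro ⟨n, e, he⟩
      change ((e + Finsupp.single a n).prod fun i n => x i ^ n) = _
      rw [Finsupp.prod_add_index' (by simp) (by intros; rw [pow_add]), Finsupp.prod_single_index (by simp), mul_comm]
    have hg := hasSum_geometric_of_norm_lt_one (hx a)
    have hgn : Summable (fun n : ℕ => ‖x a ^ n‖) := by
      simp_rw [norm_pow]; exact summable_geometric_of_lt_one (norm_nonneg _) (hx a)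
    have hs := summable_mul_of_summable_norm hgn ih.2
    constructor
    · rw [Finset.prod_insert ha, ← E.hasSum_iff]
      have := hg.mul ih.1 hs
      refine this.congr_fun ?_
      intro p; exact hE p
    · rw [← E.summable_iff]
      have := Summable.mul_of_nonneg hgn ih.2 (fun _ => norm_nonneg _) (fun _ => norm_nonneg _)
      refine this.congr ?_
      intro p
      simp only [Function.comp]
      rw [hE, norm_mul]

lemma euler_general {ι : Type*} (x : ι → ℂ) (hx : ∀ i, ‖x i‖ < 1)
    (hs : Summable (fun e : ι →₀ ℕ => ‖e.prod fun i n => x i ^ n‖)) :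
    HasProd (fun i => (1 - x i)⁻¹) (∑' e : ι →₀ ℕ, e.prod fun i n => x i ^ n) := by
  classical
  unfold HasProd
  simp only [SummationFilter.unconditional_filter]
  have h1 : ∀ S : Finset ι, ∏ i ∈ S, (1 - x i)⁻¹ = ∑' e : ι →₀ ℕ, Set.indicator {e : ι →₀ ℕ | e.support ⊆ S} (fun e => e.prod fun i n => x i ^ n) e := by
    intro S
    rw [← (euler_finite x hx S).1.tsum_eq]
    exact tsum_subtype {e : ι →₀ ℕ | e.support ⊆ S} (fun e => e.prod fun i n => x i ^ n)
  simp_rw [h1]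
  refine tendsto_tsum_of_dominated_convergence hs ?_ ?_
  · intro e
    refine tendsto_const_nhds.congr' ?_
    filter_upwards [eventually_ge_atTop e.support] with S hS
    rw [indicator_of_mem]; exact hS
  · refine Eventually.of_forall fun S e => ?_
    exact norm_indicator_le_norm_self _ _

variable (K) in
/-- nonzero primes -/
abbrev Pr := {p : Ideal (𝓞 K) // p ≠ ⊥ ∧ p.IsPrime}

variable (K) in
lemma exists_factor_equiv : ∃ E : (Pr K →₀ ℕ) ≃ (Ideal (𝓞 K))⁰, ∀ e, Ideal.absNorm ((E e : (Ideal (𝓞 K))⁰) : Ideal (𝓞 K)) = e.prod fun p n => Ideal.absNorm p.1 ^ n := by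
  classical
  let f0 : (Pr K →₀ ℕ) → Ideal (𝓞 K) := fun e => ((Finsupp.toMultiset e).map Subtype.val).prod
  have hpr : ∀ (s : Multiset (Pr K)), ∀ a ∈ s.map Subtype.val, Prime a := by
    intro s a ha
    obtain ⟨p, hp, rfl⟩ := Multiset.mem_map.1 ha
    exact Ideal.prime_of_isPrime p.2.1 p.2.2
  have hne : ∀ e, f0 e ≠ 0 := by
    intro e
    refine Multiset.prod_ne_zero ?_
    intro h
    exact (hpr _ _ h).ne_zero rfl
  let f : (Pr K →₀ ℕ) → (Ideal (𝓞 K))⁰ := fun e => ⟨f0 e, mem_nonZeroDivisors_of_ne_zero (hne e)⟩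
  have hbij : Function.Bijective f := by
    constructor
    · intro a b hab
      have h1 : f0 a = f0 b := congrArg Subtype.val hab
      have h2 := congrArg UniqueFactorizationMonoid.normalizedFactors h1
      simp only [f0] at h2
      rw [UniqueFactorizationMonoid.normalizedFactors_prod_of_prime (hpr _), UniqueFactorizationMonoid.normalizedFactors_prod_of_prime (hpr _)] at h2
      have h3 := Multiset.map_injective Subtype.val_injective h2
      exact Multiset.toFinsupp.symm.injective (by simpa using h3)
    · rintro ⟨J, hJ⟩
      have hJ0 : J ≠ 0 := nonZeroDivisors.ne_zero hJ
      have hm : ∀ p ∈ UniqueFactorizationMonoid.normalizedFactors J, p ≠ ⊥ ∧ p.IsPrime := by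
        intro p hp
        have := UniqueFactorizationMonoid.prime_of_normalized_factor p hp
        exact ⟨this.ne_zero, Ideal.isPrime_of_prime this⟩
      obtain ⟨t, ht⟩ := CanLift.prf (β := Multiset (Pr K)) (UniqueFactorizationMonoid.normalizedFactors J) hm
      refine ⟨Multiset.toFinsupp t, Subtype.ext ?_⟩
      simp only [f, f0, Multiset.toFinsupp_toMultiset]
      have : Multiset.map Subtype.val t = UniqueFactorizationMonoid.normalizedFactors J := ht
      rw [this]
      exact Ideal.prod_normalizedFactors_eq_self hJ0
  refine ⟨Equiv.ofBijective f hbij, fun e => ?_⟩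
  simp only [Equiv.ofBijective_apply, f, f0]
  rw [map_multiset_prod, Multiset.map_map, Finsupp.prod]
  rw [← Finsupp.prod, Finsupp.toMultiset_map, Finsupp.prod_toMultiset]
  rw [Finsupp.prod_mapDomain_index (by simp) (by intros; rw [pow_add])]
  simp

end nf
end NB
end

section
open MeasureTheory Set Filter Topology

set_option linter.unusedSectionVars false
set_option linter.unusedSimpArgs false
set_option linter.unusedVariables false
namespace NB
open Matrix NumberField
open scoped ComplexConjugate nonZeroDivisors

section nf
variable {K : Type*} [Field K] [NumberField K]

/-- norms that are at least two with summability for exponents above one -/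
def Good {ι : Type*} (N : ι → ℕ) : Prop := (∀ i, 2 ≤ N i) ∧ ∀ σ : ℝ, 1 < σ → Summable (fun i => (N i : ℝ) ^ (-σ))

/-- Euler product -/
noncomputable def ep {ι : Type*} (N : ι → ℕ) (s : ℂ) : ℂ := ∏' i, (1 - (N i : ℂ) ^ (-s))⁻¹

section ep
variable {ι : Type*} {N : ι → ℕ}

lemma Good.norm (h : Good N) (i : ι) (s : ℂ) : ‖(N i : ℂ) ^ (-s)‖ = (N i : ℝ) ^ (-s.re) := by
  rw [Complex.norm_natCast_cpow_of_pos (by have := h.1 i; omega)]; simp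

lemma Good.norm_lt (h : Good N) (i : ι) {s : ℂ} (hs : 0 < s.re) : ‖(N i : ℂ) ^ (-s)‖ < 1 := by
  rw [h.norm]
  exact Real.rpow_lt_one_of_one_lt_of_neg (by have := h.1 i; exact_mod_cast (by omega : 1 < N i)) (by linarith)

lemma Good.one_sub_ne (h : Good N) (i : ι) {s : ℂ} (hs : 0 < s.re) : (1 - (N i : ℂ) ^ (-s)) ≠ 0 := by
  intro h0
  have := h.norm_lt i hs
  rw [← sub_eq_zero.1 h0] at this
  simp at this

lemma Good.summable (h : Good N) {s : ℂ} (hs : 1 < s.re) : Summable (fun i => ‖(N i : ℂ) ^ (-s)‖) := by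
  simp_rw [h.norm]; exact h.2 _ hs

lemma Good.hasProd_inv (h : Good N) {s : ℂ} (hs : 1 < s.re) :
    HasProd (fun i => (1 - (N i : ℂ) ^ (-s))) (∏' i, (1 - (N i : ℂ) ^ (-s))) ∧ ∏' i, (1 - (N i : ℂ) ^ (-s)) ≠ 0 := by
  have hsum : Summable (fun i => ‖-(N i : ℂ) ^ (-s)‖) := by simpa using h.summable hs
  constructor
  · have := (multipliable_one_add_of_summable hsum).hasProd
    simpa only [← sub_eq_add_neg] using this
  · have := tprod_one_add_ne_zero_of_summable (f := fun i => -(N i : ℂ) ^ (-s)) (fun i => by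
      rw [← sub_eq_add_neg]; exact h.one_sub_ne i (by linarith)) hsum
    simpa only [← sub_eq_add_neg] using this

lemma Good.hasProd (h : Good N) {s : ℂ} (hs : 1 < s.re) :
    HasProd (fun i => (1 - (N i : ℂ) ^ (-s))⁻¹) (ep N s) := by
  have h1 := (h.hasProd_inv hs).1.inv₀ (h.hasProd_inv hs).2
  have : ep N s = (∏' i, (1 - (N i : ℂ) ^ (-s)))⁻¹ := h1.tprod_eq
  rw [this]; exact h1

lemma Good.ep_eq (h : Good N) {s : ℂ} (hs : 1 < s.re) : ep N s = (∏' i, (1 - (N i : ℂ) ^ (-s)))⁻¹ :=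
  ((h.hasProd_inv hs).1.inv₀ (h.hasProd_inv hs).2).tprod_eq

lemma Good.ep_ne_zero (h : Good N) {s : ℂ} (hs : 1 < s.re) : ep N s ≠ 0 := by
  rw [h.ep_eq hs]; exact inv_ne_zero (h.hasProd_inv hs).2

lemma Good.differentiableAt (h : Good N) {s : ℂ} (hs : 1 < s.re) : DifferentiableAt ℂ (ep N) s := by
  set a := (1 + s.re) / 2 with ha
  have hU : IsOpen {z : ℂ | a < z.re} := isOpen_lt continuous_const Complex.continuous_re
  have hd : ∀ i, Differentiable ℂ (fun z : ℂ => -(N i : ℂ) ^ (-z)) := by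
    intro i
    have : (N i : ℂ) ≠ 0 := by have := h.1 i; exact_mod_cast (by omega : N i ≠ 0)
    intro z
    exact ((differentiableAt_id.neg).const_cpow (Or.inl this)).neg
  have h1 := Summable.hasProdLocallyUniformlyOn_one_add (f := fun i (z : ℂ) => -(N i : ℂ) ^ (-z)) hU (h.2 a (by linarith)) (Eventually.of_forall fun i z (hz : a < z.re) => by
      rw [norm_neg, h.norm]
      exact Real.rpow_le_rpow_of_exponent_le (by have := h.1 i; exact_mod_cast (by omega : 1 ≤ N i)) (by linarith))
    (fun i => (hd i).continuous.continuousOn)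
  have h2 := h1.differentiableOn (.of_forall fun S => by
    simpa [Finset.prod_fn] using
      DifferentiableOn.finsetProd (fun i _ => ((hd i).const_add 1).differentiableOn)) hU
  have hsU : s ∈ {z : ℂ | a < z.re} := by show a < s.re; linarith
  have h3 := (h2.differentiableAt (hU.mem_nhds hsU))
  have h4 : DifferentiableAt ℂ (fun z : ℂ => (∏' i, (1 - (N i : ℂ) ^ (-z)))⁻¹) s := by
    refine DifferentiableAt.inv ?_ (h.hasProd_inv hs).2
    simpa only [← sub_eq_add_neg] using h3
  refine h4.congr_of_eventuallyEq ?_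
  filter_upwards [hU.mem_nhds hsU] with z hz
  exact h.ep_eq (by have hz : a < z.re := hz; linarith)

lemma Good.conj (h : Good N) {s : ℂ} (hs : 1 < s.re) : ep N (conj s) = conj (ep N s) := by
  have h1 := (h.hasProd hs).map (starRingEnd ℂ) Complex.continuous_conj
  have h2 := h.hasProd (s := conj s) (by simpa using hs)
  refine h2.unique ?_
  convert! h1 using 1
  ext i
  simp only [Function.comp, map_inv₀, map_sub, map_one]
  rw [← map_neg, Complex.cpow_conj _ _ (by
    rw [Complex.natCast_arg]; exact Real.pi_pos.ne), Complex.conj_natCast]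

lemma comb_nonneg {a : ℝ} (ha₀ : 0 ≤ a) (ha₁ : a < 1) {z : ℂ} (hz : ‖z‖ = 1) :
      0 ≤ 3 * (-Complex.log (1 - a)).re + 4 * (-Complex.log (1 - a * z)).re + (-Complex.log (1 - a * z ^ 2)).re := by
  have hac₀ : ‖(a : ℂ)‖ < 1 := by
    simp only [Complex.norm_of_nonneg ha₀, ha₁]
  have hac₁ : ‖a * z‖ < 1 := by rwa [norm_mul, hz, mul_one]
  have hac₂ : ‖a * z ^ 2‖ < 1 := by rwa [norm_mul, norm_pow, hz, one_pow, mul_one]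
  rw [← ((Complex.hasSum_re <| Complex.hasSum_taylorSeries_neg_log hac₀).mul_left 3).add
    ((Complex.hasSum_re <| Complex.hasSum_taylorSeries_neg_log hac₁).mul_left 4) |>.add
    (Complex.hasSum_re <| Complex.hasSum_taylorSeries_neg_log hac₂) |>.tsum_eq]
  refine tsum_nonneg fun n ↦ ?_
  simp only [← Complex.ofReal_pow, Complex.div_natCast_re, Complex.ofReal_re, mul_pow, Complex.mul_re, Complex.ofReal_im, zero_mul,
    sub_zero]
  rcases n.eq_zero_or_pos with rfl | hn
  · simp
  · simp only [← mul_div_assoc, ← add_div]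
    refine div_nonneg ?_ n.cast_nonneg
    rw [← pow_mul, pow_mul', sq, Complex.mul_re, ← sq, ← sq, ← Complex.sq_norm_sub_sq_re, norm_pow, hz]
    convert! (show 0 ≤ 2 * a ^ n * ((z ^ n).re + 1) ^ 2 by positivity) using 1
    ring

lemma factor_341 {a : ℝ} (ha₀ : 0 ≤ a) (ha₁ : a < 1) {z : ℂ} (hz : ‖z‖ = 1) :
    1 ≤ ‖(1 - (a:ℂ))⁻¹‖ ^ 3 * ‖(1 - a * z)⁻¹‖ ^ 4 * ‖(1 - a * z ^ 2)⁻¹‖ := by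
  have h := comb_nonneg ha₀ ha₁ hz
  have key : ∀ w : ℂ, ‖w‖ < 1 → ‖(1 - w)⁻¹‖ = Real.exp ((-Complex.log (1 - w)).re) := by
    intro w hw
    have : 1 - w ≠ 0 := by
      intro h0
      rw [← sub_eq_zero.1 h0] at hw; simp at hw
    rw [Complex.neg_re, Real.exp_neg, Complex.log_re, Real.exp_log (norm_pos_iff.2 this), norm_inv]
  rw [key _ (by simp [abs_of_nonneg ha₀, ha₁]), key _ (by rw [norm_mul, hz, mul_one]; simp [abs_of_nonneg ha₀, ha₁]),
    key _ (by rw [norm_mul, norm_pow, hz, one_pow, mul_one]; simp [abs_of_nonneg ha₀, ha₁]), ← Real.exp_nat_mul, ← Real.exp_nat_mul,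
    ← Real.exp_add, ← Real.exp_add, Real.one_le_exp_iff]
  push_cast
  exact h

lemma Good.ge_341 (h : Good N) {x : ℝ} (hx : 1 < x) (y : ℝ) :
    1 ≤ ‖ep N x‖ ^ 3 * ‖ep N (x + Complex.I * y)‖ ^ 4 * ‖ep N (x + 2 * Complex.I * y)‖ := by
  have h0 := h.hasProd (s := x) (by simpa using hx)
  have h1 := h.hasProd (s := x + Complex.I * y) (by simpa using hx)
  have h2 := h.hasProd (s := x + 2 * Complex.I * y) (by simpa using hx)
  unfold HasProd at h0 h1 h2
  refine ge_of_tendsto (((h0.norm.pow 3).mul (h1.norm.pow 4)).mul h2.norm) (Eventually.of_forall fun S => ?_)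
  simp only [norm_prod, ← Finset.prod_pow, ← Finset.prod_mul_distrib]
  refine Finset.one_le_prod ?_
  intro i _
  have hN : (N i : ℂ) ≠ 0 := by have := h.1 i; exact_mod_cast (by omega : N i ≠ 0)
  have := factor_341 (a := (N i : ℝ) ^ (-x)) (by positivity) (by
    have := h.norm_lt i (s := x) (by simpa using (by linarith : 0 < x))
    rw [h.norm] at this; simpa using this) (z := (N i : ℂ) ^ (-(Complex.I * y))) (by
    rw [h.norm]; simp)
  have e0 : (((N i : ℝ) ^ (-x) : ℝ) : ℂ) = (N i : ℂ) ^ (-(x:ℂ)) := by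
    rw [Complex.ofReal_cpow (Nat.cast_nonneg _)]; simp
  have e1 : (N i : ℂ) ^ (-(x:ℂ)) * (N i : ℂ) ^ (-(Complex.I * y)) = (N i : ℂ) ^ (-(x + Complex.I * y)) := by
    rw [← Complex.cpow_add _ _ hN]; congr 1; ring
  have e2 : (N i : ℂ) ^ (-(x:ℂ)) * ((N i : ℂ) ^ (-(Complex.I * y))) ^ 2 = (N i : ℂ) ^ (-(x + 2 * Complex.I * y)) := by
    rw [← Complex.cpow_nat_mul, ← Complex.cpow_add _ _ hN]; congr 1; push_cast; ring
  rw [e0, e1, e2] at this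
  exact this

end ep

end nf
end NB
end

section
open MeasureTheory Set Filter Topology

set_option linter.unusedSectionVars false
set_option linter.unusedSimpArgs false
set_option linter.unusedVariables false
namespace NB
open Matrix NumberField
open scoped ComplexConjugate nonZeroDivisors

section nf
variable {K : Type*} [Field K] [NumberField K]

lemma gamma_le : ∃ C : ℝ, 1 ≤ C ∧ ∀ x : ℝ, 1 ≤ x → Real.Gamma x ≤ C * Real.exp (x ^ 2) := by
  have hc : ContinuousOn Real.Gamma (Icc 1 2) := fun x hx =>
    (Real.differentiableAt_Gamma fun m => by have := hx.1; have : (0:ℝ) ≤ m := Nat.cast_nonneg m; linarith).continuousAt.continuousWithinAt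
  obtain ⟨C, hC⟩ := isCompact_Icc.bddAbove_image hc
  refine ⟨max C 1, le_max_right _ _, ?_⟩
  have hC0 : 0 ≤ max C 1 := le_trans zero_le_one (le_max_right _ _)
  have key : ∀ n : ℕ, ∀ x : ℝ, 1 ≤ x → x ≤ n + 2 → Real.Gamma x ≤ max C 1 * Real.exp (x ^ 2) := by
    intro n
    induction n with
    | zero =>
      intro x h1 h2
      have := hC (mem_image_of_mem Real.Gamma (⟨h1, by simpa using h2⟩ : x ∈ Icc (1:ℝ) 2))
      calc Real.Gamma x ≤ max C 1 := this.trans (le_max_left _ _)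
        _ ≤ _ := le_mul_of_one_le_right hC0 (Real.one_le_exp (sq_nonneg x))
    | succ n ih =>
      intro x h1 h2
      by_cases hx : x ≤ 2
      · have := hC (mem_image_of_mem Real.Gamma (⟨h1, by simpa using hx⟩ : x ∈ Icc (1:ℝ) 2))
        calc Real.Gamma x ≤ max C 1 := this.trans (le_max_left _ _)
          _ ≤ _ := le_mul_of_one_le_right hC0 (Real.one_le_exp (sq_nonneg x))
      · push Not at hx
        have h3 := ih (x - 1) (by linarith) (by push_cast at h2; linarith)
        have h4 := Real.Gamma_add_one (s := x - 1) (by linarith)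
        rw [sub_add_cancel] at h4
        have h5 : x - 1 ≤ Real.exp (x - 1) := by have := Real.add_one_le_exp (x-1); linarith
        calc Real.Gamma x ≤ Real.exp (x - 1) * (max C 1 * Real.exp ((x-1) ^ 2)) := by
              rw [h4]; exact mul_le_mul h5 h3 (Real.Gamma_pos_of_pos (by linarith)).le (by positivity)
          _ = max C 1 * Real.exp (x - 1 + (x-1)^2) := by rw [Real.exp_add]; ring
          _ ≤ _ := by gcongr; nlinarith
  intro x hx
  exact key ⌈x⌉₊ x hx (by have := Nat.le_ceil x; linarith)

lemma norm_Gamma_le_re {z : ℂ} (hz : 0 < z.re) : ‖Complex.Gamma z‖ ≤ Real.Gamma z.re := by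
  rw [Complex.Gamma_eq_integral hz, Real.Gamma_eq_integral hz, Complex.GammaIntegral]
  refine (norm_integral_le_integral_norm _).trans (le_of_eq ?_)
  refine setIntegral_congr_fun measurableSet_Ioi fun x (hx : 0 < x) => ?_
  simp only [norm_mul, Complex.norm_real, Complex.norm_cpow_eq_rpow_re_of_pos hx]
  simp [abs_of_pos (Real.exp_pos _)]

lemma norm_sin_le' (z : ℂ) : ‖Complex.sin z‖ ≤ Real.exp ‖z‖ := by
  rw [Complex.sin]
  have h1 : ‖Complex.exp (-z * Complex.I)‖ ≤ Real.exp ‖z‖ := (Complex.norm_exp_le_exp_norm _).trans (by simp)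
  have h2 : ‖Complex.exp (z * Complex.I)‖ ≤ Real.exp ‖z‖ := (Complex.norm_exp_le_exp_norm _).trans (by simp)
  rw [norm_div, norm_mul, Complex.norm_I, mul_one]
  have := norm_sub_le (Complex.exp (-z * Complex.I)) (Complex.exp (z * Complex.I))
  rw [Complex.norm_ofNat]
  linarith

lemma inv_gamma_left : ∃ C : ℝ, 1 ≤ C ∧ ∀ z : ℂ, z.re ≤ 0 → z.im ≠ 0 → ‖(Complex.Gamma z)⁻¹‖ ≤ Real.exp (C * (‖z‖ + 1) ^ 2) := by
  obtain ⟨C, hC1, hC⟩ := gamma_le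
  have hlog : 0 ≤ Real.log C := Real.log_nonneg hC1
  refine ⟨Real.log C + 1 + Real.pi, by have := Real.pi_pos; linarith, fun z hz him => ?_⟩
  have h := Complex.Gamma_mul_Gamma_one_sub z
  have hs : Complex.sin (Real.pi * z) ≠ 0 := by
    rw [Complex.sin_ne_zero_iff]
    intro k hk
    have := congrArg Complex.im hk
    simp [Real.pi_ne_zero, him] at this
  have hpi : (Real.pi : ℂ) ≠ 0 := by exact_mod_cast Real.pi_ne_zero
  have hG : Complex.Gamma z ≠ 0 := by
    intro h0; rw [h0, zero_mul] at h; exact (div_ne_zero hpi hs) h.symm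
  have e : (Complex.Gamma z)⁻¹ = Complex.Gamma (1 - z) * Complex.sin (Real.pi * z) / Real.pi := by
    rw [eq_div_iff hs] at h
    rw [eq_div_iff hpi, inv_mul_eq_iff_eq_mul₀ hG]
    linear_combination -h
  rw [e, norm_div, norm_mul]
  have h1 : ‖Complex.Gamma (1 - z)‖ ≤ C * Real.exp ((‖z‖ + 1)^2) := by
    have : (1 - z).re = 1 - z.re := by simp
    refine (norm_Gamma_le_re (by rw [this]; linarith)).trans ((hC _ (by rw [this]; linarith)).trans ?_)
    have h2 := Complex.abs_re_le_norm z
    have h3 := neg_abs_le z.re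
    rw [this]
    gcongr <;> linarith
  have h2 : ‖Complex.sin (Real.pi * z)‖ ≤ Real.exp (Real.pi * (‖z‖+1)^2) := by
    refine (norm_sin_le' _).trans (Real.exp_le_exp.2 ?_)
    rw [norm_mul, Complex.norm_real, Real.norm_of_nonneg Real.pi_pos.le]
    gcongr
    nlinarith [norm_nonneg z]
  have h3 : C ≤ Real.exp (Real.log C * (‖z‖+1)^2) := by
    conv_lhs => rw [← Real.exp_log (by linarith : 0 < C)]
    refine Real.exp_le_exp.2 (le_mul_of_one_le_right hlog ?_)
    nlinarith [norm_nonneg z]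
  have h4 : ‖(Real.pi:ℂ)‖ = Real.pi := by rw [Complex.norm_real, Real.norm_of_nonneg Real.pi_pos.le]
  rw [h4]
  refine (div_le_self (by positivity) (by linarith [Real.pi_gt_three])).trans ?_
  calc _ ≤ (Real.exp (Real.log C * (‖z‖+1)^2) * Real.exp ((‖z‖ + 1)^2)) * Real.exp (Real.pi * (‖z‖+1)^2) := by
        gcongr; exact h1.trans (by gcongr)
    _ = _ := by rw [← Real.exp_add, ← Real.exp_add]; congr 1; ring

lemma inv_gamma_bound : ∃ C : ℝ, 1 ≤ C ∧ ∀ T : ℝ, 1 ≤ T → ∀ z : ℂ, ‖z‖ ≤ T → 1/2 ≤ |z.im| →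
    ‖(Complex.Gamma z)⁻¹‖ ≤ Real.exp (C * T ^ 2) := by
  obtain ⟨C, hC1, hC⟩ := inv_gamma_left
  have key : ∀ n : ℕ, ∀ z : ℂ, z.re ≤ n → 1/2 ≤ |z.im| → ‖(Complex.Gamma z)⁻¹‖ ≤ Real.exp (n + C * (‖z‖ + n + 1) ^ 2) := by
    intro n
    induction n with
    | zero =>
      intro z hz him
      have := hC z (by simpa using hz) (by intro h; rw [h] at him; norm_num at him)
      simpa using this
    | succ n ih =>
      intro z hz him
      have h1 := ih (z - 1) (by push_cast at hz; simp; linarith) (by simpa using him)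
      have hz1 : z - 1 ≠ 0 := by intro h; have := congrArg Complex.im h; simp at this; rw [this] at him; norm_num at him
      have h2 := Complex.Gamma_add_one (z - 1) hz1
      rw [sub_add_cancel] at h2
      rw [h2, mul_inv, norm_mul]
      have h3 : ‖(z-1)⁻¹‖ ≤ Real.exp 1 := by
        rw [norm_inv]
        have h4 : 1/2 ≤ ‖z-1‖ := him.trans (by simpa using Complex.abs_im_le_norm (z-1))
        have h5 : (2:ℝ) ≤ Real.exp 1 := by have := Real.add_one_le_exp (1:ℝ); linarith
        refine le_trans ?_ h5
        rw [inv_le_comm₀ (by linarith) (by norm_num)]; linarith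
      have h6 : ‖z - 1‖ ≤ ‖z‖ + 1 := (norm_sub_le _ _).trans (by simp)
      calc _ ≤ Real.exp 1 * Real.exp (n + C * (‖z-1‖ + n + 1) ^ 2) := by gcongr
        _ ≤ Real.exp 1 * Real.exp (n + C * ((‖z‖+1) + n + 1) ^ 2) := by gcongr
        _ = _ := by rw [← Real.exp_add]; congr 1; push_cast; ring
  refine ⟨2 + C * 16, by linarith, fun T hT z hz him => ?_⟩
  refine (key ⌈T⌉₊ z ?_ him).trans (Real.exp_le_exp.2 ?_)
  · exact (Complex.re_le_norm z).trans (hz.trans (Nat.le_ceil T))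
  · have h1 := (Nat.ceil_lt_add_one (by linarith : (0:ℝ) ≤ T)).le
    have h2 : ‖z‖ + ⌈T⌉₊ + 1 ≤ 4 * T := by linarith
    have h3 : (‖z‖ + ⌈T⌉₊ + 1)^2 ≤ (4*T)^2 := by gcongr
    have h4 : C * (‖z‖ + ⌈T⌉₊ + 1)^2 ≤ C * (4*T)^2 := by gcongr
    nlinarith

end nf
end NB
end

section
open MeasureTheory Set Filter Topology

set_option linter.unusedSectionVars false
set_option linter.unusedSimpArgs false
set_option linter.unusedVariables false
namespace NB
open Matrix NumberField
open scoped ComplexConjugate nonZeroDivisors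

section nf
variable {K : Type*} [Field K] [NumberField K]

variable (K) in
/-- norm of primes -/
noncomputable def nrm (p : Pr K) : ℕ := Ideal.absNorm p.1

variable (K) in
lemma nrm_good (hsum : ∀ σ : ℝ, 1 < σ → Summable (fun J : (Ideal (𝓞 K))⁰ => (Ideal.absNorm (J : Ideal (𝓞 K)) : ℝ) ^ (-σ))) :
    Good (nrm K) := by
  refine ⟨fun p => ?_, fun σ hσ => ?_⟩
  · have h0 : Ideal.absNorm p.1 ≠ 0 := by rw [Ne, Ideal.absNorm_eq_zero_iff]; exact p.2.1
    have h1 : Ideal.absNorm p.1 ≠ 1 := by rw [Ne, Ideal.absNorm_eq_one_iff]; exact p.2.2.ne_top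
    unfold nrm; omega
  · have hinj : Function.Injective (fun p : Pr K => (⟨p.1, mem_nonZeroDivisors_of_ne_zero p.2.1⟩ : (Ideal (𝓞 K))⁰)) := by
      intro p p' h
      have h' := congrArg Subtype.val h
      exact Subtype.ext h'
    have := (hsum σ hσ).comp_injective hinj
    refine this.congr fun p => ?_
    simp only [Function.comp, nrm]

variable (K) in
lemma euler_real (hsum : ∀ σ : ℝ, 1 < σ → Summable (fun J : (Ideal (𝓞 K))⁰ => (Ideal.absNorm (J : Ideal (𝓞 K)) : ℝ) ^ (-σ)))
    {σ : ℝ} (hσ : 1 < σ) :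
    ((∑' J : (Ideal (𝓞 K))⁰, (Ideal.absNorm (J : Ideal (𝓞 K)) : ℝ) ^ (-σ) : ℝ) : ℂ) = ep (nrm K) σ := by
  have hg := nrm_good K hsum
  obtain ⟨E, hE⟩ := exists_factor_equiv K
  have key : ∀ e : Pr K →₀ ℕ, (e.prod fun p n => ((nrm K p : ℂ) ^ (-(σ:ℂ))) ^ n) = (((Ideal.absNorm ((E e : (Ideal (𝓞 K))⁰) : Ideal (𝓞 K)) : ℝ) ^ (-σ) : ℝ) : ℂ) := by
    intro e
    have h1 : ∀ p : Pr K, (nrm K p : ℂ) ^ (-(σ:ℂ)) = (((nrm K p : ℝ) ^ (-σ) : ℝ) : ℂ) := by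
      intro p
      rw [Complex.ofReal_cpow (Nat.cast_nonneg _)]; simp
    rw [hE, Finsupp.prod, Finsupp.prod]
    simp only [h1]
    push_cast
    rw [← Real.finsetProd_rpow _ _ (fun i _ => by positivity)]
    push_cast
    refine Finset.prod_congr rfl fun p _ => ?_
    rw [← Complex.ofReal_pow]
    congr 1
    rw [← Real.rpow_natCast, ← Real.rpow_natCast, ← Real.rpow_mul (Nat.cast_nonneg _), ← Real.rpow_mul (Nat.cast_nonneg _), mul_comm]
    rfl
  have h := euler_general (fun p => (nrm K p : ℂ) ^ (-(σ:ℂ))) (fun p => hg.norm_lt p (by simpa using by linarith)) (by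
    simp only [key, Complex.norm_real]
    have := ((hsum σ hσ).comp_injective E.injective).norm
    exact this)
  have h2 := hg.hasProd (s := σ) (by simpa using hσ)
  rw [h2.unique h]
  simp only [key]
  rw [← Complex.ofReal_tsum]
  congr 1
  exact (E.tsum_eq (fun J => (Ideal.absNorm (J : Ideal (𝓞 K)) : ℝ) ^ (-σ))).symm

variable (K) in
/-- inverse gamma factor, entire -/
noncomputable def cg (s : ℂ) : ℂ := ∏ v : InfinitePlace K,
  ((Real.pi * v.mult : ℝ) : ℂ) ^ (s * v.mult / 2) * (Complex.Gamma (s * v.mult / 2))⁻¹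

lemma pim_pos (v : InfinitePlace K) : 0 < Real.pi * v.mult := mul_pos Real.pi_pos (mult_pos' v)

variable (K) in
lemma cg_diff : Differentiable ℂ (cg K) := by
  unfold cg
  refine Differentiable.fun_finsetProd fun v _ => ?_
  have h0 : ((Real.pi * v.mult : ℝ) : ℂ) ≠ 0 := by exact_mod_cast (pim_pos v).ne'
  have hl : Differentiable ℂ (fun s : ℂ => s * v.mult / 2) := by fun_prop
  refine Differentiable.mul (fun s => (hl s).const_cpow (Or.inl h0)) ?_
  exact Complex.differentiable_one_div_Gamma.comp hl

lemma pim_cpow_ne (v : InfinitePlace K) (w : ℂ) : ((Real.pi * v.mult : ℝ) : ℂ) ^ w ≠ 0 := by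
  have h0 : ((Real.pi * v.mult : ℝ) : ℂ) ≠ 0 := by exact_mod_cast (pim_pos v).ne'
  rw [Complex.cpow_def_of_ne_zero h0]; exact Complex.exp_ne_zero _

lemma cg_ne_of_im {s : ℂ} (hs : s.im ≠ 0) : cg K s ≠ 0 := by
  unfold cg
  refine Finset.prod_ne_zero_iff.2 fun v _ => mul_ne_zero (pim_cpow_ne v _) (inv_ne_zero (Complex.Gamma_ne_zero fun m h => ?_))
  have := congrArg Complex.im h
  have hm := (mult_pos' v).ne'
  have e : (s * v.mult / 2).im = s.im * v.mult / 2 := by simp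
  rw [e] at this
  exact (div_ne_zero (mul_ne_zero hs hm) two_ne_zero) (by simpa using this)

lemma cg_ne_of_re {s : ℂ} (hs : 0 < s.re) : cg K s ≠ 0 := by
  unfold cg
  refine Finset.prod_ne_zero_iff.2 fun v _ => mul_ne_zero (pim_cpow_ne v _) (inv_ne_zero (Complex.Gamma_ne_zero_of_re_pos ?_))
  have hm := (mult_pos' v)
  have : (s * v.mult / 2).re = s.re * v.mult / 2 := by simp
  rw [this]; positivity

lemma cg_real {σ : ℝ} (hσ : 0 < σ) : ((gamR K (Module.finrank ℚ K * σ / 2) : ℝ) : ℂ) * cg K σ = 1 := by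
  unfold gamR cg
  push_cast
  rw [← Finset.prod_mul_distrib]
  refine Finset.prod_eq_one fun v _ => ?_
  have hn : (0:ℝ) < Module.finrank ℚ K := sum_mult_pos
  have hm := (mult_pos' v)
  have e : (Module.finrank ℚ K * σ / 2) * (v.mult:ℝ) / Module.finrank ℚ K = σ * v.mult / 2 := by field_simp
  rw [e]
  have e2 : ((σ:ℂ) * v.mult / 2) = ((σ * v.mult / 2 : ℝ) : ℂ) := by push_cast; rfl
  have e3 : (Real.pi : ℂ) * v.mult = ((Real.pi * v.mult : ℝ) : ℂ) := by push_cast; rfl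
  rw [e2, e3, Complex.Gamma_ofReal, ← Complex.ofReal_cpow (pim_pos v).le, ← Complex.ofReal_inv, ← Complex.ofReal_mul,
    ← Complex.ofReal_mul, ← Complex.ofReal_mul]
  rw [← Complex.ofReal_one]
  congr 1
  have h1 : Real.Gamma (σ * v.mult / 2) ≠ 0 := (Real.Gamma_pos_of_pos (by positivity)).ne'
  have h2 := (Real.rpow_pos_of_pos (pim_pos v) (σ * v.mult / 2)).ne'
  rw [Real.rpow_neg (pim_pos v).le]
  field_simp

end nf
end NB
end

section
open MeasureTheory Set Filter Topology

set_option linter.unusedSectionVars false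
set_option linter.unusedSimpArgs false
set_option linter.unusedVariables false
namespace NB
open Matrix NumberField
open scoped ComplexConjugate nonZeroDivisors

section nf
variable {K : Type*} [Field K] [NumberField K]

lemma analyticAt_conj_conj {g : ℂ → ℂ} {w : ℂ} (hg : AnalyticAt ℂ g (conj w)) : AnalyticAt ℂ (fun z => conj (g (conj z))) w := by
  rw [Complex.analyticAt_iff_eventually_differentiableAt] at hg ⊢
  have := (Complex.continuous_conj.tendsto w).eventually hg
  filter_upwards [this] with z hz
  have := hz.conj_conj
  simpa [Function.comp_def] using this

lemma tendsto_conj_ne (w : ℂ) : Tendsto (fun z : ℂ => conj z) (𝓝[≠] w) (𝓝[≠] (conj w)) := by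
  refine tendsto_nhdsWithin_iff.2 ⟨(Complex.continuous_conj.tendsto w).mono_left nhdsWithin_le_nhds, ?_⟩
  filter_upwards [self_mem_nhdsWithin] with z hz
  intro h
  exact hz ((starRingEnd ℂ).injective h)

lemma order_conj {f : ℂ → ℂ} {w : ℂ} (hf : MeromorphicAt f (conj w)) (hfw : MeromorphicAt f w)
    (h : ∀ᶠ z in 𝓝[≠] w, f z = conj (f (conj z))) : meromorphicOrderAt f w = meromorphicOrderAt f (conj w) := by
  by_cases htop : meromorphicOrderAt f (conj w) = ⊤
  · rw [htop]
    rw [meromorphicOrderAt_eq_top_iff] at htop ⊢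
    filter_upwards [h, (tendsto_conj_ne w).eventually htop] with z h1 h2
    rw [h1, h2, map_zero]
  · obtain ⟨n, hn⟩ := WithTop.ne_top_iff_exists.1 htop
    rw [← hn]
    obtain ⟨g, hg, hg0, hge⟩ := (meromorphicOrderAt_eq_int_iff hf).1 hn.symm
    refine (meromorphicOrderAt_eq_int_iff hfw).2 ⟨_, analyticAt_conj_conj hg, by simpa using hg0, ?_⟩
    filter_upwards [h, (tendsto_conj_ne w).eventually hge] with z h1 h2
    rw [h1, h2]
    simp

variable (K) in
/-- properties of the continued zeta function -/
structure IsZeta (Z : ℂ → ℂ) : Prop where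
  good : Good (nrm K)
  diff : ∀ s, s ≠ 0 → s ≠ 1 → DifferentiableAt ℂ Z s
  mero : ∀ s, MeromorphicAt Z s
  eq : ∀ s, 1 < s.re → Z s = ep (nrm K) s
  ord_one : meromorphicOrderAt Z 1 = (-1 : ℤ)
  symm : ∀ w, w.im ≠ 0 → meromorphicOrderAt Z (1 - conj w) = meromorphicOrderAt Z w
  growth : ∃ C : ℝ, 0 ≤ C ∧ ∀ T : ℝ, 1 ≤ T → ∀ s : ℂ, ‖s‖ ≤ T → 1 ≤ |s.im| → ‖Z s‖ ≤ Real.exp (C * T ^ 2)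
  line : ∀ s, s.re = 1 → s.im ≠ 0 → Z s ≠ 0

variable (K) in
lemma cg_bound : ∃ C : ℝ, 0 ≤ C ∧ ∀ T : ℝ, 1 ≤ T → ∀ s : ℂ, ‖s‖ ≤ T → 1 ≤ |s.im| → ‖cg K s‖ ≤ Real.exp (C * T ^ 2) := by
  obtain ⟨C, hC1, hC⟩ := inv_gamma_bound
  let c : InfinitePlace K → ℝ := fun v => |Real.log (Real.pi * v.mult)| * (v.mult / 2) + C * v.mult ^ 2
  refine ⟨∑ v, c v, Finset.sum_nonneg fun v _ => by positivity, fun T hT s hs him => ?_⟩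
  unfold cg
  rw [norm_prod, Finset.sum_mul, Real.exp_sum]
  refine Finset.prod_le_prod (fun v _ => norm_nonneg _) fun v _ => ?_
  have hm : (1:ℝ) ≤ v.mult := by exact_mod_cast InfinitePlace.mult_pos
  have hre := Complex.abs_re_le_norm s
  have hr : (s * v.mult / 2).re = s.re * (v.mult / 2) := by simp; ring
  have hi : (s * v.mult / 2).im = s.im * (v.mult / 2) := by simp; ring
  rw [norm_mul, Complex.norm_cpow_eq_rpow_re_of_pos (pim_pos v), hr, Real.rpow_def_of_pos (pim_pos v)]
  have h2 := hC (v.mult * T) (by nlinarith) (s * v.mult / 2) (by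
    rw [norm_div, norm_mul, Complex.norm_natCast, Complex.norm_ofNat]
    have : ‖s‖ * v.mult ≤ T * v.mult := by gcongr
    have h0 : 0 ≤ ‖s‖ * v.mult := by positivity
    linarith) (by
    rw [hi, abs_mul, abs_of_nonneg (by positivity : (0:ℝ) ≤ v.mult / 2)]; nlinarith)
  refine (mul_le_mul_of_nonneg_left h2 (Real.exp_pos _).le).trans ?_
  rw [← Real.exp_add]
  apply Real.exp_le_exp.2
  have h3 : Real.log (Real.pi * v.mult) * (s.re * (v.mult / 2)) ≤ |Real.log (Real.pi * v.mult)| * (v.mult / 2) * T ^ 2 := by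
    calc _ ≤ |Real.log (Real.pi * v.mult) * (s.re * (v.mult / 2))| := le_abs_self _
      _ = |Real.log (Real.pi * v.mult)| * (v.mult / 2) * |s.re| := by
        rw [abs_mul, abs_mul, abs_of_nonneg (by positivity : (0:ℝ) ≤ v.mult / 2)]; ring
      _ ≤ |Real.log (Real.pi * v.mult)| * (v.mult / 2) * T ^ 2 := by
        gcongr; nlinarith
  simp only [c]
  nlinarith

variable (K) in
lemma cg_inv_bound : ∃ C : ℝ, 0 ≤ C ∧ ∀ T : ℝ, 1 ≤ T → ∀ s : ℂ, ‖s‖ ≤ T → 2 ≤ s.re → ‖(cg K s)⁻¹‖ ≤ Real.exp (C * T ^ 2) := by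
  obtain ⟨C, hC1, hC⟩ := gamma_le
  have hlog : 0 ≤ Real.log C := Real.log_nonneg hC1
  let c : InfinitePlace K → ℝ := fun v => |Real.log (Real.pi * v.mult)| * (v.mult / 2) + (Real.log C + v.mult ^ 2)
  refine ⟨∑ v, c v, Finset.sum_nonneg fun v _ => by positivity, fun T hT s hs hs2 => ?_⟩
  unfold cg
  rw [norm_inv, norm_prod, ← Finset.prod_inv_distrib, Finset.sum_mul, Real.exp_sum]
  refine Finset.prod_le_prod (fun v _ => by positivity) fun v _ => ?_
  have hm : (1:ℝ) ≤ v.mult := by exact_mod_cast InfinitePlace.mult_pos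
  have hre := Complex.abs_re_le_norm s
  have hr : (s * v.mult / 2).re = s.re * (v.mult / 2) := by simp; ring
  rw [norm_mul, Complex.norm_cpow_eq_rpow_re_of_pos (pim_pos v), hr, Real.rpow_def_of_pos (pim_pos v), mul_inv, ← Real.exp_neg,
    norm_inv, inv_inv]
  have h2 : ‖Complex.Gamma (s * v.mult / 2)‖ ≤ Real.exp ((Real.log C + v.mult ^ 2) * T ^ 2) := by
    refine (norm_Gamma_le_re (by rw [hr]; nlinarith)).trans ((hC _ (by rw [hr]; nlinarith)).trans ?_)
    conv_lhs => rw [← Real.exp_log (by linarith : 0 < C)]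
    rw [← Real.exp_add, hr]
    apply Real.exp_le_exp.2
    have h5 : s.re ≤ T := (le_abs_self _).trans (hre.trans hs)
    have h6 : s.re * (v.mult / 2) ≤ v.mult * T := by nlinarith
    have h7 : (s.re * (v.mult / 2))^2 ≤ (v.mult * T)^2 := by
      have : 0 ≤ s.re * (v.mult / 2) := by positivity
      gcongr
    have h8 : Real.log C ≤ Real.log C * T ^ 2 := le_mul_of_one_le_right hlog (by nlinarith)
    nlinarith
  refine (mul_le_mul_of_nonneg_left h2 (Real.exp_pos _).le).trans ?_
  rw [← Real.exp_add]
  apply Real.exp_le_exp.2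
  have h3 : -(Real.log (Real.pi * v.mult) * (s.re * (v.mult / 2))) ≤ |Real.log (Real.pi * v.mult)| * (v.mult / 2) * T ^ 2 := by
    calc _ ≤ |Real.log (Real.pi * v.mult) * (s.re * (v.mult / 2))| := neg_le_abs _
      _ = |Real.log (Real.pi * v.mult)| * (v.mult / 2) * |s.re| := by
        rw [abs_mul, abs_mul, abs_of_nonneg (by positivity : (0:ℝ) ≤ v.mult / 2)]; ring
      _ ≤ |Real.log (Real.pi * v.mult)| * (v.mult / 2) * T ^ 2 := by
        gcongr; nlinarith
  simp only [c]
  nlinarith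

section ep2
variable {ι : Type*} {N : ι → ℕ}

/-- crude bound for Euler products on a half plane -/
lemma Good.bound (h : Good N) : ∃ C : ℝ, 1 ≤ C ∧ ∀ s : ℂ, 2 ≤ s.re → ‖ep N s‖ ≤ C := by
  have hsum := h.2 2 (by norm_num)
  refine ⟨Real.exp (2 * ∑' i, (N i : ℝ) ^ (-(2:ℝ))), Real.one_le_exp (by positivity), fun s hs => ?_⟩
  have h1 := (h.hasProd (s := s) (by linarith)).norm
  refine le_of_tendsto h1 (Eventually.of_forall fun S => ?_)
  have h2 : ∀ i, ‖(1 - (N i : ℂ) ^ (-s))⁻¹‖ ≤ Real.exp (2 * (N i : ℝ) ^ (-(2:ℝ))) := by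
    intro i
    have hN : (2:ℝ) ≤ N i := by exact_mod_cast h.1 i
    have hx : ‖(N i : ℂ) ^ (-s)‖ ≤ (N i : ℝ) ^ (-(2:ℝ)) := by
      rw [h.norm]; exact Real.rpow_le_rpow_of_exponent_le (by linarith) (by linarith)
    have hx2 : (N i : ℝ) ^ (-(2:ℝ)) ≤ 1/4 := by
      rw [Real.rpow_neg (by linarith)]
      rw [inv_le_comm₀ (by positivity) (by norm_num)]
      norm_num
      nlinarith
    set x := (N i : ℝ) ^ (-(2:ℝ))
    have hx0 : 0 ≤ x := (norm_nonneg _).trans hx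
    have h3 : 1 - x ≤ ‖1 - (N i : ℂ) ^ (-s)‖ := by
      have := norm_sub_norm_le (1:ℂ) ((N i : ℂ) ^ (-s)); rw [norm_one] at this; linarith
    rw [norm_inv]
    have h4 : (1 - x)⁻¹ ≤ 1 + 2 * x := by
      rw [inv_le_iff_one_le_mul₀ (by linarith)]; nlinarith
    have h5 : ‖1 - (N i : ℂ) ^ (-s)‖⁻¹ ≤ (1 - x)⁻¹ := inv_anti₀ (by linarith) h3
    have := Real.add_one_le_exp (2 * x)
    linarith
  calc _ ≤ ∏ i ∈ S, Real.exp (2 * (N i : ℝ) ^ (-(2:ℝ))) := by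
        exact Finset.prod_le_prod (fun _ _ => norm_nonneg _) fun i _ => h2 i
    _ = Real.exp (∑ i ∈ S, 2 * (N i : ℝ) ^ (-(2:ℝ))) := (Real.exp_sum _ _).symm
    _ ≤ _ := by
      apply Real.exp_le_exp.2
      rw [← Finset.mul_sum]
      gcongr
      exact hsum.sum_le_tsum S fun i _ => by positivity
end ep2

end nf
end NB
end

section
open MeasureTheory Set Filter Topology

set_option linter.unusedSectionVars false
set_option linter.unusedSimpArgs false
set_option linter.unusedVariables false
namespace NB
open Matrix NumberField
open scoped ComplexConjugate nonZeroDivisors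

section nf
variable {K : Type*} [Field K] [NumberField K]

lemma halfplane_preconnected (a : ℝ) : IsPreconnected {s : ℂ | a < s.re} := (convex_halfSpace_re_gt a).isPreconnected

/-- three four one argument -/
lemma line_aux {ι : Type*} {N : ι → ℕ} (hN : Good N) {Z : ℂ → ℂ} (heq : ∀ s, 1 < s.re → Z s = ep N s)
    (hd : ∀ s, s ≠ 0 → s ≠ 1 → DifferentiableAt ℂ Z s) {g : ℂ → ℂ} (hg : ContinuousAt g 1)
    (hZg : ∀ s, s ≠ 1 → s ≠ 0 → Z s = (s - 1)⁻¹ * g s) (s : ℂ) (hs : s.re = 1) (him : s.im ≠ 0) : Z s ≠ 0 := by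
  intro h0
  set y := s.im with hy
  have hsy : s = 1 + Complex.I * y := by apply Complex.ext <;> simp [hs, ← hy]
  have hd1 := (hd s (by rintro rfl; simp at hs) (by rintro rfl; exact him (by simp [hy]))).hasDerivAt
  have ht : Tendsto (fun x : ℝ => (x : ℂ)) (𝓝[>] 1) (𝓝 1) := by
    have := (Complex.continuous_ofReal.tendsto (1:ℝ)).mono_left (nhdsWithin_le_nhds (s := Ioi 1))
    simpa using this
  have l1 : Tendsto (fun x : ℝ => g x) (𝓝[>] 1) (𝓝 (g 1)) := hg.tendsto.comp ht
  have l2 : Tendsto (fun x : ℝ => Z (x + Complex.I * y) / (x - 1)) (𝓝[>] 1) (𝓝 (deriv Z s)) := by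
    have h1 := hd1.tendsto_slope
    have h2 : Tendsto (fun x : ℝ => (x : ℂ) + Complex.I * y) (𝓝[>] 1) (𝓝[≠] s) := by
      refine tendsto_nhdsWithin_iff.2 ⟨?_, ?_⟩
      · rw [hsy]; exact ht.add_const _
      · filter_upwards [self_mem_nhdsWithin] with x hx
        intro h
        have := congrArg Complex.re h
        simp [hs] at this
        exact (ne_of_gt (hx : (1:ℝ) < x)) this
    refine (h1.comp h2).congr fun x => ?_
    simp only [Function.comp, slope, h0, vsub_eq_sub, sub_zero, smul_eq_mul]
    rw [hsy]; rw [div_eq_inv_mul]; congr 2; ring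
  have l3 : Tendsto (fun x : ℝ => Z (x + 2 * Complex.I * y)) (𝓝[>] 1) (𝓝 (Z (1 + 2 * Complex.I * y))) := by
    have hc : ContinuousAt Z (1 + 2 * Complex.I * y) := (hd _ (by
      intro h; have := congrArg Complex.re h; simp at this) (by
      intro h; have := congrArg Complex.im h; simp [him] at this)).continuousAt
    exact hc.tendsto.comp (ht.add_const _)
  have l4 : Tendsto (fun x : ℝ => x - 1) (𝓝[>] 1) (𝓝 0) := by
    have : Tendsto (fun x : ℝ => x - 1) (𝓝 1) (𝓝 (1 - 1)) := (continuous_id.sub continuous_const).tendsto 1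
    rw [sub_self] at this
    exact this.mono_left nhdsWithin_le_nhds
  have l := (((l1.norm.pow 3).mul (l2.norm.pow 4)).mul l3.norm).mul l4
  rw [mul_zero] at l
  have := ge_of_tendsto l (b := 1) (by
    filter_upwards [self_mem_nhdsWithin] with x hx
    have hx : 1 < x := hx
    have h := hN.ge_341 hx y
    rw [← heq _ (by simpa using hx), ← heq _ (by simpa using hx), ← heq _ (by simpa using hx)] at h
    have e1 : ‖Z x‖ = (x - 1)⁻¹ * ‖g x‖ := by
      rw [hZg x (by intro h; have := congrArg Complex.re h; simp at this; linarith) (by intro h; have := congrArg Complex.re h; simp at this; linarith), norm_mul, norm_inv]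
      congr 2
      rw [show (x:ℂ) - 1 = ((x - 1 : ℝ) : ℂ) by push_cast; rfl, Complex.norm_real, Real.norm_of_nonneg (by linarith)]
    have e2 : ‖Z (x + Complex.I * y) / (x - 1)‖ = ‖Z (x + Complex.I * y)‖ * (x - 1)⁻¹ := by
      rw [norm_div, div_eq_mul_inv]
      congr 2
      rw [show (x:ℂ) - 1 = ((x - 1 : ℝ) : ℂ) by push_cast; rfl, Complex.norm_real, Real.norm_of_nonneg (by linarith)]
    rw [e1] at h
    rw [e2]
    refine h.trans (le_of_eq ?_)
    have : x - 1 ≠ 0 := by linarith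
    field_simp)
  linarith

variable (K) in
lemma exists_zeta : ∃ Z : ℂ → ℂ, IsZeta K Z := by
  obtain ⟨P, A, B, M, ε, Δ, hP, hA, hB, hM, hε, hreal, hfe, hbd⟩ := exists_completed K
  have hsum := fun σ hσ => (hreal σ hσ).1
  have hgood := nrm_good K hsum
  let L : ℂ → ℂ := fun s => P s - A / s - B / (1 - s)
  have hLd : ∀ s, s ≠ 0 → s ≠ 1 → DifferentiableAt ℂ L s := by
    intro s h0 h1
    have h1' : 1 - s ≠ 0 := sub_ne_zero.2 (Ne.symm h1)
    exact ((hP s).sub ((differentiableAt_const _).div differentiableAt_id h0)).sub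
      ((differentiableAt_const _).div ((differentiableAt_const _).sub differentiableAt_id) h1')
  have hPm : ∀ s, MeromorphicAt P s := fun s => (hP.analyticAt s).meromorphicAt
  have hcgm : ∀ s, AnalyticAt ℂ (fun s => (M:ℂ)⁻¹ * cg K s) s := fun s => analyticAt_const.mul ((cg_diff K).analyticAt s)
  have hLm : ∀ s, MeromorphicAt L s := by
    intro s
    have hid : MeromorphicAt (fun z : ℂ => z) s := analyticAt_id.meromorphicAt
    have hid1 : MeromorphicAt (fun z : ℂ => 1 - z) s := (analyticAt_const.sub analyticAt_id).meromorphicAt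
    exact ((hPm s).sub ((MeromorphicAt.const _ _).div hid)).sub ((MeromorphicAt.const _ _).div hid1)
  have hM0 : (M:ℂ) ≠ 0 := by exact_mod_cast hM.ne'
  let Z : ℂ → ℂ := fun s => L s * ((M:ℂ)⁻¹ * cg K s)
  have hZd : ∀ s, s ≠ 0 → s ≠ 1 → DifferentiableAt ℂ Z s := fun s h0 h1 => (hLd s h0 h1).mul (hcgm s).differentiableAt
  have hZm : ∀ s, MeromorphicAt Z s := fun s => (hLm s).mul (hcgm s).meromorphicAt
  have hZreal : ∀ σ : ℝ, 1 < σ → Z σ = ep (nrm K) σ := by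
    intro σ hσ
    show (P σ - A / σ - B / (1 - σ)) * _ = _
    rw [(hreal σ hσ).2, ← euler_real K hsum hσ, Complex.ofReal_mul, Complex.ofReal_mul]
    have := cg_real (K := K) (σ := σ) (by linarith)
    field_simp
    linear_combination ((∑' J : (Ideal (𝓞 K))⁰, (Ideal.absNorm (J : Ideal (𝓞 K)) : ℝ) ^ (-σ) : ℝ) : ℂ) * this
  have hopen : IsOpen {s : ℂ | 1 < s.re} := isOpen_lt continuous_const Complex.continuous_re
  have hZeq : ∀ s : ℂ, 1 < s.re → Z s = ep (nrm K) s := by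
    have := ident_real (f := Z) (g := ep (nrm K)) hopen (halfplane_preconnected 1)
      (fun s (hs : 1 < s.re) => (hZd s (by rintro rfl; simp at hs; linarith) (by rintro rfl; simp at hs)).differentiableWithinAt)
      (fun s hs => (hgood.differentiableAt hs).differentiableWithinAt) 1 2 (by norm_num) (by simp) hZreal
    exact fun s hs => this hs
  let g : ℂ → ℂ := fun s => ((s - 1) * P s - A * (s - 1) / s + B) * ((M:ℂ)⁻¹ * cg K s)
  have hg : AnalyticAt ℂ g 1 := by
    have h1 : AnalyticAt ℂ (fun s : ℂ => s - 1) 1 := analyticAt_id.sub analyticAt_const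
    exact (((h1.mul (hP.analyticAt 1)).sub ((analyticAt_const.mul h1).div analyticAt_id one_ne_zero)).add analyticAt_const).mul (hcgm 1)
  have hZg : ∀ s, s ≠ 1 → s ≠ 0 → Z s = (s - 1)⁻¹ * g s := by
    intro s h1 h0
    have h1a : s - 1 ≠ 0 := sub_ne_zero.2 h1
    have h1b : 1 - s ≠ 0 := sub_ne_zero.2 (Ne.symm h1)
    simp only [Z, g, L]
    field_simp
    ring
  have hg1 : g 1 ≠ 0 := by
    simp only [g, sub_self, zero_mul, mul_zero, zero_div, zero_add, zero_sub, neg_zero]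
    exact mul_ne_zero (by exact_mod_cast hB.ne') (mul_ne_zero (inv_ne_zero hM0) (cg_ne_of_re (by simp)))
  -- conjugation
  have hconj : ∀ s, s ≠ 0 → s ≠ 1 → Z s = conj (Z (conj s)) := by
    have hU : IsOpen ({0, 1}ᶜ : Set ℂ) := (Set.toFinite _).isClosed.isOpen_compl
    have := ident_real (f := Z) (g := fun s => conj (Z (conj s))) hU (compl_pair_preconnected 0 1)
      (fun s hs => (hZd s (by rintro rfl; simp at hs) (by rintro rfl; simp at hs)).differentiableWithinAt)
      (fun s hs => by
        have : DifferentiableAt ℂ Z (conj s) := hZd _ (by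
          intro h; apply hs; left; simpa using h) (by
          intro h; apply hs; right
          have := congrArg conj h
          simpa using this)
        have h2 := this.conj_conj
        simp only [Complex.conj_conj] at h2
        exact h2.differentiableWithinAt) 1 2 (by norm_num) (by simp) (fun σ hσ => by
        simp only [Complex.conj_ofReal]
        rw [hZreal σ hσ, ← hgood.conj (by simpa using hσ), Complex.conj_ofReal])
    intro s h0 h1
    exact this (by simp [h0, h1])
  have hordL : ∀ w : ℂ, w.im ≠ 0 → meromorphicOrderAt Z w = meromorphicOrderAt L w := by
    intro w hw
    have h := meromorphicOrderAt_mul (hLm w) (hcgm w).meromorphicAt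
    have h2 : meromorphicOrderAt (fun s => (M:ℂ)⁻¹ * cg K s) w = 0 := by
      rw [(hcgm w).meromorphicOrderAt_eq, (hcgm w).analyticOrderAt_eq_zero.2 (mul_ne_zero (inv_ne_zero hM0) (cg_ne_of_im hw))]
      rfl
    rw [h2, add_zero] at h
    exact h
  have hordfe : ∀ w : ℂ, w.im ≠ 0 → meromorphicOrderAt L (1 - w) = meromorphicOrderAt L w := by
    intro w hw
    have han : AnalyticAt ℂ (fun s : ℂ => 1 - s) w := analyticAt_const.sub analyticAt_id
    have hder : deriv (fun s : ℂ => 1 - s) w ≠ 0 := by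
      have : HasDerivAt (fun s : ℂ => 1 - s) (-1) w := (hasDerivAt_id w).const_sub 1
      rw [this.deriv]; norm_num
    have h1 := meromorphicOrderAt_comp_of_deriv_ne_zero (f := L) han hder
    rw [← h1]
    have he : AnalyticAt ℂ (fun s : ℂ => (ε:ℂ) * Complex.exp (-Δ * s)) w := by fun_prop
    have h2 := meromorphicOrderAt_mul he.meromorphicAt (hLm w)
    have h3 : meromorphicOrderAt (fun s : ℂ => (ε:ℂ) * Complex.exp (-Δ * s)) w = 0 := by
      rw [he.meromorphicOrderAt_eq, he.analyticOrderAt_eq_zero.2 (mul_ne_zero (by exact_mod_cast hε.ne') (Complex.exp_ne_zero _))]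
      rfl
    rw [h3, zero_add] at h2
    rw [← h2]
    refine meromorphicOrderAt_congr ?_
    have hU : IsOpen {z : ℂ | z.im ≠ 0} := isOpen_ne_fun Complex.continuous_im continuous_const
    filter_upwards [nhdsWithin_le_nhds (hU.mem_nhds hw)] with z hz
    have := hfe z (by rintro rfl; simp at hz) (by rintro rfl; simp at hz)
    simp only [Function.comp, L, Pi.mul_apply, sub_sub_cancel]
    exact this
  refine ⟨Z, hgood, hZd, hZm, hZeq, ?_, ?_, ?_, line_aux hgood hZeq hZd hg.continuousAt hZg⟩
  · refine (meromorphicOrderAt_eq_int_iff (hZm 1)).2 ⟨g, hg, hg1, ?_⟩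
    have hU : IsOpen {z : ℂ | z ≠ 0} := isOpen_ne_fun continuous_id continuous_const
    filter_upwards [self_mem_nhdsWithin, nhdsWithin_le_nhds (hU.mem_nhds one_ne_zero)] with z hz hz0
    rw [hZg z hz hz0, _root_.zpow_neg_one, smul_eq_mul]
  · intro w hw
    have hw' : (conj w).im ≠ 0 := by simpa using hw
    rw [hordL _ (by simpa using hw), hordfe _ hw', ← hordL _ hw']
    refine (order_conj (hZm _) (hZm _) ?_).symm
    have hU : IsOpen {z : ℂ | z.im ≠ 0} := isOpen_ne_fun Complex.continuous_im continuous_const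
    filter_upwards [nhdsWithin_le_nhds (hU.mem_nhds hw)] with z hz
    exact hconj z (by rintro rfl; simp at hz) (by rintro rfl; simp at hz)
  · obtain ⟨C1, hC10, hC1⟩ := cg_bound K
    obtain ⟨C2, hC20, hC2⟩ := cg_inv_bound K
    obtain ⟨C3, hC3⟩ := hbd (-1) 2
    obtain ⟨C4, hC41, hC4⟩ := hgood.bound
    -- bound of L for real part at least minus one
    have key1 : ∃ C : ℝ, 0 ≤ C ∧ ∀ T : ℝ, 1 ≤ T → ∀ s : ℂ, ‖s‖ ≤ T → 1 ≤ |s.im| → -1 ≤ s.re → ‖L s‖ ≤ Real.exp (C * T ^ 2) := by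
      have hlog4 := Real.log_nonneg hC41
      have hla := abs_nonneg (Real.log M)
      refine ⟨|C3| + A + B + (Real.log C4 + |Real.log M| + C2), by positivity, fun T hT s hs him hre => ?_⟩
      have hT2 : 1 ≤ T ^ 2 := by nlinarith
      by_cases h2 : s.re ≤ 2
      · have n1 : 1 ≤ ‖s‖ := him.trans (Complex.abs_im_le_norm s)
        have n2 : 1 ≤ ‖1 - s‖ := him.trans (by simpa using Complex.abs_im_le_norm (1 - s))
        have : ‖L s‖ ≤ |C3| + A + B := by
          calc ‖L s‖ ≤ ‖P s‖ + ‖(A:ℂ) / s‖ + ‖(B:ℂ) / (1 - s)‖ := (norm_sub_le _ _).trans (by gcongr; exact norm_sub_le _ _)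
            _ ≤ |C3| + A + B := by
              rw [norm_div, norm_div, Complex.norm_real, Complex.norm_real, Real.norm_of_nonneg hA.le, Real.norm_of_nonneg hB.le]
              have := (hC3 s hre h2).trans (le_abs_self C3)
              have := div_le_self hA.le n1
              have := div_le_self hB.le n2
              linarith
        have h3 := Real.add_one_le_exp ((|C3| + A + B + (Real.log C4 + |Real.log M| + C2)) * T ^ 2)
        have h4 : |C3| + A + B + (Real.log C4 + |Real.log M| + C2) ≤ (|C3| + A + B + (Real.log C4 + |Real.log M| + C2)) * T ^ 2 :=
          le_mul_of_one_le_right (by positivity) hT2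
        linarith
      · push Not at h2
        have hc : cg K s ≠ 0 := cg_ne_of_re (by linarith)
        have e : L s = M * ep (nrm K) s * (cg K s)⁻¹ := by
          rw [← hZeq s (by linarith)]
          simp only [Z]; field_simp
        have b1 := hC4 s h2.le
        have b2 := hC2 T hT s hs h2.le
        rw [e, norm_mul, norm_mul, Complex.norm_real, Real.norm_of_nonneg hM.le]
        have m1 : M ≤ Real.exp (|Real.log M|) := by
          conv_lhs => rw [← Real.exp_log hM]
          exact Real.exp_le_exp.2 (le_abs_self _)
        have m2 : C4 = Real.exp (Real.log C4) := (Real.exp_log (by linarith)).symm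
        calc _ ≤ Real.exp (|Real.log M|) * Real.exp (Real.log C4) * Real.exp (C2 * T ^ 2) := by
              gcongr; exact m2 ▸ b1
          _ = Real.exp (|Real.log M| + Real.log C4 + C2 * T ^ 2) := by rw [Real.exp_add, Real.exp_add]
          _ ≤ _ := by
            apply Real.exp_le_exp.2
            have := le_mul_of_one_le_right hla hT2
            have := le_mul_of_one_le_right hlog4 hT2
            have : 0 ≤ (|C3| + A + B) * T ^ 2 := by positivity
            linarith
    obtain ⟨C5, hC50, hC5⟩ := key1
    have key2 : ∃ C : ℝ, 0 ≤ C ∧ ∀ T : ℝ, 1 ≤ T → ∀ s : ℂ, ‖s‖ ≤ T → 1 ≤ |s.im| → ‖L s‖ ≤ Real.exp (C * T ^ 2) := by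
      refine ⟨4 * C5 + |Real.log ε⁻¹| + |Δ|, by positivity, fun T hT s hs him => ?_⟩
      have hT2 : 1 ≤ T ^ 2 := by nlinarith
      have hTT : T ≤ T ^ 2 := by nlinarith
      by_cases hre : -1 ≤ s.re
      · refine (hC5 T hT s hs him hre).trans (Real.exp_le_exp.2 ?_)
        have : 0 ≤ (3 * C5 + |Real.log ε⁻¹| + |Δ|) * T ^ 2 := by positivity
        linarith
      · push Not at hre
        have h1 := hfe s (by rintro rfl; simp at hre; linarith) (by rintro rfl; simp at hre; linarith)
        have h2 : L (1 - s) = ε * Complex.exp (-Δ * s) * L s := by simp only [L, sub_sub_cancel]; exact h1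
        have h3 : ‖L (1 - s)‖ ≤ Real.exp (C5 * (2 * T) ^ 2) := hC5 (2 * T) (by linarith) (1 - s) (by
          refine (norm_sub_le _ _).trans ?_
          rw [norm_one]; linarith) (by simpa using him) (by simp; linarith)
        have hε0 : (ε:ℂ) ≠ 0 := by exact_mod_cast hε.ne'
        have h4 : L s = ((ε⁻¹ : ℝ) : ℂ) * Complex.exp (Δ * s) * L (1 - s) := by
          rw [h2, show -(Δ:ℂ) * s = -(Δ * s) by ring, Complex.exp_neg]
          have := Complex.exp_ne_zero (Δ * s)
          push_cast
          field_simp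
        rw [h4, norm_mul, norm_mul, Complex.norm_real, Real.norm_of_nonneg (inv_pos.2 hε).le]
        have m1 : ε⁻¹ ≤ Real.exp (|Real.log ε⁻¹| * T ^ 2) := by
          conv_lhs => rw [← Real.exp_log (inv_pos.2 hε)]
          exact Real.exp_le_exp.2 ((le_abs_self _).trans (le_mul_of_one_le_right (abs_nonneg _) hT2))
        have m2 : ‖Complex.exp (Δ * s)‖ ≤ Real.exp (|Δ| * T ^ 2) := by
          refine (Complex.norm_exp_le_exp_norm _).trans (Real.exp_le_exp.2 ?_)
          rw [norm_mul, Complex.norm_real, Real.norm_eq_abs]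
          gcongr
          exact hs.trans hTT
        calc _ ≤ Real.exp (|Real.log ε⁻¹| * T ^ 2) * Real.exp (|Δ| * T ^ 2) * Real.exp (C5 * (2 * T) ^ 2) := by gcongr
          _ = _ := by rw [← Real.exp_add, ← Real.exp_add]; congr 1; ring
    obtain ⟨C6, hC60, hC6⟩ := key2
    refine ⟨|Real.log M⁻¹| + C1 + C6, by positivity, fun T hT s hs him => ?_⟩
    have hT2 : 1 ≤ T ^ 2 := by nlinarith
    have m1 : M⁻¹ ≤ Real.exp (|Real.log M⁻¹| * T ^ 2) := by
      conv_lhs => rw [← Real.exp_log (inv_pos.2 hM)]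
      exact Real.exp_le_exp.2 ((le_abs_self _).trans (le_mul_of_one_le_right (abs_nonneg _) hT2))
    have e : ‖Z s‖ = ‖L s‖ * (M⁻¹ * ‖cg K s‖) := by
      simp only [Z]
      rw [norm_mul, norm_mul, norm_inv, Complex.norm_real, Real.norm_of_nonneg hM.le]
    rw [e]
    calc _ ≤ Real.exp (C6 * T ^ 2) * (Real.exp (|Real.log M⁻¹| * T ^ 2) * Real.exp (C1 * T ^ 2)) := by
          gcongr
          · exact hC6 T hT s hs him
          · exact hC1 T hT s hs him
      _ = _ := by rw [← Real.exp_add, ← Real.exp_add]; congr 1; ring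

end nf
end NB
end

section
open MeasureTheory Set Filter Topology

set_option linter.unusedSectionVars false
set_option linter.unusedSimpArgs false
set_option linter.unusedVariables false
namespace NB
open Matrix NumberField
open scoped ComplexConjugate nonZeroDivisors

section nf
variable {K : Type*} [Field K] [NumberField K]

section ext
variable {k : Type*} [Field k] [NumberField k] [Algebra k K]

/-- the prime below -/
noncomputable def below (k : Type*) [Field k] [NumberField k] [Algebra k K] (P : Pr K) : Pr k :=
  ⟨P.1.under (𝓞 k), fun h => P.2.1 (Ideal.eq_bot_of_comap_eq_bot h), by have := P.2.2; infer_instance⟩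

lemma absNorm_eq_of_dvd {I J : Ideal (𝓞 K)} (h : I ∣ J) (hJ : J ≠ ⊥) (hn : Ideal.absNorm I = Ideal.absNorm J) : I = J := by
  obtain ⟨L, rfl⟩ := h
  rw [map_mul] at hn
  have h0 : Ideal.absNorm I ≠ 0 := by
    rw [Ne, Ideal.absNorm_eq_zero_iff]; rintro rfl; simp at hJ
  have h1 : Ideal.absNorm L = 1 := by
    have : Ideal.absNorm I * Ideal.absNorm L = Ideal.absNorm I * 1 := by rw [mul_one]; exact hn.symm
    exact Nat.eq_of_mul_eq_mul_left (Nat.pos_of_ne_zero h0) this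
  rw [Ideal.absNorm_eq_one_iff] at h1
  rw [h1, Ideal.mul_top]

variable [IsGalois k K]

variable (K) in
lemma local_data {q : ℕ} (hcard : Nat.card Gal(K/k) = q) (p : Pr k) :
    Finite {P : Pr K // below k P = p} ∧ ∃ g e f : ℕ, g * (e * f) = q ∧ Nat.card {P : Pr K // below k P = p} = g ∧
      (∀ P : {P : Pr K // below k P = p}, nrm K P.1 = nrm k p ^ f) ∧
      ((Ideal.map (algebraMap (𝓞 k) (𝓞 K)) p.1).IsPrime ↔ f = q) ∧
      (e ≠ 1 → ∃ P : Pr K, below k P = p ∧ P.1 ∣ differentIdeal (𝓞 k) (𝓞 K)) := by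
  have hp := p.2.2
  have hmax : p.1.IsMaximal := hp.isMaximal p.2.1
  have hlies : ∀ P : Pr K, below k P = p → P.1.LiesOver p.1 := by
    intro P h
    exact ⟨by rw [← h]; rfl⟩
  have hne : ∀ P : Ideal (𝓞 K), P.LiesOver p.1 → P ≠ ⊥ := by
    rintro P h rfl
    apply p.2.1
    rw [h.over]
    exact Ideal.comap_bot_of_injective _ (FaithfulSMul.algebraMap_injective _ _)
  let E : {P : Pr K // below k P = p} ≃ p.1.primesOver (𝓞 K) :=
    { toFun := fun P => ⟨P.1.1, P.1.2.2, hlies P.1 P.2⟩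
      invFun := fun P => ⟨⟨P.1, hne P.1 P.2.2, P.2.1⟩, Subtype.ext P.2.2.over.symm⟩
      left_inv := fun P => rfl
      right_inv := fun P => rfl }
  have hfin : Finite (p.1.primesOver (𝓞 K)) := Algebra.QuasiFinite.finite_primesOver p.1
  have hefg := Ideal.ncard_primesOver_mul_ramificationIdxIn_mul_inertiaDegIn p.1 (𝓞 K) Gal(K/k)
  rw [hcard] at hefg
  have hNP : ∀ P : {P : Pr K // below k P = p}, nrm K P.1 = nrm k p ^ (p.1.inertiaDegIn (𝓞 K)) := by
    intro P
    have h1 := P.1.2.2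
    have h2 := hlies P.1 P.2
    have h3 := Ideal.absNorm_pow_inertiaDeg p.1 P.1.1
    rw [Ideal.inertiaDegIn_eq_inertiaDeg p.1 P.1.1 Gal(K/k)]
    exact h3.symm
  obtain ⟨P0⟩ : Nonempty (p.1.primesOver (𝓞 K)) := inferInstance
  have hmapN : Ideal.absNorm (Ideal.map (algebraMap (𝓞 k) (𝓞 K)) p.1) = nrm k p ^ q := by
    have := Ideal.absNorm_algebraMap (R := 𝓞 k) (S := 𝓞 K) p.1
    rw [← IsFractionRing.finrank_eq (𝓞 k) k (𝓞 K) K, ← IsGalois.card_aut_eq_finrank, hcard] at this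
    exact this
  have h2 : 2 ≤ nrm k p := by
    have h0 : Ideal.absNorm p.1 ≠ 0 := by rw [Ne, Ideal.absNorm_eq_zero_iff]; exact p.2.1
    have h1 : Ideal.absNorm p.1 ≠ 1 := by rw [Ne, Ideal.absNorm_eq_one_iff]; exact p.2.2.ne_top
    unfold nrm; omega
  have hmap0 : Ideal.map (algebraMap (𝓞 k) (𝓞 K)) p.1 ≠ ⊥ := by
    rw [Ne, Ideal.map_eq_bot_iff_of_injective (FaithfulSMul.algebraMap_injective _ _)]; exact p.2.1
  refine ⟨Finite.of_equiv _ E.symm, _, _, _, hefg, ?_, hNP, ⟨fun h => ?_, fun h => ?_⟩, fun he => ?_⟩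
  · rw [Nat.card_congr E]; exact Nat.card_coe_set_eq _
  · have hl : below k (⟨_, hmap0, h⟩ : Pr K) = p := by
      refine Subtype.ext ?_
      refine (hmax.eq_of_le (h.comap _).ne_top ?_).symm
      exact Ideal.le_comap_map
    have h3 := hNP ⟨⟨_, hmap0, h⟩, hl⟩
    have h4 : nrm K (⟨_, hmap0, h⟩ : Pr K) = nrm k p ^ q := hmapN
    rw [h4] at h3
    exact (Nat.pow_right_injective h2 h3).symm
  · have h3 := hNP (E.symm P0)
    rw [h] at h3
    have h4 : Ideal.absNorm P0.1 = nrm k p ^ q := h3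
    have hd : P0.1 ∣ Ideal.map (algebraMap (𝓞 k) (𝓞 K)) p.1 := by
      rw [Ideal.dvd_iff_le, Ideal.map_le_iff_le_comap]
      exact le_of_eq P0.2.2.over
    rw [← absNorm_eq_of_dvd hd hmap0 (by rw [h4, hmapN])]
    exact P0.2.1
  · have h1 := P0.2.1
    have h3 := P0.2.2
    refine ⟨(E.symm P0).1, (E.symm P0).2, ?_⟩
    show P0.1 ∣ _
    rw [dvd_differentIdeal_iff]
    intro hu
    apply he
    rw [Ideal.ramificationIdxIn_eq_ramificationIdx p.1 P0.1 Gal(K/k)]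
    exact Ideal.ramificationIdx_eq_one P0.1 (𝓞 k)

end ext

end nf
end NB
end

section
open MeasureTheory Set Filter Topology

set_option linter.unusedSectionVars false
set_option linter.unusedSimpArgs false
set_option linter.unusedVariables false
namespace NB
open Matrix NumberField
open scoped ComplexConjugate nonZeroDivisors

section nf
variable {K : Type*} [Field K] [NumberField K]
section ext
variable {k : Type*} [Field k] [NumberField k] [Algebra k K]

/-- inert primes -/
abbrev Inert (k K : Type*) [Field k] [NumberField k] [Field K] [NumberField K] [Algebra k K] :=
  {𝔭 : Ideal (𝓞 k) // 𝔭 ≠ ⊥ ∧ 𝔭.IsPrime ∧ (Ideal.map (algebraMap (𝓞 k) (𝓞 K)) 𝔭).IsPrime}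

/-- norms of inert primes -/
noncomputable def nIn (k K : Type*) [Field k] [NumberField k] [Field K] [NumberField K] [Algebra k K] (p : Inert k K) : ℕ :=
  Ideal.absNorm p.1

/-- inclusion -/
def inPr (k K : Type*) [Field k] [NumberField k] [Field K] [NumberField K] [Algebra k K] (p : Inert k K) : Pr k := ⟨p.1, p.2.1, p.2.2.1⟩

lemma inPr_inj : Function.Injective (inPr k K) := by
  intro a b h
  have h1 : (inPr k K a).1 = (inPr k K b).1 := by rw [h]
  exact Subtype.ext h1

lemma nIn_good (h : Good (nrm k)) : Good (nIn k K) := by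
  refine ⟨fun i => h.1 (inPr k K i), fun σ hσ => ?_⟩
  have h1 := (h.2 σ hσ).comp_injective (inPr_inj (k := k) (K := K))
  exact h1

variable [IsGalois k K]

variable (k K) in
lemma ram_finite : {p : Pr k | ∃ P : Pr K, below k P = p ∧ P.1 ∣ differentIdeal (𝓞 k) (𝓞 K)}.Finite := by
  have h0 : differentIdeal (𝓞 k) (𝓞 K) ≠ 0 := differentIdeal_ne_bot (A := 𝓞 k) (B := 𝓞 K)
  have h1 := Ideal.finite_factors h0
  have h2 : {P : Pr K | P.1 ∣ differentIdeal (𝓞 k) (𝓞 K)}.Finite := by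
    refine Set.Finite.of_injOn (f := fun P : Pr K => (⟨P.1, P.2.2, P.2.1⟩ : IsDedekindDomain.HeightOneSpectrum (𝓞 K))) ?_ ?_ h1
    · intro P hP; exact hP
    · intro P _ Q _ h
      exact Subtype.ext (congrArg IsDedekindDomain.HeightOneSpectrum.asIdeal h)
  refine (h2.image (below k)).subset ?_
  rintro p ⟨P, h, h'⟩
  exact ⟨P, h', h⟩

lemma hasProd_pow {ι : Type*} {f : ι → ℂ} {a : ℂ} (h : HasProd f a) (n : ℕ) : HasProd (fun i => f i ^ n) (a ^ n) := by
  exact h.map (powMonoidHom n) (continuous_pow n)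

variable (k K) in
lemma euler_identity {q : ℕ} (hq : q.Prime) (hcard : Nat.card Gal(K/k) = q) (hk : Good (nrm k)) (hK : Good (nrm K)) :
    ∃ R : Finset (Pr k), ∀ s : ℂ, 1 < s.re →
      ep (nIn k K) s ^ q * ep (nrm K) s =
        ep (nrm k) s ^ q * (∏ p ∈ R, (1 - (nrm k p : ℂ) ^ (-s))) ^ (q - 1) * ep (nIn k K) (q * s) := by
  classical
  have hloc := fun p : Pr k => (local_data K hcard p).2
  have hfin := fun p : Pr k => (local_data K hcard p).1
  choose g e f hgef hg hf hin hram using hloc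
  have hR : {p : Pr k | e p ≠ 1}.Finite := (ram_finite K k).subset fun p hp => hram p hp
  refine ⟨hR.toFinset, fun s hs => ?_⟩
  have hgood := nIn_good (K := K) hk
  have hqs : 1 < ((q : ℂ) * s).re := by
    have : (1:ℝ) ≤ q := by exact_mod_cast hq.one_le
    simp; nlinarith
  -- zeta_K grouped
  have hKp : HasProd (fun p : Pr k => ((1 - ((nrm k p : ℂ) ^ (-s)) ^ f p)⁻¹) ^ g p) (ep (nrm K) s) := by
    have h1 := (Equiv.sigmaFiberEquiv (below (K := K) k)).hasProd_iff.2 (hK.hasProd hs)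
    refine HasProd.sigma h1 fun p => ?_
    have := hfin p
    have hft : Fintype {P : Pr K // below k P = p} := Fintype.ofFinite _
    have h2 := hasProd_fintype (fun P : {P : Pr K // below k P = p} => (1 - (nrm K P.1 : ℂ) ^ (-s))⁻¹)
    have h3 : ∏ P : {P : Pr K // below k P = p}, (1 - (nrm K P.1 : ℂ) ^ (-s))⁻¹ = ((1 - ((nrm k p : ℂ) ^ (-s)) ^ f p)⁻¹) ^ g p := by
      rw [← hg p, Nat.card_eq_fintype_card, ← Finset.card_univ, ← Finset.prod_const]
      refine Finset.prod_congr rfl fun P _ => ?_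
      rw [hf p P]
      congr 2
      push_cast
      rw [← Complex.cpow_nat_mul, ← Complex.natCast_cpow_natCast_mul, mul_comm]
    rw [h3] at h2
    exact h2
  have ext1 : ∀ w : ℂ, 1 < w.re → HasProd (fun p : Pr k => if f p = q then (1 - (nrm k p : ℂ) ^ (-w))⁻¹ else 1) (ep (nIn k K) w) := by
    intro w hw
    refine ((inPr_inj (k := k) (K := K)).hasProd_iff ?_).1 ?_
    · intro p hp
      rw [if_neg]
      intro hfq
      exact hp ⟨⟨p.1, p.2.1, p.2.2, (hin p).2 hfq⟩, rfl⟩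
    · convert! hgood.hasProd hw using 1
      ext p
      show (if f (inPr k K p) = q then _ else _) = _
      rw [if_pos ((hin (inPr k K p)).1 p.2.2.2)]
      rfl
  have hram' : HasProd (fun p : Pr k => if e p ≠ 1 then (1 - (nrm k p : ℂ) ^ (-s)) else 1) (∏ p ∈ hR.toFinset, (1 - (nrm k p : ℂ) ^ (-s))) := by
    have h1 : ∏ p ∈ hR.toFinset, (1 - (nrm k p : ℂ) ^ (-s)) = ∏ p ∈ hR.toFinset, (if e p ≠ 1 then (1 - (nrm k p : ℂ) ^ (-s)) else 1) := by
      refine Finset.prod_congr rfl fun p hp => ?_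
      rw [if_pos]; simpa using hp
    rw [h1]
    refine hasProd_prod_of_ne_finset_one fun p hp => ?_
    rw [if_neg]; simpa using hp
  have hL := (hasProd_pow (ext1 s hs) q).mul hKp
  have hRR := ((hasProd_pow (hk.hasProd hs) q).mul (hasProd_pow hram' (q - 1))).mul (ext1 _ hqs)
  refine hL.unique ?_
  convert! hRR using 1
  ext p
  have hx : (nrm k p : ℂ) ^ (-(q * s)) = ((nrm k p : ℂ) ^ (-s)) ^ q := by
    rw [← Complex.cpow_nat_mul]; congr 1; ring
  rw [hx]
  have hx1 := hk.one_sub_ne p (s := s) (by linarith)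
  set x := (nrm k p : ℂ) ^ (-s)
  have hq1 := hq.one_lt
  have h3 := hgef p
  by_cases hfq : f p = q
  · have h4 : g p * e p = 1 := by
      have : (g p * e p) * q = 1 * q := by
        rw [hfq] at h3
        rw [one_mul, mul_assoc]; exact h3
      exact Nat.eq_of_mul_eq_mul_right hq.pos this
    have hg1 : g p = 1 := Nat.eq_one_of_mul_eq_one_right h4
    have he1 : e p = 1 := Nat.eq_one_of_mul_eq_one_left h4
    simp [hfq, hg1, he1]
  · have hf1 : f p = 1 := by
      have : f p ∣ q := ⟨g p * e p, by rw [← h3]; ring⟩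
      exact ((Nat.dvd_prime hq).1 this).resolve_right hfq
    by_cases he1 : e p = 1
    · have hgq : g p = q := by rw [← h3, he1, hf1]; simp
      simp [hf1, hgq, he1, hq1.ne]
    · have heq : e p = q := by
        have : e p ∣ q := ⟨g p * f p, by rw [← h3]; ring⟩
        exact ((Nat.dvd_prime hq).1 this).resolve_left he1
      have hgq : g p = 1 := by
        rw [heq, hf1, mul_one] at h3
        exact Nat.eq_of_mul_eq_mul_right hq.pos (by rw [h3, one_mul])
      obtain ⟨m, rfl⟩ : ∃ m, q = m + 1 := ⟨q - 1, by omega⟩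
      simp only [hf1, hgq]
      rw [if_neg hq1.ne, if_neg hq1.ne, if_pos he1]
      simp only [Nat.add_sub_cancel, pow_one, one_pow, one_mul, mul_one, pow_succ, inv_pow]
      field_simp

end ext
end nf
end NB
end

section
open MeasureTheory Set Filter Topology

set_option linter.unusedSectionVars false
set_option linter.unusedSimpArgs false
set_option linter.unusedVariables false
namespace NB
open Matrix NumberField
open scoped ComplexConjugate nonZeroDivisors

section nf
variable {K : Type*} [Field K] [NumberField K]
section dir
variable {J : Type*}

lemma cpow_nat_norm {n : ℕ} (hn : 1 ≤ n) (s : ℂ) : ‖(n : ℂ) ^ s‖ = (n : ℝ) ^ s.re := by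
  rw [Complex.norm_natCast_cpow_of_pos (by omega)]

lemma dirichlet_lead (w : J → ℂ) (M : J → ℕ) (hM : ∀ j, 1 ≤ M j) (hw : ∀ j, M j = 1 → w j = 0)
    (hsum : ∀ s : ℂ, 1 < s.re → Summable (fun j => w j * (M j : ℂ) ^ (-s))) :
    (∀ s : ℂ, 1 < s.re → ∑' j, w j * (M j : ℂ) ^ (-s) = 0) ∨
    ∃ n : ℕ, 2 ≤ n ∧ ∃ d : ℂ, d ≠ 0 ∧ ∀ ε : ℝ, 0 < ε → ∃ σ : ℝ, ∀ s : ℂ, σ ≤ s.re →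
      ‖(∑' j, w j * (M j : ℂ) ^ (-s)) * (n : ℂ) ^ s - d‖ ≤ ε := by
  classical
  let d : ℕ → ℂ := fun n => ∑' j : {j // M j = n}, w j
  have hfib : ∀ n : ℕ, Summable (fun j : {j // M j = n} => w j) := by
    intro n
    rcases Nat.eq_zero_or_pos n with rfl | hn
    · have : IsEmpty {j // M j = 0} := ⟨fun j => by have := hM j.1; have := j.2; omega⟩
      exact summable_empty
    have h1 : Summable (fun j : {j // M j = n} => w j * (M j : ℂ) ^ (-(2:ℂ))) := (hsum 2 (by norm_num)).subtype {j | M j = n}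
    have h2 := h1.mul_right ((n : ℂ) ^ (2:ℂ))
    refine h2.congr fun j => ?_
    have hn0 : (n : ℂ) ≠ 0 := by exact_mod_cast hn.ne'
    rw [j.2, mul_assoc, ← Complex.cpow_add _ _ hn0]
    simp
  have hS : ∀ s : ℂ, 1 < s.re → HasSum (fun n : ℕ => d n * (n : ℂ) ^ (-s)) (∑' j, w j * (M j : ℂ) ^ (-s)) := by
    intro s hs
    have h1 := (Equiv.sigmaFiberEquiv M).hasSum_iff.2 (hsum s hs).hasSum
    refine HasSum.sigma h1 fun n => ?_
    have h2 := (hfib n).hasSum.mul_right ((n : ℂ) ^ (-s))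
    convert! h2 using 1
    ext j
    simp [Equiv.sigmaFiberEquiv, j.2]
  by_cases hall : ∀ n, d n = 0
  · left
    intro s hs
    refine (hS s hs).unique ?_
    simp only [hall, zero_mul]
    exact hasSum_zero
  right
  push Not at hall
  set n := Nat.find hall with hn
  have hdn : d n ≠ 0 := Nat.find_spec hall
  have hlt : ∀ m, m < n → d m = 0 := fun m hm => by
    by_contra h; exact Nat.find_min hall hm h
  have hd0 : d 0 = 0 := by
    have : IsEmpty {j // M j = 0} := ⟨fun j => by have := hM j.1; have := j.2; omega⟩
    exact tsum_empty
  have hd1 : d 1 = 0 := by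
    have : ∀ j : {j // M j = 1}, w j = 0 := fun j => hw j.1 j.2
    show ∑' j : {j // M j = 1}, w j = 0
    simp [this]
  have hn2 : 2 ≤ n := by
    by_contra h
    have : n = 0 ∨ n = 1 := by omega
    rcases this with h | h
    · rw [h] at hdn; exact hdn hd0
    · rw [h] at hdn; exact hdn hd1
  refine ⟨n, hn2, d n, hdn, fun ε hε => ?_⟩
  have hs2 : Summable (fun m : ℕ => ‖d m * (m : ℂ) ^ (-(2:ℂ))‖) := (hS 2 (by norm_num)).summable.norm
  set C := ∑' m : ℕ, ‖d m * (m : ℂ) ^ (-(2:ℂ))‖ with hC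
  have hC0 : 0 ≤ C := tsum_nonneg fun _ => norm_nonneg _
  have hnR : (2:ℝ) ≤ n := by exact_mod_cast hn2
  set t : ℝ := (n : ℝ) / (n + 1) with ht
  have ht0 : 0 < t := by positivity
  have ht1 : t < 1 := by rw [ht, div_lt_one (by positivity)]; linarith
  have hlim : Tendsto (fun x : ℝ => t ^ (x - 2) * ((n : ℝ) ^ (2:ℝ) * C)) atTop (𝓝 0) := by
    have h1 : Tendsto (fun x : ℝ => t ^ (x - 2)) atTop (𝓝 0) :=
      (tendsto_rpow_atTop_of_base_lt_one t (by linarith) ht1).comp (tendsto_atTop_add_const_right _ (-2) tendsto_id)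
    simpa using h1.mul_const ((n : ℝ) ^ (2:ℝ) * C)
  obtain ⟨σ, hσ⟩ := ((hlim.eventually (ge_mem_nhds hε)).and (eventually_ge_atTop 2)).exists_forall_of_atTop
  refine ⟨σ, fun s hs => ?_⟩
  obtain ⟨hσ1, hσ2⟩ := hσ s.re hs
  have hs1 : 1 < s.re := by linarith
  have hn0 : (n : ℂ) ≠ 0 := by exact_mod_cast (by omega : n ≠ 0)
  have h3 : HasSum (fun m : ℕ => d m * (m : ℂ) ^ (-s) * (n : ℂ) ^ s - (if m = n then d n else 0))
      ((∑' j, w j * (M j : ℂ) ^ (-s)) * (n : ℂ) ^ s - d n) :=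
    ((hS s hs1).mul_right _).sub (hasSum_ite_eq n (d n))
  rw [← h3.tsum_eq]
  have hb : ∀ m : ℕ, ‖d m * (m : ℂ) ^ (-s) * (n : ℂ) ^ s - (if m = n then d n else 0)‖ ≤
      t ^ (s.re - 2) * ((n : ℝ) ^ (2:ℝ)) * ‖d m * (m : ℂ) ^ (-(2:ℂ))‖ := by
    intro m
    rcases lt_trichotomy m n with hm | hm | hm
    · rw [hlt m hm, if_neg hm.ne]; simp
    · rw [if_pos hm, hm, mul_assoc, ← Complex.cpow_add _ _ hn0]
      simp only [neg_add_cancel, Complex.cpow_zero, mul_one, sub_self, norm_zero]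
      positivity
    · rw [if_neg hm.ne', sub_zero, norm_mul, norm_mul, norm_mul, cpow_nat_norm (by omega), cpow_nat_norm (by omega), cpow_nat_norm (by omega)]
      simp only [Complex.neg_re, Complex.re_ofNat]
      have hm0 : (0:ℝ) < m := by exact_mod_cast (by omega : 0 < m)
      have hmn : (n:ℝ) + 1 ≤ m := by exact_mod_cast hm
      have e1 : (m:ℝ) ^ (-s.re) * (n:ℝ) ^ s.re = ((n:ℝ) / m) ^ (s.re - 2) * (n:ℝ) ^ (2:ℝ) * (m:ℝ) ^ (-(2:ℝ)) := by
        rw [Real.div_rpow (by positivity) hm0.le, Real.rpow_sub (by positivity), Real.rpow_sub hm0, Real.rpow_neg hm0.le, Real.rpow_neg hm0.le]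
        field_simp
      rw [mul_assoc, e1]
      have e2 : ((n:ℝ) / m) ^ (s.re - 2) ≤ t ^ (s.re - 2) := by
        apply Real.rpow_le_rpow (by positivity) _ (by linarith)
        rw [ht]; gcongr
      calc ‖d m‖ * (((n:ℝ) / m) ^ (s.re - 2) * (n:ℝ) ^ (2:ℝ) * (m:ℝ) ^ (-(2:ℝ)))
          ≤ ‖d m‖ * (t ^ (s.re - 2) * (n:ℝ) ^ (2:ℝ) * (m:ℝ) ^ (-(2:ℝ))) := by gcongr
        _ = _ := by ring
  calc _ ≤ ∑' m, t ^ (s.re - 2) * ((n : ℝ) ^ (2:ℝ)) * ‖d m * (m : ℂ) ^ (-(2:ℂ))‖ :=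
        tsum_of_norm_bounded ((hs2.mul_left _).hasSum) hb
    _ = t ^ (s.re - 2) * ((n : ℝ) ^ (2:ℝ) * C) := by rw [tsum_mul_left, mul_assoc]
    _ ≤ ε := hσ1

end dir
end nf
end NB
end

section
open MeasureTheory Set Filter Topology

set_option linter.unusedSectionVars false
set_option linter.unusedSimpArgs false
set_option linter.unusedVariables false
namespace NB
open Matrix NumberField
open scoped ComplexConjugate nonZeroDivisors

section nf
variable {K : Type*} [Field K] [NumberField K]
section logep
variable {ι κ : Type*} {N : ι → ℕ}

/-- terms of the log series -/
noncomputable def lt (N : ι → ℕ) (j : ι × ℕ) (s : ℂ) : ℂ := (1 / (j.2 : ℂ)) * ((N j.1 ^ j.2 : ℕ) : ℂ) ^ (-s)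

lemma lt_eq (N : ι → ℕ) (j : ι × ℕ) (s : ℂ) : lt N j s = ((N j.1 : ℂ) ^ (-s)) ^ j.2 / j.2 := by
  unfold lt
  push_cast
  rw [← Complex.cpow_nat_mul, ← Complex.natCast_cpow_natCast_mul]
  ring_nf

lemma lt_bound (h : Good N) (j : ι × ℕ) {a : ℝ} (ha : 1 ≤ a) {s : ℂ} (hs : a ≤ s.re) :
    ‖lt N j s‖ ≤ (N j.1 : ℝ) ^ (-a) * (2 * (1/2) ^ j.2) := by
  obtain ⟨i, m⟩ := j
  rw [lt_eq]
  rcases m with _ | m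
  · simp; positivity
  have h2 : (2:ℝ) ≤ N i := by exact_mod_cast h.1 i
  have hx : ‖(N i : ℂ) ^ (-s)‖ ≤ (N i : ℝ) ^ (-a) := by
    rw [h.norm]
    exact Real.rpow_le_rpow_of_exponent_le (by linarith) (by linarith)
  have hx2 : (N i : ℝ) ^ (-a) ≤ 1/2 := by
    calc (N i : ℝ) ^ (-a) ≤ (N i : ℝ) ^ (-1:ℝ) := Real.rpow_le_rpow_of_exponent_le (by linarith) (by linarith)
      _ = 1 / (N i : ℝ) := by rw [Real.rpow_neg_one, one_div]
      _ ≤ 1/2 := by gcongr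
  have h0 : (0:ℝ) ≤ (N i : ℝ) ^ (-a) := by positivity
  rw [norm_div, norm_pow]
  have h3 : (1:ℝ) ≤ ‖((m + 1 : ℕ) : ℂ)‖ := by
    rw [Complex.norm_natCast]; exact_mod_cast (by omega)
  calc ‖(N i : ℂ) ^ (-s)‖ ^ (m+1) / ‖((m + 1 : ℕ) : ℂ)‖ ≤ ‖(N i : ℂ) ^ (-s)‖ ^ (m+1) := div_le_self (by positivity) h3
    _ ≤ ((N i : ℝ) ^ (-a)) ^ (m+1) := by gcongr
    _ = (N i : ℝ) ^ (-a) * ((N i : ℝ) ^ (-a)) ^ m := by ring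
    _ ≤ (N i : ℝ) ^ (-a) * (1/2) ^ m := by gcongr
    _ = _ := by rw [pow_succ]; ring

lemma lt_bound_summable (h : Good N) {a : ℝ} (ha : 1 < a) : Summable (fun j : ι × ℕ => (N j.1 : ℝ) ^ (-a) * (2 * (1/2) ^ j.2)) :=
  Summable.mul_of_nonneg (f := fun i => (N i : ℝ) ^ (-a)) (g := fun m : ℕ => (2 * (1/2) ^ m : ℝ)) (h.2 a ha)
    ((summable_geometric_of_lt_one (by norm_num) (by norm_num)).mul_left 2)
    (fun i => by positivity) (fun m => by positivity)

lemma lt_summable (h : Good N) {s : ℂ} (hs : 1 < s.re) : Summable (fun j => lt N j s) :=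
  Summable.of_norm_bounded (lt_bound_summable h hs) fun j => lt_bound h j hs.le le_rfl

lemma lt_exp (h : Good N) {s : ℂ} (hs : 1 < s.re) : Complex.exp (∑' j, lt N j s) = ep N s := by
  have h1 := (lt_summable h hs).hasSum.prod_fiberwise (g := fun i => -Complex.log (1 - (N i : ℂ) ^ (-s))) fun i => by
    simp only [lt_eq]
    exact Complex.hasSum_taylorSeries_neg_log (h.norm_lt i (by linarith))
  refine h1.cexp.unique ?_
  convert! h.hasProd hs using 1
  ext i
  simp only [Function.comp]
  rw [Complex.exp_neg, Complex.exp_log (h.one_sub_ne i (by linarith))]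

lemma lt_diff (h : Good N) : DifferentiableOn ℂ (fun s => ∑' j, lt N j s) {s | 1 < s.re} := by
  intro s hs
  have hs : 1 < s.re := hs
  have hU : IsOpen {z : ℂ | (1 + s.re) / 2 < z.re} := isOpen_lt continuous_const Complex.continuous_re
  have h1 := Complex.differentiableOn_tsum_of_summable_norm (F := fun j => lt N j) (lt_bound_summable h (a := (1 + s.re) / 2) (by linarith)) (U := {z : ℂ | (1 + s.re) / 2 < z.re}) (fun j z hz => by
      have : ((N j.1 ^ j.2 : ℕ) : ℂ) ≠ 0 := by
        have := h.1 j.1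
        exact_mod_cast (pow_ne_zero _ (by omega))
      exact (((differentiableAt_id.neg).const_cpow (Or.inl this)).const_mul _).differentiableWithinAt) hU
    (fun j z (hz : (1 + s.re) / 2 < z.re) => lt_bound h j (by linarith) hz.le)
  exact (h1.differentiableAt (hU.mem_nhds (by show (1 + s.re) / 2 < s.re; linarith))).differentiableWithinAt

lemma log_ratio {M : κ → ℕ} (hN : Good N) (hM : Good M) (q : ℕ) :
    ∃ L : ℂ → ℂ, DifferentiableOn ℂ L {s | 1 < s.re} ∧ (∀ s : ℂ, 1 < s.re → Complex.exp (L s) = ep N s ^ q / ep M s) ∧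
    ((∀ s : ℂ, 1 < s.re → L s = 0) ∨
    ∃ n : ℕ, 2 ≤ n ∧ ∃ d : ℂ, d ≠ 0 ∧ ∀ ε : ℝ, 0 < ε → ∃ σ : ℝ, ∀ s : ℂ, σ ≤ s.re → ‖L s * (n : ℂ) ^ s - d‖ ≤ ε) := by
  let w : (ι × ℕ) ⊕ (κ × ℕ) → ℂ := Sum.elim (fun j => q * (1 / (j.2 : ℂ))) (fun j => -(1 / (j.2 : ℂ)))
  let Q : (ι × ℕ) ⊕ (κ × ℕ) → ℕ := Sum.elim (fun j => N j.1 ^ j.2) (fun j => M j.1 ^ j.2)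
  have hS : ∀ s : ℂ, 1 < s.re → HasSum (fun j => w j * (Q j : ℂ) ^ (-s)) (q * (∑' j, lt N j s) - ∑' j, lt M j s) := by
    intro s hs
    rw [sub_eq_add_neg]
    refine HasSum.sum ?_ ?_
    · convert! (lt_summable hN hs).hasSum.mul_left (q : ℂ) using 1
      ext j
      simp [w, Q, lt, mul_assoc]
    · convert! (lt_summable hM hs).hasSum.neg using 1
      ext j
      simp [w, Q, lt]
  refine ⟨fun s => ∑' j, w j * (Q j : ℂ) ^ (-s), ?_, ?_, ?_⟩
  · refine DifferentiableOn.congr (f := fun s => q * (∑' j, lt N j s) - ∑' j, lt M j s) ?_ fun s hs => (hS s hs).tsum_eq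
    exact ((lt_diff hN).const_mul _).sub (lt_diff hM)
  · intro s hs
    beta_reduce
    rw [(hS s hs).tsum_eq, Complex.exp_sub, Complex.exp_nat_mul, lt_exp hN hs, lt_exp hM hs]
  · have h1 : ∀ {μ : Type _} {N : μ → ℕ} (h : Good N) (j : μ × ℕ), N j.1 ^ j.2 = 1 → (1 / (j.2 : ℂ)) = 0 := by
      intro μ N h j hj
      have := h.1 j.1
      rcases Nat.eq_zero_or_pos j.2 with h0 | h0
      · simp [h0]
      · have := Nat.one_lt_pow h0.ne' (by omega : 1 < N j.1); omega
    have h1' : ∀ {μ : Type _} {N : μ → ℕ} (h : Good N) (j : μ × ℕ), N j.1 ^ j.2 = 1 → (1 / (j.2 : ℂ)) = 0 := by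
      intro μ N h j hj
      have := h.1 j.1
      rcases Nat.eq_zero_or_pos j.2 with h0 | h0
      · simp [h0]
      · have := Nat.one_lt_pow h0.ne' (by omega : 1 < N j.1); omega
    refine dirichlet_lead w Q ?_ ?_ fun s hs => (hS s hs).summable
    · rintro (j | j)
      · exact Nat.one_le_pow _ _ (by have := hN.1 j.1; omega)
      · exact Nat.one_le_pow _ _ (by have := hM.1 j.1; omega)
    · rintro (j | j) hj
      · have := h1 hN j hj
        simp only [w, Sum.elim_inl, this, mul_zero]
      · have := h1' hM j hj
        simp only [w, Sum.elim_inr, this, neg_zero]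

end logep
end nf
end NB
end

section
open MeasureTheory Set Filter Topology

set_option linter.unusedSectionVars false
set_option linter.unusedSimpArgs false
set_option linter.unusedVariables false
namespace NB
open Matrix NumberField
open scoped ComplexConjugate nonZeroDivisors

section nf
variable {K : Type*} [Field K] [NumberField K]
lemma Good.bound_inv {ι : Type*} {N : ι → ℕ} (h : Good N) : ∃ C : ℝ, 1 ≤ C ∧ ∀ s : ℂ, 2 ≤ s.re → ‖ep N s‖⁻¹ ≤ C := by
  have hsm := lt_bound_summable h (a := 2) (by norm_num)
  refine ⟨Real.exp (∑' j : ι × ℕ, (N j.1 : ℝ) ^ (-(2:ℝ)) * (2 * (1/2) ^ j.2)), ?_, fun s hs => ?_⟩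
  · rw [Real.one_le_exp_iff]; exact tsum_nonneg fun j => by positivity
  · rw [← lt_exp h (by linarith), Complex.norm_exp, ← Real.exp_neg, Real.exp_le_exp]
    have h1 : ‖∑' j, lt N j s‖ ≤ ∑' j : ι × ℕ, (N j.1 : ℝ) ^ (-(2:ℝ)) * (2 * (1/2) ^ j.2) :=
      tsum_of_norm_bounded hsm.hasSum fun j => lt_bound h j (by norm_num) hs
    have h2 := Complex.abs_re_le_norm (∑' j, lt N j s)
    have h3 := neg_abs_le (∑' j, lt N j s).re
    linarith

/-- abstract zeta -/
structure Zt (Z : ℂ → ℂ) : Prop where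
  diff : ∀ s : ℂ, s ≠ 0 → s ≠ 1 → DifferentiableAt ℂ Z s
  mero : ∀ s, MeromorphicAt Z s
  nz : ∀ s : ℂ, 1 < s.re → Z s ≠ 0
  ord_one : meromorphicOrderAt Z 1 = (-1 : ℤ)
  symm : ∀ w : ℂ, w.im ≠ 0 → meromorphicOrderAt Z (1 - conj w) = meromorphicOrderAt Z w
  growth : ∃ C : ℝ, 0 ≤ C ∧ ∀ T : ℝ, 1 ≤ T → ∀ s : ℂ, ‖s‖ ≤ T → 1 ≤ |s.im| → ‖Z s‖ ≤ Real.exp (C * T ^ 2)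
  line : ∀ s : ℂ, s.re = 1 → s.im ≠ 0 → Z s ≠ 0
  bddinv : ∃ C : ℝ, 1 ≤ C ∧ ∀ s : ℂ, 2 ≤ s.re → ‖Z s‖⁻¹ ≤ C

lemma IsZeta.zt {Z : ℂ → ℂ} (h : IsZeta K Z) : Zt Z where
  diff := h.diff
  mero := h.mero
  nz := fun s hs => by rw [h.eq s hs]; exact h.good.ep_ne_zero hs
  ord_one := h.ord_one
  symm := h.symm
  growth := h.growth
  line := h.line
  bddinv := by
    obtain ⟨C, h1, h2⟩ := h.good.bound_inv
    exact ⟨C, h1, fun s hs => by rw [h.eq s (by linarith)]; exact h2 s hs⟩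

/-- abstract data -/
structure Dat (q : ℕ) (A B W P L : ℂ → ℂ) : Prop where
  hq : 2 ≤ q
  hA : Zt A
  hB : Zt B
  W_diff : Differentiable ℂ W
  W_ne : ∀ s : ℂ, 0 < s.re → W s ≠ 0
  P_diff : ∀ s : ℂ, 1 < s.re → DifferentiableAt ℂ P s
  P_ne : ∀ s : ℂ, 1 < s.re → P s ≠ 0
  ident : ∀ s : ℂ, 1 < s.re → P s ^ q * B s = A s ^ q * W s * P (q * s)
  L_diff : DifferentiableOn ℂ L {s | 1 < s.re}
  L_exp : ∀ s : ℂ, 1 < s.re → Complex.exp (L s) = A s ^ q / B s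
  L_lead : ∃ n : ℕ, 2 ≤ n ∧ ∃ d : ℂ, d ≠ 0 ∧ ∀ ε : ℝ, 0 < ε → ∃ σ : ℝ, ∀ s : ℂ, σ ≤ s.re → ‖L s * (n : ℂ) ^ s - d‖ ≤ ε

lemma exists_dat (k K : Type*) [Field k] [NumberField k] [Field K] [NumberField K] [Algebra k K] [IsGalois k K]
    {q : ℕ} (hq : q.Prime) (hcard : Nat.card Gal(K/k) = q) : ∃ A B W L : ℂ → ℂ, Dat q A B W (ep (nIn k K)) L := by
  obtain ⟨A, hA⟩ := exists_zeta k
  obtain ⟨B, hB⟩ := exists_zeta K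
  have hgood := nIn_good (K := K) hA.good
  obtain ⟨R, hR⟩ := euler_identity K k hq hcard hA.good hB.good
  obtain ⟨L, hLd, hLe, hLL⟩ := log_ratio hA.good hB.good q
  have hLe' : ∀ s : ℂ, 1 < s.re → Complex.exp (L s) = A s ^ q / B s := fun s hs => by
    rw [hA.eq s hs, hB.eq s hs]; exact hLe s hs
  refine ⟨A, B, fun s => (∏ p ∈ R, (1 - (nrm k p : ℂ) ^ (-s))) ^ (q - 1), L, hq.two_le, hA.zt, hB.zt, ?_, ?_, ?_, ?_, ?_, hLd, hLe', ?_⟩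
  · refine Differentiable.pow (Differentiable.fun_finsetProd fun p _ => ?_) _
    have : (nrm k p : ℂ) ≠ 0 := by have := hA.good.1 p; exact_mod_cast (by omega : nrm k p ≠ 0)
    intro z
    exact ((differentiableAt_id.neg).const_cpow (Or.inl this)).const_sub 1
  · intro s hs
    exact pow_ne_zero _ (Finset.prod_ne_zero_iff.2 fun p _ => hA.good.one_sub_ne p hs)
  · exact fun s hs => hgood.differentiableAt hs
  · exact fun s hs => hgood.ep_ne_zero hs
  · intro s hs
    rw [hA.eq s hs, hB.eq s hs]; exact hR s hs
  · refine hLL.resolve_left fun h0 => ?_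
    have h1 : EqOn (fun s => A s ^ q) B ({0, 1}ᶜ) := by
      have hop : IsOpen (({0, 1} : Set ℂ)ᶜ) := (Set.toFinite _).isClosed.isOpen_compl
      refine ident_real hop (compl_pair_preconnected 0 1) (fun s hs => ?_) (fun s hs => ?_) 1 2 (by norm_num) (by simp) (fun σ hσ => ?_)
      · simp only [mem_compl_iff, mem_insert_iff, mem_singleton_iff, not_or] at hs
        exact ((hA.diff s hs.1 hs.2).pow q).differentiableWithinAt
      · simp only [mem_compl_iff, mem_insert_iff, mem_singleton_iff, not_or] at hs
        exact (hB.diff s hs.1 hs.2).differentiableWithinAt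
      · have hs : 1 < ((σ : ℂ)).re := by simpa using hσ
        have h2 := hLe' σ hs
        rw [h0 σ hs, Complex.exp_zero, eq_div_iff (hB.zt.nz _ hs), one_mul] at h2
        exact h2.symm
    have h2 : (A ^ q) =ᶠ[𝓝[≠] 1] B := by
      have : ∀ᶠ s : ℂ in 𝓝[≠] 1, s ≠ 0 := eventually_nhdsWithin_of_eventually_nhds (eventually_ne_nhds one_ne_zero)
      filter_upwards [this, self_mem_nhdsWithin] with s hs hs1
      exact h1 (by simp only [mem_compl_iff, mem_insert_iff, mem_singleton_iff, not_or]; exact ⟨hs, hs1⟩)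
    have h3 := meromorphicOrderAt_congr h2
    rw [meromorphicOrderAt_pow (hA.mero 1), hA.ord_one, hB.ord_one] at h3
    have h4 : ((q : ℤ) * (-1) : ℤ) = -1 := by exact_mod_cast h3
    have := hq.two_le
    omega

end nf
end NB
end

section
open MeasureTheory Set Filter Topology

set_option linter.unusedSectionVars false
set_option linter.unusedSimpArgs false
set_option linter.unusedVariables false
namespace NB
open Matrix NumberField
open scoped ComplexConjugate nonZeroDivisors

section nf
variable {K : Type*} [Field K] [NumberField K]
section dat
variable {q : ℕ} {A B W P L : ℂ → ℂ}

/-- the quotient -/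
noncomputable def GG (q : ℕ) (A B W : ℂ → ℂ) (s : ℂ) : ℂ := A s ^ q / B s * W s

/-- continuations -/
noncomputable def En (q : ℕ) (A B W P : ℂ → ℂ) : ℕ → ℂ → ℂ
  | 0 => P
  | (n+1) => fun s => GG q A B W s ^ (q ^ n) * En q A B W P n (q * s)

lemma Zt.ne_top {Z : ℂ → ℂ} (h : Zt Z) (s : ℂ) : meromorphicOrderAt Z s ≠ ⊤ :=
  MeromorphicOn.meromorphicOrderAt_ne_top_of_isPreconnected (U := univ) (fun s _ => h.mero s) isPreconnected_univ (mem_univ 1) (mem_univ s) (by rw [h.ord_one]; simp)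

/-- order of the quotient -/
noncomputable def mm (q : ℕ) (A B : ℂ → ℂ) (s : ℂ) : ℤ := q * (meromorphicOrderAt A s).untop₀ - (meromorphicOrderAt B s).untop₀

lemma Zt.coe {Z : ℂ → ℂ} (h : Zt Z) (s : ℂ) : ((meromorphicOrderAt Z s).untop₀ : WithTop ℤ) = meromorphicOrderAt Z s :=
  WithTop.coe_untop₀_of_ne_top (h.ne_top s)

lemma Dat.mero0 (h : Dat q A B W P L) (s : ℂ) : MeromorphicAt (fun s => A s ^ q / B s) s := ((h.hA.mero s).pow q).div (h.hB.mero s)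

lemma Dat.meroG (h : Dat q A B W P L) (s : ℂ) : MeromorphicAt (GG q A B W) s :=
  (h.mero0 s).mul (h.W_diff.analyticAt s).meromorphicAt

lemma Dat.ord0 (h : Dat q A B W P L) (s : ℂ) : meromorphicOrderAt (fun s => A s ^ q / B s) s = (mm q A B s : ℤ) := by
  have : (fun s => A s ^ q / B s) = (A ^ q) / B := rfl
  rw [this, meromorphicOrderAt_div ((h.hA.mero s).pow q) (h.hB.mero s), meromorphicOrderAt_pow (h.hA.mero s), ← h.hA.coe, ← h.hB.coe]
  rfl

lemma Dat.ordG (h : Dat q A B W P L) {s : ℂ} (hs : 0 < s.re) : meromorphicOrderAt (GG q A B W) s = (mm q A B s : ℤ) := by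
  have h1 : GG q A B W = W * (fun s => A s ^ q / B s) := by ext s; simp only [GG, Pi.mul_apply]; ring
  rw [h1, meromorphicOrderAt_mul_of_ne_zero (h.W_diff.analyticAt s) (h.W_ne s hs), h.ord0]

lemma Dat.mm_symm (h : Dat q A B W P L) {w : ℂ} (hw : w.im ≠ 0) : mm q A B (1 - conj w) = mm q A B w := by
  unfold mm
  rw [h.hA.symm w hw, h.hB.symm w hw]

lemma Zt.ord_right {Z : ℂ → ℂ} (h : Zt Z) {w : ℂ} (hw : w.im ≠ 0) (h1 : 1 ≤ w.re) : meromorphicOrderAt Z w = 0 := by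
  have hd : AnalyticAt ℂ Z w := by
    have hU : IsOpen (({0, 1} : Set ℂ)ᶜ) := (Set.toFinite _).isClosed.isOpen_compl
    refine DifferentiableOn.analyticAt (s := ({0, 1} : Set ℂ)ᶜ) (fun s hs => ?_) (hU.mem_nhds ?_)
    · simp only [mem_compl_iff, mem_insert_iff, mem_singleton_iff, not_or] at hs
      exact (h.diff s hs.1 hs.2).differentiableWithinAt
    · simp only [mem_compl_iff, mem_insert_iff, mem_singleton_iff, not_or]
      constructor <;> rintro rfl <;> simp at hw
  have hne : Z w ≠ 0 := by
    rcases h1.lt_or_eq with h1 | h1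
    · exact h.nz w h1
    · exact h.line w h1.symm hw
  rw [hd.meromorphicOrderAt_eq, hd.analyticOrderAt_eq_zero.2 hne]; rfl

lemma Dat.mm_right (h : Dat q A B W P L) {w : ℂ} (hw : w.im ≠ 0) (h1 : 1 ≤ w.re) : mm q A B w = 0 := by
  unfold mm
  rw [h.hA.ord_right hw h1, h.hB.ord_right hw h1]; simp

lemma Dat.qre (h : Dat q A B W P L) (s : ℂ) : ((q : ℂ) * s).re = q * s.re := by simp

lemma Dat.q2 (h : Dat q A B W P L) : (2:ℝ) ≤ q := by exact_mod_cast h.hq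

lemma Dat.En_eq (h : Dat q A B W P L) (n : ℕ) : ∀ s : ℂ, 1 < s.re → En q A B W P n s = P s ^ (q ^ n) := by
  induction n with
  | zero => intro s hs; simp [En]
  | succ n ih =>
    intro s hs
    have hqs : 1 < ((q : ℂ) * s).re := by rw [h.qre]; nlinarith [h.q2]
    simp only [En]
    rw [ih _ hqs, ← mul_pow]
    have h1 : GG q A B W s * P (q * s) = P s ^ q := by
      have h2 := h.ident s hs
      have h3 := h.hB.nz s hs
      unfold GG
      field_simp
      linear_combination -h2
    rw [h1, ← pow_mul, pow_succ, mul_comm q]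

lemma Dat.comp_an (h : Dat q A B W P L) (s : ℂ) : AnalyticAt ℂ (fun s : ℂ => (q : ℂ) * s) s := by fun_prop

lemma Dat.En_mero (h : Dat q A B W P L) (n : ℕ) : ∀ s : ℂ, 1 < (q:ℝ) ^ n * s.re → MeromorphicAt (En q A B W P n) s := by
  induction n with
  | zero =>
    intro s hs
    have hs : 1 < s.re := by simpa using hs
    have hU : IsOpen {z : ℂ | 1 < z.re} := isOpen_lt continuous_const Complex.continuous_re
    exact (DifferentiableOn.analyticAt (s := {z : ℂ | 1 < z.re}) (fun z hz => (h.P_diff z hz).differentiableWithinAt) (hU.mem_nhds hs)).meromorphicAt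
  | succ n ih =>
    intro s hs
    have h1 : MeromorphicAt (En q A B W P n) (q * s) := ih _ (by rw [h.qre]; rw [pow_succ] at hs; linarith)
    exact ((h.meroG s).pow _).mul (h1.comp_analyticAt (f := En q A B W P n) (h.comp_an s))

lemma Dat.En_ord (h : Dat q A B W P L) (n : ℕ) : ∀ s : ℂ, 1 < (q:ℝ) ^ n * s.re → 0 < s.re →
    meromorphicOrderAt (En q A B W P n) s = ((∑ i ∈ Finset.range n, (q:ℤ) ^ (n - 1 - i) * mm q A B ((q:ℂ) ^ i * s) : ℤ) : WithTop ℤ) := by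
  induction n with
  | zero =>
    intro s hs _
    have hs : 1 < s.re := by simpa using hs
    have hU : IsOpen {z : ℂ | 1 < z.re} := isOpen_lt continuous_const Complex.continuous_re
    have hd := (DifferentiableOn.analyticAt (s := {z : ℂ | 1 < z.re}) (fun z hz => (h.P_diff z hz).differentiableWithinAt) (hU.mem_nhds hs))
    show meromorphicOrderAt P s = _
    rw [hd.meromorphicOrderAt_eq, hd.analyticOrderAt_eq_zero.2 (h.P_ne s hs)]; rfl
  | succ n ih =>
    intro s hs h0
    have hs' : 1 < (q:ℝ) ^ n * ((q:ℂ) * s).re := by rw [h.qre]; rw [pow_succ] at hs; linarith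
    have h1 : MeromorphicAt (En q A B W P n) (q * s) := h.En_mero n _ hs'
    have hq0 : (q:ℂ) ≠ 0 := by have := h.hq; exact_mod_cast (by omega : q ≠ 0)
    have h2 : meromorphicOrderAt (En q A B W P n ∘ fun s : ℂ => (q:ℂ) * s) s = meromorphicOrderAt (En q A B W P n) (q * s) := by
      refine meromorphicOrderAt_comp_of_deriv_ne_zero (f := En q A B W P n) (h.comp_an s) ?_
      rw [deriv_const_mul _ differentiableAt_id]; simpa using hq0
    have h3 : En q A B W P (n+1) = (GG q A B W) ^ (q ^ n) * (En q A B W P n ∘ fun s : ℂ => (q:ℂ) * s) := rfl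
    rw [h3, meromorphicOrderAt_mul ((h.meroG s).pow _) (h1.comp_analyticAt (f := En q A B W P n) (h.comp_an s)), h2,
      meromorphicOrderAt_pow (h.meroG s), h.ordG h0, ih _ hs' (by rw [h.qre]; have := h.q2; positivity), Finset.sum_range_succ']
    rw [add_comm]
    have e1 : ∀ i ∈ Finset.range n, (q:ℤ) ^ (n + 1 - 1 - (i + 1)) * mm q A B ((q:ℂ) ^ (i+1) * s) = (q:ℤ) ^ (n - 1 - i) * mm q A B ((q:ℂ) ^ i * (q * s)) := by
      intro i hi
      have : n + 1 - 1 - (i + 1) = n - 1 - i := by omega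
      rw [this, pow_succ, mul_assoc]
    rw [Finset.sum_congr rfl e1]
    simp only [Nat.add_sub_cancel, Nat.sub_zero, pow_zero, one_mul]
    push_cast
    rfl

lemma Dat.part1 (h : Dat q A B W P L) (r : ℕ) : MeromorphicOn (En q A B W P r) {s : ℂ | 1 / (q : ℝ) ^ r < s.re} := by
  intro s hs
  have hs : 1 / (q : ℝ) ^ r < s.re := hs
  refine h.En_mero r s ?_
  have := h.q2
  rwa [div_lt_iff₀' (by positivity)] at hs

end dat
end nf
end NB
end

section
open MeasureTheory Set Filter Topology

set_option linter.unusedSectionVars false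
set_option linter.unusedSimpArgs false
set_option linter.unusedVariables false
namespace NB
open Matrix NumberField
open scoped ComplexConjugate nonZeroDivisors

section nf
variable {K : Type*} [Field K] [NumberField K]
lemma ident_mero {f g : ℂ → ℂ} {V : Set ℂ} (hV : IsPreconnected V) (hf : MeromorphicOn f V) (hg : MeromorphicOn g V)
    {s₁ s₀ : ℂ} (h1 : s₁ ∈ V) (h0 : s₀ ∈ V) (h : ∀ᶠ w in 𝓝[≠] s₁, f w = g w) : ∀ᶠ w in 𝓝[≠] s₀, f w = g w := by
  by_contra hcon
  have hm : MeromorphicOn (fun w => f w - g w) V := fun s hs => (hf s hs).sub (hg s hs)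
  have h2 : meromorphicOrderAt (fun w => f w - g w) s₀ ≠ ⊤ := by
    intro ht
    rw [meromorphicOrderAt_eq_top_iff] at ht
    exact hcon (ht.mono fun w hw => sub_eq_zero.1 hw)
  refine hm.meromorphicOrderAt_ne_top_of_isPreconnected hV h0 h1 h2 ?_
  rw [meromorphicOrderAt_eq_top_iff]
  exact h.mono fun w hw => sub_eq_zero.2 hw

section dat
variable {q : ℕ} {A B W P L : ℂ → ℂ}

lemma Dat.half_conn (h : Dat q A B W P L) (n : ℕ) : IsPreconnected {s : ℂ | 1 < (q:ℝ)^n * s.re} := by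
  have := h.q2
  have e : {s : ℂ | 1 < (q:ℝ)^n * s.re} = {s : ℂ | 1 / (q:ℝ)^n < s.re} := by
    ext s
    show 1 < (q:ℝ)^n * s.re ↔ 1 / (q:ℝ)^n < s.re
    rw [div_lt_iff₀' (by positivity)]
  rw [e]; exact halfplane_preconnected _

lemma Dat.mem_two (h : Dat q A B W P L) (n : ℕ) : 1 < (q:ℝ)^n * (2:ℂ).re := by
  have : (1:ℝ) ≤ (q:ℝ)^n := one_le_pow₀ (by linarith [h.q2])
  simp; linarith

lemma ev_two {p : ℂ → Prop} (hp : ∀ s : ℂ, 1 < s.re → p s) : ∀ᶠ s in 𝓝[≠] (2:ℂ), p s := by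
  have hU : IsOpen {z : ℂ | 1 < z.re} := isOpen_lt continuous_const Complex.continuous_re
  exact eventually_nhdsWithin_of_eventually_nhds (eventually_of_mem (hU.mem_nhds (by show 1 < (2:ℂ).re; norm_num)) hp)

lemma Dat.En_succ (h : Dat q A B W P L) (n : ℕ) {s : ℂ} (hs : 1 < (q:ℝ)^n * s.re) :
    ∀ᶠ w in 𝓝[≠] s, En q A B W P (n+1) w = En q A B W P n w ^ q := by
  refine ident_mero (f := En q A B W P (n+1)) (g := fun w => En q A B W P n w ^ q) (h.half_conn n) (fun s hs => ?_) (fun s hs => (h.En_mero n s hs).pow q) (h.mem_two n) hs ?_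
  · refine h.En_mero _ s ?_
    have hs : 1 < (q:ℝ)^n * s.re := hs
    rw [pow_succ]; nlinarith [h.q2]
  · refine ev_two fun s hs => ?_
    rw [h.En_eq _ s hs, h.En_eq _ s hs, ← pow_mul, pow_succ]

/-- matching at level n -/
def TT (q : ℕ) (A B W P : ℂ → ℂ) (r : ℕ) (F : ℂ → ℂ) (n : ℕ) (s : ℂ) : Prop :=
  r ≤ n ∧ 1 < (q:ℝ)^n * s.re ∧ ∀ᶠ w in 𝓝[≠] s, F w ^ (q ^ (n - r)) = En q A B W P n w

lemma Dat.TT_mono (h : Dat q A B W P L) {r n m : ℕ} {F : ℂ → ℂ} {s : ℂ} (hT : TT q A B W P r F n s) (hm : n ≤ m) :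
    TT q A B W P r F m s := by
  induction m, hm using Nat.le_induction with
  | base => exact hT
  | succ m hm ih =>
    obtain ⟨h1, h2, h3⟩ := ih
    refine ⟨by omega, ?_, ?_⟩
    · rw [pow_succ]; nlinarith [h.q2]
    · filter_upwards [h3, h.En_succ m h2] with w hw hw'
      rw [hw', ← hw, ← pow_mul, Nat.succ_sub h1, pow_succ]

lemma ev_ne_of_ev {p : ℂ → Prop} {s : ℂ} (h : ∀ᶠ w in 𝓝[≠] s, p w) : ∀ᶠ s' in 𝓝 s, ∀ᶠ w in 𝓝[≠] s', p w := by
  have h1 := eventually_eventually_nhds.2 (eventually_nhdsWithin_iff.1 h)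
  filter_upwards [h1] with s' hs'
  by_cases he : s' = s
  · rw [he]; exact h
  · have h3 : ∀ᶠ w in 𝓝 s', w ≠ s := eventually_ne_nhds he
    exact eventually_nhdsWithin_of_eventually_nhds ((hs'.and h3).mono fun w hw => hw.1 hw.2)

lemma Dat.localize (h : Dat q A B W P L) {r : ℕ} {F F' : ℂ → ℂ} {U : Set ℂ} (hU : IsOpen U) (hc : IsConnected U)
    {z : ℂ} (hz : z.re = 0) (hzU : z ∈ U) (hne : (U ∩ {s : ℂ | 1 / (q : ℝ) ^ r < s.re}).Nonempty)
    (hF' : MeromorphicOn F' ({s : ℂ | 1 / (q : ℝ) ^ r < s.re} ∪ U))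
    (hFF : ∀ s : ℂ, 1 / (q : ℝ) ^ r < s.re → F' s = F s)
    (hF : ∀ s : ℂ, 1 < s.re → F s = P s ^ (q ^ r)) :
    ∃ z₂ : ℂ, z₂.re = 0 ∧ ∃ δ : ℝ, 0 < δ ∧ Metric.ball z₂ δ ⊆ U ∧ ∀ s ∈ Metric.ball z₂ δ, 0 < s.re → ∃ n, TT q A B W P r F' n s := by
  have hq := h.q2
  have hpos : ∀ n : ℕ, (0:ℝ) < (q:ℝ)^n := fun n => by positivity
  let S : Set ℂ := {s | s ∈ U ∧ 0 < s.re ∧ ∃ n, TT q A B W P r F' n s}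
  have hreo : ∀ a : ℝ, IsOpen {s : ℂ | a < s.re} := fun a => isOpen_lt continuous_const Complex.continuous_re
  have hSo : IsOpen S := by
    rw [isOpen_iff_mem_nhds]
    rintro s ⟨hsU, hs0, n, h1, h2, h3⟩
    have e1 : ∀ᶠ s' in 𝓝 s, 1 < (q:ℝ)^n * s'.re :=
      (isOpen_lt continuous_const (continuous_const.mul Complex.continuous_re)).mem_nhds h2
    filter_upwards [hU.mem_nhds hsU, (hreo 0).mem_nhds hs0, e1, ev_ne_of_ev h3] with s' a b c d
    exact ⟨a, b, n, h1, c, d⟩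
  have hclosed : ∀ V : Set ℂ, IsPreconnected V → V ⊆ U → (∃ a : ℝ, 0 < a ∧ ∀ s ∈ V, a < s.re) → (V ∩ S).Nonempty → V ⊆ S := by
    rintro V hV hVU ⟨a, ha, haV⟩ ⟨s₁, hs1, -, -, n₁, hT⟩ s₀ hs0
    obtain ⟨n, hn⟩ := pow_unbounded_of_one_lt (1 / a) (by linarith : (1:ℝ) < q)
    have hT' := h.TT_mono hT (le_max_left n₁ n)
    set m := max n₁ n
    have hVm : ∀ s ∈ V, 1 < (q:ℝ)^m * s.re := by
      intro s hs
      have h1 : (q:ℝ)^n ≤ (q:ℝ)^m := pow_le_pow_right₀ (by linarith) (le_max_right _ _)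
      have h2 : 1 < (q:ℝ)^n * a := by rwa [div_lt_iff₀ ha] at hn
      have h3 := haV s hs
      have := hpos n
      nlinarith
    refine ⟨hVU hs0, by linarith [haV s₀ hs0], m, hT'.1, hVm _ hs0, ?_⟩
    exact ident_mero (f := fun w => F' w ^ (q ^ (m - r))) hV (fun s hs => (hF' s (Or.inr (hVU hs))).pow _) (fun s hs => h.En_mero m s (hVm s hs)) hs1 hs0 hT'.2.2
  -- nonempty
  have hS0 : S.Nonempty := by
    obtain ⟨s, hsU, hs⟩ := hne
    have hs : 1 / (q : ℝ) ^ r < s.re := hs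
    have hs' : 1 < (q:ℝ)^r * s.re := by rwa [div_lt_iff₀' (hpos r)] at hs
    refine ⟨s, hsU, lt_trans (by have := hpos r; positivity) hs, r, le_rfl, hs', ?_⟩
    refine ident_mero (f := fun w => F' w ^ (q ^ (r - r))) (h.half_conn r) (fun s hs => (hF' s (Or.inl ?_)).pow _) (fun s hs => h.En_mero r s hs) (h.mem_two r) hs' ?_
    · have hs : 1 < (q:ℝ)^r * s.re := hs
      show 1 / (q : ℝ) ^ r < s.re
      rwa [div_lt_iff₀' (hpos r)]
    · refine ev_two fun s hs => ?_
      simp only [Nat.sub_self, pow_zero, pow_one]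
      rw [hFF, hF s hs, h.En_eq r s hs]
      rw [div_lt_iff₀' (hpos r)]
      have : (1:ℝ) ≤ (q:ℝ)^r := one_le_pow₀ (by linarith)
      nlinarith
  have hzS : z ∉ S := fun h => by have := h.2.1; rw [hz] at this; exact lt_irrefl _ this
  -- limit point
  have hex : ∃ z₂ ∈ U, z₂ ∈ closure S ∧ z₂ ∉ S := by
    by_contra hcon
    push Not at hcon
    have hsub := hc.isPreconnected S (closure S)ᶜ hSo isClosed_closure.isOpen_compl (fun x hx => by
      by_cases hxc : x ∈ closure S
      · exact Or.inl (hcon x hx hxc)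
      · exact Or.inr hxc) (by obtain ⟨s, hs⟩ := hS0; exact ⟨s, hs.1, hs⟩) ⟨z, hzU, fun hzc => hzS (hcon z hzU hzc)⟩
    obtain ⟨x, -, hx1, hx2⟩ := hsub
    exact hx2 (subset_closure hx1)
  obtain ⟨z₂, hz2U, hz2c, hz2S⟩ := hex
  obtain ⟨δ, hδ, hball⟩ := Metric.isOpen_iff.1 hU z₂ hz2U
  have hre : z₂.re = 0 := by
    have h1 : 0 ≤ z₂.re := by
      have : closure S ⊆ {s : ℂ | 0 ≤ s.re} := closure_minimal (fun s hs => hs.2.1.le) (isClosed_le continuous_const Complex.continuous_re)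
      exact this hz2c
    by_contra hne
    have h2 : 0 < z₂.re := lt_of_le_of_ne h1 (Ne.symm hne)
    apply hz2S
    set ρ := min δ (z₂.re / 2) with hρ
    have hρ0 : 0 < ρ := lt_min hδ (by linarith)
    refine hclosed (Metric.ball z₂ ρ) (convex_ball _ _).isPreconnected ((Metric.ball_subset_ball (min_le_left _ _)).trans hball) ⟨z₂.re / 2, by linarith, fun s hs => ?_⟩ ?_ (Metric.mem_ball_self hρ0)
    · have h3 := Complex.abs_re_le_norm (s - z₂)
      rw [Metric.mem_ball, dist_eq_norm] at hs
      have h4 : ρ ≤ z₂.re / 2 := min_le_right _ _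
      have h5 := neg_abs_le (s - z₂).re
      rw [Complex.sub_re] at h5 h3
      linarith
    · exact mem_closure_iff.1 hz2c _ Metric.isOpen_ball (Metric.mem_ball_self hρ0)
  refine ⟨z₂, hre, δ, hδ, hball, fun s hs hs0 => ?_⟩
  obtain ⟨s₁, hs1b, hs1S⟩ := mem_closure_iff.1 hz2c _ Metric.isOpen_ball (Metric.mem_ball_self hδ)
  set a := min s.re s₁.re / 2 with ha
  have ha0 : 0 < a := by have := lt_min hs0 hs1S.2.1; positivity
  have ha1 : a < s.re := by have := min_le_left s.re s₁.re; have := lt_min hs0 hs1S.2.1; linarith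
  have ha2 : a < s₁.re := by have := min_le_right s.re s₁.re; have := lt_min hs0 hs1S.2.1; linarith
  have hconv : Convex ℝ (Metric.ball z₂ δ ∩ {s : ℂ | a < s.re}) := (convex_ball _ _).inter (convex_halfSpace_re_gt a)
  exact (hclosed _ hconv.isPreconnected (fun x hx => hball hx.1) ⟨a, ha0, fun s hs => hs.2⟩ ⟨s₁, ⟨hs1b, ha2⟩, hs1S⟩ ⟨hs, ha1⟩).2.2

end dat
end nf
end NB
end

section
open MeasureTheory Set Filter Topology

set_option linter.unusedSectionVars false
set_option linter.unusedSimpArgs false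
set_option linter.unusedVariables false
namespace NB
open Matrix NumberField
open scoped ComplexConjugate nonZeroDivisors

section nf
variable {K : Type*} [Field K] [NumberField K]
section dat
variable {q : ℕ} {A B W P L : ℂ → ℂ}

lemma Dat.relation (h : Dat q A B W P L) {r : ℕ} {F' : ℂ → ℂ} {z : ℂ} (hz : z.re = 0) {δ : ℝ} (hδ : 0 < δ)
    (hF' : MeromorphicOn F' (Metric.ball z δ))
    (hT : ∀ s ∈ Metric.ball z δ, 0 < s.re → ∃ n, TT q A B W P r F' n s) :
    ∃ y ε : ℝ, 0 < ε ∧ ε < |y| ∧ ∀ s : ℂ, 0 < s.re → s.re < ε → |s.im - y| < ε →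
      ∃ n : ℕ, 1 < (q:ℝ)^n * s.re ∧ ∑ i ∈ Finset.range n, (q:ℤ) ^ (n - 1 - i) * mm q A B ((q:ℂ) ^ i * s) = 0 := by
  have hq := h.q2
  have hq0 : q ≠ 0 := by have := h.hq; omega
  have hord : ∀ s ∈ Metric.ball z δ, 0 < s.re → ∃ n : ℕ, 1 < (q:ℝ)^n * s.re ∧ ∃ N : ℕ, N ≠ 0 ∧ (N : WithTop ℤ) * meromorphicOrderAt F' s =
      ((∑ i ∈ Finset.range n, (q:ℤ) ^ (n - 1 - i) * mm q A B ((q:ℂ) ^ i * s) : ℤ) : WithTop ℤ) := by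
    intro s hs hs0
    obtain ⟨n, -, h2, h3⟩ := hT s hs hs0
    refine ⟨n, h2, q ^ (n - r), pow_ne_zero _ hq0, ?_⟩
    rw [← h.En_ord n s h2 hs0, ← meromorphicOrderAt_congr h3, ← meromorphicOrderAt_pow (hF' s hs)]
    rfl
  have hnt : meromorphicOrderAt F' z ≠ ⊤ := by
    have hs : z + (δ/2 : ℝ) ∈ Metric.ball z δ := by
      rw [Metric.mem_ball, dist_eq_norm]
      simp only [add_sub_cancel_left, Complex.norm_real, Real.norm_eq_abs]
      rw [abs_of_pos (by linarith)]; linarith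
    refine hF'.meromorphicOrderAt_ne_top_of_isPreconnected (convex_ball _ _).isPreconnected hs (Metric.mem_ball_self hδ) ?_
    obtain ⟨n, -, N, hN, he⟩ := hord _ hs (by simp only [Complex.add_re, Complex.ofReal_re, hz]; linarith)
    intro ht
    rw [ht, WithTop.mul_top (by exact_mod_cast hN)] at he
    exact WithTop.top_ne_coe he
  have hev : ∀ᶠ w in 𝓝[≠] z, meromorphicOrderAt F' w = 0 := by
    have h1 := (meromorphicOrderAt_ne_top_iff_eventually_ne_zero (hF' z (Metric.mem_ball_self hδ))).1 hnt
    filter_upwards [h1, (hF' z (Metric.mem_ball_self hδ)).eventually_analyticAt] with w hw1 hw2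
    rw [hw2.meromorphicOrderAt_eq, hw2.analyticOrderAt_eq_zero.2 hw1]; rfl
  obtain ⟨η, hη, hball⟩ := Metric.mem_nhdsWithin_iff.1 hev
  set e := min η δ with he
  have he0 : 0 < e := lt_min hη hδ
  obtain ⟨t, ht1, ht2, ht0⟩ : ∃ t : ℝ, e / 4 ≤ t ∧ t ≤ e / 2 ∧ z.im + t ≠ 0 := by
    by_cases h0 : z.im + e / 2 = 0
    · exact ⟨e/4, le_rfl, by linarith, by intro h1; linarith⟩
    · exact ⟨e/2, by linarith, le_rfl, h0⟩
  refine ⟨z.im + t, min (e/8) (|z.im + t| / 2), lt_min (by linarith) (by have := abs_pos.2 ht0; linarith), lt_of_le_of_lt (min_le_right _ _) (by have := abs_pos.2 ht0; linarith), fun s hs0 hs1 hs2 => ?_⟩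
  have hs1 : s.re < e/8 := lt_of_lt_of_le hs1 (min_le_left _ _)
  have hs2 : |s.im - (z.im + t)| < e/8 := lt_of_lt_of_le hs2 (min_le_left _ _)
  have hsb : dist s z < e := by
    rw [dist_eq_norm]
    refine lt_of_le_of_lt (Complex.norm_le_abs_re_add_abs_im _) ?_
    rw [Complex.sub_re, Complex.sub_im, hz, sub_zero, abs_of_pos hs0]
    have := abs_lt.1 hs2
    have : |s.im - z.im| < 5 * e / 8 := by rw [abs_lt]; constructor <;> linarith
    linarith
  have hsz : s ≠ z := by rintro rfl; linarith
  obtain ⟨n, h1, N, hN, h2⟩ := hord s (lt_of_lt_of_le hsb (min_le_right _ _)) hs0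
  refine ⟨n, h1, ?_⟩
  have h3 : meromorphicOrderAt F' s = 0 := hball ⟨lt_of_lt_of_le hsb (min_le_left _ _), hsz⟩
  rw [h3, mul_zero] at h2
  exact_mod_cast h2.symm

lemma Zt.finite {Z : ℂ → ℂ} (h : Zt Z) {S : Set ℂ} (hS : IsCompact S) : {s ∈ S | meromorphicOrderAt Z s ≠ 0}.Finite := by
  have h1 : MeromorphicOn Z S := fun s _ => h.mero s
  have h2 := h1.codiscreteWithin_setOfPred_meromorphicOrderAt_eq_zero_or_top fun u _ => h.ne_top u
  refine (IsCompact.finite_sdiff_of_mem_codiscreteWithin hS h2).subset ?_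
  rintro s ⟨a, b⟩
  refine ⟨a, ?_⟩
  rintro ⟨-, c | c⟩
  · exact b c
  · exact h.ne_top s c

lemma Dat.finite (h : Dat q A B W P L) {S : Set ℂ} (hS : IsCompact S) : {s ∈ S | mm q A B s ≠ 0}.Finite := by
  refine ((h.hA.finite hS).union (h.hB.finite hS)).subset ?_
  rintro s ⟨hs, hm⟩
  by_contra hcon
  simp only [mem_union, not_or] at hcon
  have h1 : meromorphicOrderAt A s = 0 := by by_contra h0; exact hcon.1 ⟨hs, h0⟩
  have h2 : meromorphicOrderAt B s = 0 := by by_contra h0; exact hcon.2 ⟨hs, h0⟩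
  apply hm
  unfold mm
  rw [h1, h2]; simp

lemma Dat.window (h : Dat q A B W P L) {y ε : ℝ} (hε : 0 < ε) (hεy : ε < |y|)
    (hrel : ∀ s : ℂ, 0 < s.re → s.re < ε → |s.im - y| < ε →
      ∃ n : ℕ, 1 < (q:ℝ)^n * s.re ∧ ∑ i ∈ Finset.range n, (q:ℤ) ^ (n - 1 - i) * mm q A B ((q:ℂ) ^ i * s) = 0) :
    ∃ y₁ ε₁ : ℝ, 0 < ε₁ ∧ ε₁ < |y₁| ∧ ∀ (N : ℕ) (w : ℂ), |w.im - q ^ N * y₁| < q ^ N * ε₁ → mm q A B w = 0 := by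
  have hq := h.q2
  have hq0 : (q:ℂ) ≠ 0 := by have := h.hq; exact_mod_cast (by omega : q ≠ 0)
  have hpos : ∀ n : ℕ, (0:ℝ) < (q:ℝ)^n := fun n => by positivity
  obtain ⟨n₀, hn0⟩ := exists_pow_lt_of_lt_one hε (by rw [inv_lt_one₀ (by linarith)]; linarith : (q:ℝ)⁻¹ < 1)
  rw [inv_pow] at hn0
  let D : ℕ → Set ℂ := fun i => {s ∈ Icc (0:ℝ) 1 ×ℂ Icc (-(q ^ i * (|y| + ε))) (q ^ i * (|y| + ε)) | mm q A B s ≠ 0}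
  have hD : ∀ i, (D i).Finite := fun i => h.finite (isCompact_Icc.reProdIm isCompact_Icc)
  let H : Set ℝ := ⋃ i ∈ Finset.range n₀, (fun s : ℂ => s.im / q ^ i) '' D i
  have hH : H.Finite := Set.Finite.biUnion (Finset.finite_toSet _) fun i _ => (hD i).image _
  have him : ∀ (N : ℕ) (w : ℂ), |w.im / q ^ N - y| < ε → w.im ≠ 0 := by
    intro N w hw h0
    rw [h0, zero_div, zero_sub, abs_neg] at hw
    linarith
  have key : ∀ (N : ℕ) (ρ : ℂ), 0 < ρ.re → ρ.re < 1 → |ρ.im / q ^ N - y| < ε → mm q A B ρ ≠ 0 → ρ.im / q ^ N ∈ H := by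
    intro N
    induction N using Nat.strong_induction_on with
    | _ N ih =>
    have main : ∀ ρ : ℂ, 1/2 ≤ ρ.re → ρ.re < 1 → |ρ.im / q ^ N - y| < ε → mm q A B ρ ≠ 0 → ρ.im / q ^ N ∈ H := by
      intro ρ h0 h1 h2 h3
      have hNp := hpos N
      by_cases hN : N < n₀
      · simp only [H, mem_iUnion]
        refine ⟨N, Finset.mem_range.2 hN, ρ, ⟨⟨⟨by linarith, h1.le⟩, ?_⟩, h3⟩, rfl⟩
        have : |ρ.im / q ^ N| ≤ |y| + ε := by
          have := abs_sub_abs_le_abs_sub (ρ.im / q ^ N) y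
          linarith
        rw [abs_div, abs_of_pos hNp, div_le_iff₀ hNp] at this
        have h5 := abs_le.1 this
        show ρ.im ∈ Icc _ _
        constructor <;> nlinarith
      push Not at hN
      set s : ℂ := ρ / (q:ℂ) ^ N with hs
      have hsr : s.re = ρ.re / q ^ N := by
        have : (q:ℂ) ^ N = ((q:ℝ) ^ N : ℝ) := by push_cast; rfl
        rw [hs, this, Complex.div_ofReal_re]
      have hsi : s.im = ρ.im / q ^ N := by
        have : (q:ℂ) ^ N = ((q:ℝ) ^ N : ℝ) := by push_cast; rfl
        rw [hs, this, Complex.div_ofReal_im]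
      have hmr : ∀ i : ℕ, ((q:ℂ) ^ i * s).re = (q:ℝ) ^ i * s.re := fun i => by
        have : (q:ℂ) ^ i = ((q:ℝ) ^ i : ℝ) := by push_cast; rfl
        rw [this, Complex.re_ofReal_mul]
      have hmi : ∀ i : ℕ, ((q:ℂ) ^ i * s).im = (q:ℝ) ^ i * s.im := fun i => by
        have : (q:ℂ) ^ i = ((q:ℝ) ^ i : ℝ) := by push_cast; rfl
        rw [this, Complex.im_ofReal_mul]
      have hs0 : 0 < s.re := by rw [hsr]; apply div_pos <;> linarith
      have hs1 : s.re < ε := by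
        rw [hsr]
        refine lt_of_le_of_lt ?_ hn0
        rw [div_eq_mul_inv]
        have h5 : ((q:ℝ) ^ N)⁻¹ ≤ ((q:ℝ) ^ n₀)⁻¹ := by
          apply inv_anti₀ (hpos _); exact pow_le_pow_right₀ (by linarith) hN
        have h6 : 0 < ((q:ℝ) ^ N)⁻¹ := by positivity
        nlinarith
      have hsim0 : s.im ≠ 0 := by
        rw [hsi]; exact div_ne_zero (him N ρ h2) (hpos N).ne'
      have hNs : (q:ℂ) ^ N * s = ρ := by rw [hs]; field_simp
      obtain ⟨n, hn1, hn2⟩ := hrel s hs0 hs1 (by rw [hsi]; exact h2)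
      have hNn : N < n := by
        by_contra hle
        push Not at hle
        have h5 : (q:ℝ) ^ n ≤ (q:ℝ) ^ N := pow_le_pow_right₀ (by linarith) hle
        have h6 : (q:ℝ) ^ N * s.re < 1 := by rw [← hmr, hNs]; exact h1
        nlinarith
      have hex : ∃ i, i < N ∧ mm q A B ((q:ℂ) ^ i * s) ≠ 0 := by
        by_contra hcon
        push Not at hcon
        rw [Finset.sum_eq_single_of_mem N (Finset.mem_range.2 hNn)] at hn2
        · rw [hNs] at hn2
          rcases mul_eq_zero.1 hn2 with h5 | h5
          · have := pow_ne_zero (n - 1 - N) (by have := h.hq; exact_mod_cast (by omega : q ≠ 0) : (q:ℤ) ≠ 0)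
            exact this h5
          · exact h3 h5
        · intro i _ hiN
          rcases lt_or_gt_of_ne hiN with hlt | hgt
          · rw [hcon i hlt, mul_zero]
          · rw [h.mm_right, mul_zero]
            · rw [hmi]; exact mul_ne_zero (hpos i).ne' hsim0
            · obtain ⟨m, rfl⟩ : ∃ m, i = N + (m + 1) := ⟨i - N - 1, by omega⟩
              have h6 : (1:ℝ) ≤ (q:ℝ) ^ m := one_le_pow₀ (by linarith)
              have h7 : (q:ℝ) ^ N * s.re = ρ.re := by rw [← hmr, hNs]
              rw [hmr, pow_add, pow_succ]
              calc (1:ℝ) ≤ (1 * 2) * (1/2) := by norm_num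
                _ ≤ ((q:ℝ) ^ m * q) * ρ.re := by gcongr
                _ = _ := by rw [← h7]; ring
      obtain ⟨i, hi, hmi0⟩ := hex
      have e1 : ((q:ℂ) ^ i * s).im / q ^ i = ρ.im / q ^ N := by
        rw [hmi, ← hsi]; field_simp [(hpos i).ne']
      have := ih i hi ((q:ℂ) ^ i * s) (by rw [hmr]; exact mul_pos (hpos i) hs0) (by
        rw [hmr]
        have h5 : (q:ℝ) ^ i ≤ (q:ℝ) ^ N := pow_le_pow_right₀ (by linarith) hi.le
        have h6 : (q:ℝ) ^ N * s.re < 1 := by rw [← hmr, hNs]; exact h1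
        nlinarith) (by rw [e1]; exact h2) hmi0
      rwa [e1] at this
    intro ρ h0 h1 h2 h3
    rcases le_or_gt (1/2) ρ.re with h4 | h4
    · exact main ρ h4 h1 h2 h3
    · have e1 : (1 - conj ρ).im = ρ.im := by simp
      have e2 : (1 - conj ρ).re = 1 - ρ.re := by simp
      have := main (1 - conj ρ) (by rw [e2]; linarith) (by rw [e2]; linarith) (by rw [e1]; exact h2) (by rw [h.mm_symm (him N ρ h2)]; exact h3)
      rwa [e1] at this
  -- choose the window
  have hopen : IsOpen (Metric.ball y ε \ H) := Metric.isOpen_ball.sdiff hH.isClosed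
  obtain ⟨y₁, hy1⟩ : (Metric.ball y ε \ H).Nonempty := by
    have : (Metric.ball y ε).Infinite := by
      rw [Real.ball_eq_Ioo]; exact Set.Ioo_infinite (by linarith)
    exact (this.sdiff hH).nonempty
  obtain ⟨ε₁, hε1, hb⟩ := Metric.isOpen_iff.1 hopen y₁ hy1
  have hy10 : y₁ ≠ 0 := by
    rintro rfl
    have := hy1.1
    rw [Metric.mem_ball, Real.dist_eq, zero_sub, abs_neg] at this
    linarith
  refine ⟨y₁, min ε₁ (|y₁| / 2), lt_min hε1 (by have := abs_pos.2 hy10; linarith), lt_of_le_of_lt (min_le_right _ _) (by have := abs_pos.2 hy10; linarith), fun N w hw => ?_⟩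
  have hNp := hpos N
  have h1 : w.im / q ^ N ∈ Metric.ball y₁ ε₁ := by
    rw [Metric.mem_ball, Real.dist_eq]
    have e : w.im / q ^ N - y₁ = (w.im - q ^ N * y₁) / q ^ N := by field_simp
    rw [e, abs_div, abs_of_pos hNp, div_lt_iff₀ hNp]
    have : (q:ℝ) ^ N * min ε₁ (|y₁| / 2) ≤ (q:ℝ) ^ N * ε₁ := by gcongr; exact min_le_left _ _
    linarith
  have h2 := hb h1
  have h3 : |w.im / q ^ N - y| < ε := by
    have := h2.1; rwa [Metric.mem_ball, Real.dist_eq] at this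
  have hwi := him N w h3
  by_contra hne
  rcases le_or_gt 1 w.re with h4 | h4
  · exact hne (h.mm_right hwi h4)
  rcases le_or_gt w.re 0 with h5 | h5
  · apply hne
    rw [← h.mm_symm hwi]
    exact h.mm_right (by simpa using hwi) (by simp; linarith)
  · exact h2.2 (key N w h5 h4 h3 hne)

end dat
end nf
end NB
end

section
open MeasureTheory Set Filter Topology

set_option linter.unusedSectionVars false
set_option linter.unusedSimpArgs false
set_option linter.unusedVariables false
namespace NB
open Matrix NumberField
open scoped ComplexConjugate nonZeroDivisors

section nf
variable {K : Type*} [Field K] [NumberField K]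

open Real in
theorem third_diff_id {H : ℂ → ℂ} {c : ℂ} {R h : ℝ} (hh : 0 < h) (hR : 6 * h ≤ R)
    (hH : DiffContOnCl ℂ H (Metric.ball c R)) :
    ‖H c - 3 * H (c + h) + 3 * H (c + 2 * h) - H (c + 3 * h)‖ ≤
      96 * h ^ 3 / R ^ 3 * circleAverage (fun z => |(H z).re|) c R := by
  have hR0 : 0 < R := by linarith
  have habs : |R| = R := abs_of_pos hR0
  have hsph : ∀ z ∈ Metric.sphere c |R|, ‖z - c‖ = R := by
    intro z hz; rw [habs] at hz; simpa [dist_eq_norm] using hz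
  have hHc : ContinuousOn H (Metric.sphere c R) := by
    have := hH.2
    rw [closure_ball _ hR0.ne'] at this
    exact this.mono Metric.sphere_subset_closedBall
  have hne : ∀ (a : ℝ), 0 ≤ a → a ≤ 3 → ∀ z ∈ Metric.sphere c |R|, R / 2 ≤ ‖z - c - a * h‖ := by
    intro a ha0 ha z hz
    have h1 := hsph z hz
    have h2 := norm_sub_norm_le (z - c) (a * h)
    rw [norm_mul, Complex.norm_real, Complex.norm_real, Real.norm_of_nonneg ha0, Real.norm_of_nonneg hh.le] at h2
    nlinarith
  have hne' : ∀ (a : ℝ), 0 ≤ a → a ≤ 3 → ∀ z ∈ Metric.sphere c |R|, z - c - a * h ≠ 0 := by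
    intro a ha0 ha z hz h0
    have := hne a ha0 ha z hz
    rw [h0, norm_zero] at this; linarith
  have hcau : ∀ a : ℝ, 0 ≤ a → a ≤ 3 → circleAverage (fun z => ((z - c) / (z - (c + a * h))) • H z) c R = H (c + a * h) := by
    intro a ha0 ha
    apply DiffContOnCl.circleAverage_smul_div (by rwa [habs])
    rw [habs, Metric.mem_ball, dist_eq_norm, add_sub_cancel_left, norm_mul, Complex.norm_real, Complex.norm_real, Real.norm_of_nonneg ha0, Real.norm_of_nonneg hh.le]
    nlinarith
  have hci : ∀ a : ℝ, 0 ≤ a → a ≤ 3 → CircleIntegrable (fun z => ((z - c) / (z - (c + a * h))) • H z) c R := by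
    intro a ha0 ha
    apply ContinuousOn.circleIntegrable hR0.le
    have hq : ContinuousOn (fun z => (z - c) / (z - (c + (a:ℂ) * h))) (Metric.sphere c R) := by
      apply ContinuousOn.div (by fun_prop) (by fun_prop)
      intro z hz
      have := hne' a ha0 ha z (by rwa [habs])
      rwa [sub_sub] at this
    exact hq.smul hHc
  set D : ℂ → ℂ := fun z => -6 * (h:ℂ) ^ 3 / ((z - c - (1:ℝ) * h) * (z - c - (2:ℝ) * h) * (z - c - (3:ℝ) * h)) with hD
  have hDc : ContinuousOn D (Metric.sphere c R) := by
    apply ContinuousOn.div (by fun_prop) (by fun_prop)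
    intro z hz
    have hz' : z ∈ Metric.sphere c |R| := by rwa [habs]
    exact mul_ne_zero (mul_ne_zero (hne' 1 (by norm_num) (by norm_num) z hz') (hne' 2 (by norm_num) (by norm_num) z hz')) (hne' 3 (by norm_num) (by norm_num) z hz')
  have hDb : ∀ z ∈ Metric.sphere c |R|, ‖D z‖ ≤ 48 * h ^ 3 / R ^ 3 := by
    intro z hz
    have h1 := hne 1 (by norm_num) (by norm_num) z hz
    have h2 := hne 2 (by norm_num) (by norm_num) z hz
    have h3 := hne 3 (by norm_num) (by norm_num) z hz
    rw [hD]
    simp only [norm_div, norm_mul, norm_neg, norm_pow, Complex.norm_real, Real.norm_of_nonneg hh.le]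
    rw [show (48 * h ^ 3 / R ^ 3 : ℝ) = ‖(6:ℂ)‖ * h ^ 3 / (R / 2 * (R / 2) * (R / 2)) by
      rw [Complex.norm_ofNat]; field_simp; norm_num]
    gcongr
  have e1 : circleAverage (fun z => D z * H z) c R = H c - 3 * H (c + h) + 3 * H (c + 2 * h) - H (c + 3 * h) := by
    have c0 := hcau 0 (by norm_num) (by norm_num)
    have c1 := hcau 1 (by norm_num) (by norm_num)
    have c2 := hcau 2 (by norm_num) (by norm_num)
    have c3 := hcau 3 (by norm_num) (by norm_num)
    have i0 := hci 0 (by norm_num) (by norm_num)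
    have i1 := hci 1 (by norm_num) (by norm_num)
    have i2 := hci 2 (by norm_num) (by norm_num)
    have i3 := hci 3 (by norm_num) (by norm_num)
    have i1' := i1.const_smul (a := (3:ℂ))
    have i2' := i2.const_smul (a := (3:ℂ))
    have c1' := circleAverage_smul (a := (3:ℂ)) (f := fun z => ((z - c) / (z - (c + ((1:ℝ):ℂ) * h))) • H z) (c := c) (R := R)
    have c2' := circleAverage_smul (a := (3:ℂ)) (f := fun z => ((z - c) / (z - (c + ((2:ℝ):ℂ) * h))) • H z) (c := c) (R := R)
    have t := circleAverage_sub ((i0.sub i1').add i2') i3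
    rw [circleAverage_add (i0.sub i1') i2', circleAverage_sub i0 i1', c1', c2', c0, c1, c2, c3] at t
    have t2 : H c - 3 * H (c + h) + 3 * H (c + 2 * h) - H (c + 3 * h) = H (c + ((0:ℝ):ℂ) * h) - (3:ℂ) • H (c + ((1:ℝ):ℂ) * h) + (3:ℂ) • H (c + ((2:ℝ):ℂ) * h) - H (c + ((3:ℝ):ℂ) * h) := by
      simp
    rw [t2, ← t]
    apply circleAverage_congr_sphere
    intro z hz
    have n0 := hne' 0 (by norm_num) (by norm_num) z hz
    have n1 := hne' 1 (by norm_num) (by norm_num) z hz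
    have n2 := hne' 2 (by norm_num) (by norm_num) z hz
    have n3 := hne' 3 (by norm_num) (by norm_num) z hz
    simp only [Pi.sub_apply, Pi.add_apply, Pi.smul_apply, smul_eq_mul, hD]
    rw [← sub_sub, ← sub_sub, ← sub_sub, ← sub_sub]
    have n0' : z - c ≠ 0 := by simpa using n0
    simp only [Complex.ofReal_zero, Complex.ofReal_one, Complex.ofReal_ofNat, zero_mul, sub_zero, one_mul] at n0 n1 n2 n3 ⊢
    clear_value D
    generalize z - c = u at n0 n1 n2 n3 n0' ⊢
    rw [mul_comm (2:ℂ)] at n2 ⊢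
    rw [mul_comm (3:ℂ) (h:ℂ)] at n3 ⊢
    field_simp
    ring
  have e2 : circleAverage (fun z => conj (D z) * H z) c R = 0 := by
    set E : ℂ → ℂ := fun z => -6 * (h:ℂ) ^ 3 * (z - c) ^ 3 / (((R:ℂ) ^ 2 - (1:ℝ) * h * (z - c)) * ((R:ℂ) ^ 2 - (2:ℝ) * h * (z - c)) * ((R:ℂ) ^ 2 - (3:ℝ) * h * (z - c))) with hE
    have hEne : ∀ a : ℝ, 0 ≤ a → a ≤ 3 → ∀ z ∈ Metric.closedBall c R, (R:ℂ) ^ 2 - a * h * (z - c) ≠ 0 := by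
      intro a ha0 ha z hz h0
      have h1 : ‖(R:ℂ) ^ 2‖ = ‖(a:ℂ) * h * (z - c)‖ := by rw [sub_eq_zero.1 h0]
      rw [norm_mul, norm_mul, norm_pow, Complex.norm_real, Complex.norm_real, Complex.norm_real, Real.norm_of_nonneg ha0, Real.norm_of_nonneg hh.le, Real.norm_of_nonneg hR0.le] at h1
      have h2 : ‖z - c‖ ≤ R := by simpa [dist_eq_norm] using hz
      have h3 : a * h * ‖z - c‖ ≤ 3 * h * R := by gcongr
      nlinarith
    have hEd : DiffContOnCl ℂ E (Metric.ball c R) := by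
      have key : ∀ z ∈ Metric.closedBall c R, DifferentiableAt ℂ E z := by
        intro z hz
        apply DifferentiableAt.div (by fun_prop) (by fun_prop)
        exact mul_ne_zero (mul_ne_zero (hEne 1 (by norm_num) (by norm_num) z hz) (hEne 2 (by norm_num) (by norm_num) z hz)) (hEne 3 (by norm_num) (by norm_num) z hz)
      refine ⟨fun z hz => (key z (Metric.ball_subset_closedBall hz)).differentiableWithinAt, ?_⟩
      rw [closure_ball _ hR0.ne']
      exact fun z hz => (key z hz).continuousAt.continuousWithinAt
    have := DiffContOnCl.circleAverage (f := fun z => E z * H z) (c := c) (R := R) (by rw [habs]; exact hEd.smul hH)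
    rw [show E c * H c = 0 by simp [hE]] at this
    rw [← this]
    apply circleAverage_congr_sphere
    intro z hz
    simp only
    congr 1
    have n0 := hne' 0 (by norm_num) (by norm_num) z hz
    have n0' : z - c ≠ 0 := by simpa using n0
    have hn := hsph z hz
    have hcj : conj (z - c) = (R:ℂ) ^ 2 / (z - c) := by
      rw [eq_div_iff n0', mul_comm, Complex.mul_conj, Complex.normSq_eq_norm_sq, hn]; push_cast; ring
    simp only [hD, hE, map_div₀, map_mul, map_neg, map_pow, map_sub, Complex.conj_ofReal, map_ofNat]
    rw [← map_sub, hcj]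
    have hzc : z ∈ Metric.closedBall c R := Metric.sphere_subset_closedBall (by rwa [habs] at hz)
    have m1 := hEne 1 (by norm_num) (by norm_num) z hzc
    have m2 := hEne 2 (by norm_num) (by norm_num) z hzc
    have m3 := hEne 3 (by norm_num) (by norm_num) z hzc
    have k : ∀ a : ℂ, (R:ℂ) ^ 2 / (z - c) - a * h = ((R:ℂ) ^ 2 - a * h * (z - c)) / (z - c) := by
      intro a; field_simp
    rw [k, k, k]
    field_simp
  have hiD : CircleIntegrable (fun z => D z * H z) c R := (hDc.mul hHc).circleIntegrable hR0.le
  have hiD' : CircleIntegrable (fun z => D z * conj (H z)) c R :=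
    (hDc.mul (Complex.continuous_conj.comp_continuousOn hHc)).circleIntegrable hR0.le
  have hcDc : ContinuousOn (fun z => conj (D z) * H z) (Metric.sphere c R) :=
    (Complex.continuous_conj.comp_continuousOn hDc).mul hHc
  have e3 : circleAverage (fun z => D z * conj (H z)) c R = 0 := by
    have := (Complex.conjCLE : ℂ →L[ℝ] ℂ).circleAverage_comp_comm (hcDc.circleIntegrable hR0.le)
    rw [e2] at this
    simp only [map_zero] at this
    rw [← this]
    congr 1
    funext z
    simp
  have e4 : H c - 3 * H (c + h) + 3 * H (c + 2 * h) - H (c + 3 * h) = circleAverage (fun z => D z * (2 * (H z).re : ℝ)) c R := by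
    rw [← e1, ← add_zero (circleAverage (fun z => D z * H z) c R), ← e3, ← circleAverage_fun_add hiD hiD']
    congr 1
    funext z
    rw [← mul_add, Complex.add_conj]
  rw [e4, circleAverage_def, circleAverage_def, norm_smul, smul_eq_mul, Real.norm_of_nonneg (by positivity)]
  have hcm : ∀ θ, circleMap c R θ ∈ Metric.sphere c |R| := circleMap_mem_sphere' c R
  have hcont : Continuous (fun θ => (H (circleMap c R θ)).re) := by
    apply Complex.continuous_re.comp
    rw [← continuousOn_univ]
    apply hHc.comp (continuous_circleMap c R).continuousOn
    intro θ _
    have := hcm θ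
    rwa [habs] at this
  have : ‖∫ θ in (0:ℝ)..2 * π, D (circleMap c R θ) * ((2 * (H (circleMap c R θ)).re : ℝ) : ℂ)‖ ≤ ∫ θ in (0:ℝ)..2 * π, 96 * h ^ 3 / R ^ 3 * |(H (circleMap c R θ)).re| := by
    apply intervalIntegral.norm_integral_le_of_norm_le (by positivity)
    · refine Filter.Eventually.of_forall fun θ _ => ?_
      rw [norm_mul, Complex.norm_real, norm_mul, Real.norm_eq_abs, Real.norm_eq_abs, abs_two]
      calc _ ≤ 48 * h ^ 3 / R ^ 3 * (2 * |(H (circleMap c R θ)).re|) := by gcongr; exact hDb _ (hcm θ)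
        _ = _ := by ring
    · exact (continuous_const.mul hcont.abs).intervalIntegrable _ _
  rw [intervalIntegral.integral_const_mul] at this
  calc _ ≤ (2 * π)⁻¹ * (96 * h ^ 3 / R ^ 3 * ∫ θ in (0:ℝ)..2 * π, |(H (circleMap c R θ)).re|) := by gcongr
    _ = _ := by ring

end nf
end NB
end

section
open MeasureTheory Set Filter Topology

set_option linter.unusedSectionVars false
set_option linter.unusedSimpArgs false
set_option linter.unusedVariables false
namespace NB
open Matrix NumberField
open scoped ComplexConjugate nonZeroDivisors

section nf
variable {K : Type*} [Field K] [NumberField K]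

open Real in
theorem avg_abs_log {f : ℂ → ℂ} {c : ℂ} {R M : ℝ} (hR : 0 < R) (hM : 0 ≤ M)
    (hf : AnalyticOnNhd ℂ f (Metric.closedBall c R)) (hc : f c ≠ 0)
    (hb : ∀ z ∈ Metric.sphere c R, ‖f z‖ ≤ Real.exp M) :
    CircleIntegrable (fun z => |Real.log ‖f z‖|) c R ∧
    circleAverage (fun z => |Real.log ‖f z‖|) c R ≤ 2 * M - Real.log ‖f c‖ := by
  have habs : |R| = R := abs_of_pos hR
  have hi : CircleIntegrable (fun z => Real.log ‖f z‖) c R := by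
    apply MeromorphicOn.circleIntegrable_log_norm
    rw [habs]
    exact (hf.mono Metric.sphere_subset_closedBall).meromorphicOn
  have hia : CircleIntegrable (fun z => |Real.log ‖f z‖|) c R := IntervalIntegrable.abs hi
  refine ⟨hia, ?_⟩
  have hic : CircleIntegrable (fun z : ℂ => 2 * M) c R := circleIntegrable_const _ _ _
  have h1 : circleAverage (fun z => |Real.log ‖f z‖|) c R ≤ circleAverage (fun z => 2 * M - Real.log ‖f z‖) c R := by
    apply circleAverage_mono hia (hic.sub hi)
    intro z hz
    rw [habs] at hz
    have h2 : Real.log ‖f z‖ ≤ M := by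
      by_cases h0 : f z = 0
      · simpa [h0] using hM
      · rw [Real.log_le_iff_le_exp (norm_pos_iff.2 h0)]; exact hb z hz
    rw [abs_le]
    simp only [Pi.sub_apply]
    constructor <;> linarith
  refine h1.trans ?_
  rw [circleAverage_fun_sub hic hi, circleAverage_const, AnalyticOnNhd.circleAverage_log_norm hR.ne' (by rwa [habs]) hc]
  have h3 : 0 ≤ ∑ᶠ u, (MeromorphicOn.divisor f (Metric.closedBall c |R|) u : ℝ) * Real.log (R * ‖c - u‖⁻¹) := by
    apply finsum_nonneg
    intro u
    by_cases hu : u ∈ Metric.closedBall c |R|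
    · have hd : 0 ≤ MeromorphicOn.divisor f (Metric.closedBall c |R|) u := by
        have := MeromorphicOn.AnalyticOnNhd.divisor_nonneg (U := Metric.closedBall c |R|) (by rwa [habs])
        exact this u
      apply mul_nonneg (by exact_mod_cast hd)
      by_cases hcu : u = c
      · simp [hcu]
      · apply Real.log_nonneg
        have : 0 < ‖c - u‖ := norm_pos_iff.2 (sub_ne_zero.2 (Ne.symm hcu))
        rw [← div_eq_mul_inv, le_div_iff₀ this, one_mul]
        rw [habs, Metric.mem_closedBall, dist_comm, dist_eq_norm] at hu
        exact hu
    · rw [Function.locallyFinsuppWithin.apply_eq_zero_of_notMem _ hu]; simp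
  linarith

theorem exists_log {g : ℂ → ℂ} {c : ℂ} {R : ℝ} (hR : 0 < R)
    (hg : DifferentiableOn ℂ g (Metric.ball c R)) (h0 : ∀ z ∈ Metric.ball c R, g z ≠ 0) :
    ∃ H : ℂ → ℂ, DifferentiableOn ℂ H (Metric.ball c R) ∧ ∀ z ∈ Metric.ball c R, Complex.exp (H z) = g z := by
  have hd : DifferentiableOn ℂ (fun z => deriv g z / g z) (Metric.ball c R) :=
    (hg.deriv Metric.isOpen_ball).div hg h0
  obtain ⟨H, hH⟩ := hd.isExactOn_ball
  have hcR : c ∈ Metric.ball c R := Metric.mem_ball_self hR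
  have hconst : ∀ z ∈ Metric.ball c R, g z * Complex.exp (-H z) = g c * Complex.exp (-H c) := by
    intro z hz
    apply (convex_ball c R).is_const_of_fderivWithin_eq_zero (𝕜 := ℂ) (f := fun z => g z * Complex.exp (-H z)) _ _ hz hcR
    · exact hg.mul (fun w hw => ((hH w hw).neg.cexp).differentiableAt.differentiableWithinAt)
    · intro w hw
      have hgw := (hg.differentiableAt (Metric.isOpen_ball.mem_nhds hw)).hasDerivAt
      have := hgw.mul (hH w hw).neg.cexp
      have e : deriv g w * Complex.exp (-H w) + g w * (Complex.exp (-H w) * -(deriv g w / g w)) = 0 := by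
        field_simp [h0 w hw]; ring
      have this' : HasDerivAt (fun z => g z * Complex.exp (-H z)) 0 w := by
        rw [← e]; exact this
      rw [fderivWithin_of_isOpen Metric.isOpen_ball hw]
      have := this'.hasFDerivAt.fderiv
      rw [this]; ext; simp
  refine ⟨fun z => H z + (Complex.log (g c) - H c), fun z hz => ((hH z hz).differentiableAt.add_const _).differentiableWithinAt, fun z hz => ?_⟩
  have := hconst z hz
  rw [Complex.exp_add, Complex.exp_sub, Complex.exp_log (h0 c hcR)]
  rw [Complex.exp_neg, Complex.exp_neg] at this
  have a := Complex.exp_ne_zero (H z)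
  have b := Complex.exp_ne_zero (H c)
  field_simp at this ⊢
  exact this.symm

end nf
end NB
end

section
open MeasureTheory Set Filter Topology

set_option linter.unusedSectionVars false
set_option linter.unusedSimpArgs false
set_option linter.unusedVariables false
namespace NB
open Matrix NumberField
open scoped ComplexConjugate nonZeroDivisors

section nf
variable {K : Type*} [Field K] [NumberField K]
section dat
variable {q : ℕ} {A B W P L : ℂ → ℂ}

theorem Zt.analytic {Z : ℂ → ℂ} (h : Zt Z) {z : ℂ} (h0 : z ≠ 0) (h1 : z ≠ 1) : AnalyticAt ℂ Z z := by
  rw [Complex.analyticAt_iff_eventually_differentiableAt]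
  filter_upwards [isOpen_ne.mem_nhds h0, isOpen_ne.mem_nhds h1] with w hw0 hw1
  exact h.diff w hw0 hw1

open Real in
theorem Zt.avg_bound {Z : ℂ → ℂ} (h : Zt Z) : ∃ C : ℝ, 0 ≤ C ∧ ∀ (c : ℂ) (R T : ℝ), 0 < R → 1 ≤ T → 2 ≤ c.re →
    (∀ w ∈ Metric.closedBall c R, 1 ≤ |w.im| ∧ ‖w‖ ≤ T) →
    CircleIntegrable (fun z => |Real.log ‖Z z‖|) c R ∧
    circleAverage (fun z => |Real.log ‖Z z‖|) c R ≤ C * T ^ 2 := by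
  obtain ⟨C, hC0, hC⟩ := h.growth
  obtain ⟨C', hC1, hC'⟩ := h.bddinv
  have hl : 0 ≤ Real.log C' := Real.log_nonneg hC1
  refine ⟨2 * C + Real.log C', by positivity, fun c R T hR hT hc hw => ?_⟩
  have hne := h.nz c (by linarith)
  obtain ⟨i, b⟩ := avg_abs_log (f := Z) (c := c) (R := R) (M := C * T ^ 2) hR (by positivity) (by
    intro z hz
    have := (hw z hz).1
    apply h.analytic <;> rintro rfl <;> norm_num at this) hne (by
    intro z hz
    have := hw z (Metric.sphere_subset_closedBall hz)
    exact hC T hT z this.2 this.1)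
  refine ⟨i, b.trans ?_⟩
  have h1 : -Real.log ‖Z c‖ ≤ Real.log C' := by
    rw [← Real.log_inv]
    exact Real.log_le_log (inv_pos.2 (norm_pos_iff.2 hne)) (hC' c hc)
  have h2 : Real.log C' ≤ Real.log C' * T ^ 2 := le_mul_of_one_le_right hl (one_le_pow₀ hT)
  linarith

open Real in
theorem Dat.diff_bound (h : Dat q A B W P L) : ∃ C : ℝ, 0 ≤ C ∧ ∀ (c : ℂ) (R T : ℝ), 24 ≤ R → 1 ≤ T → 2 ≤ c.re →
    (∀ w ∈ Metric.closedBall c R, 1 ≤ |w.im| ∧ ‖w‖ ≤ T) →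
    (∀ w ∈ Metric.ball c (2 * R), mm q A B w = 0) →
    ‖L c - 3 * L (c + 4) + 3 * L (c + 8) - L (c + 12)‖ ≤ C * T ^ 2 / R ^ 3 := by
  obtain ⟨C1, hC10, hC1⟩ := h.hA.avg_bound
  obtain ⟨C2, hC20, hC2⟩ := h.hB.avg_bound
  refine ⟨96 * 4 ^ 3 * (q * C1 + C2), by positivity, fun c R T hR hT hc hw hm => ?_⟩
  have hR0 : 0 < R := by linarith
  have habs : |R| = R := abs_of_pos hR0
  set G0 : ℂ → ℂ := fun s => A s ^ q / B s with hG0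
  set V := Metric.ball c (2 * R) with hV
  have hG0m : MeromorphicOn G0 V := fun s _ => h.mero0 s
  set g := toMeromorphicNFOn G0 V with hg
  have hgo : ∀ z ∈ V, meromorphicOrderAt g z = 0 := by
    intro z hz
    rw [hg, meromorphicOrderAt_toMeromorphicNFOn hG0m hz, h.ord0 z, hm z hz]; rfl
  have hnf : MeromorphicNFOn g V := meromorphicNFOn_toMeromorphicNFOn G0 V
  have hgd : DifferentiableOn ℂ g V := by
    intro z hz
    have : AnalyticAt ℂ g z := (hnf hz).meromorphicOrderAt_nonneg_iff_analyticAt.1 (by rw [hgo z hz])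
    exact this.differentiableAt.differentiableWithinAt
  have hgne : ∀ z ∈ V, g z ≠ 0 := fun z hz => (hnf hz).meromorphicOrderAt_eq_zero_iff.1 (hgo z hz)
  obtain ⟨H, hHd, hH⟩ := exists_log (c := c) (R := 2 * R) (by linarith) hgd hgne
  have hgG : ∀ z ∈ V, 1 < z.re → g z = G0 z := by
    intro z hz hz1
    rw [hg, toMeromorphicNFOn_eq_toMeromorphicNFAt hG0m hz]
    have h0 : z ≠ 0 := by rintro rfl; norm_num at hz1
    have h1 : z ≠ 1 := by rintro rfl; norm_num at hz1
    have : AnalyticAt ℂ G0 z := ((h.hA.analytic h0 h1).pow q).div (h.hB.analytic h0 h1) (h.hB.nz z hz1)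
    rw [toMeromorphicNFAt_eq_self.2 this.meromorphicNFAt]
  -- `H - L` is constant
  have hSo : IsOpen (V ∩ {s : ℂ | 1 < s.re}) := Metric.isOpen_ball.inter (isOpen_lt continuous_const Complex.continuous_re)
  have hSc : Convex ℝ (V ∩ {s : ℂ | 1 < s.re}) := (convex_ball _ _).inter (convex_halfSpace_re_gt 1)
  have hmem : ∀ a : ℝ, 0 ≤ a → a ≤ 12 → c + a ∈ V ∩ {s : ℂ | 1 < s.re} := by
    intro a ha0 ha
    refine ⟨?_, ?_⟩
    · rw [hV, Metric.mem_ball, dist_eq_norm, add_sub_cancel_left, Complex.norm_real, Real.norm_of_nonneg ha0]; linarith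
    · show 1 < (c + a).re
      simp; linarith
  have hexp : ∀ z ∈ V ∩ {s : ℂ | 1 < s.re}, Complex.exp (H z) = Complex.exp (L z) := by
    intro z hz
    rw [hH z hz.1, hgG z hz.1 hz.2, h.L_exp z hz.2]
  have hLd : DifferentiableOn ℂ L (V ∩ {s : ℂ | 1 < s.re}) := h.L_diff.mono inter_subset_right
  have hHd' : DifferentiableOn ℂ H (V ∩ {s : ℂ | 1 < s.re}) := hHd.mono inter_subset_left
  have hcon : ∀ z ∈ V ∩ {s : ℂ | 1 < s.re}, H z - L z = H c - L c := by
    intro z hz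
    have hcm : c ∈ V ∩ {s : ℂ | 1 < s.re} := by simpa using hmem 0 le_rfl (by norm_num)
    apply hSc.is_const_of_fderivWithin_eq_zero (𝕜 := ℂ) (f := fun z => H z - L z) (hHd'.sub hLd) _ hz hcm
    intro w hw
    have d1 := (hHd'.differentiableAt (hSo.mem_nhds hw)).hasDerivAt
    have d2 := (hLd.differentiableAt (hSo.mem_nhds hw)).hasDerivAt
    have e : (fun z => Complex.exp (H z)) =ᶠ[𝓝 w] fun z => Complex.exp (L z) := by
      filter_upwards [hSo.mem_nhds hw] with z hz using hexp z hz
    have e1 := d1.cexp.congr_of_eventuallyEq e.symm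
    have e2 := e1.unique d2.cexp
    rw [hexp w hw] at e2
    have e3 := mul_left_cancel₀ (Complex.exp_ne_zero _) e2
    have e4 := d1.sub d2
    rw [e3, sub_self] at e4
    rw [fderivWithin_of_isOpen hSo hw]
    have := e4.hasFDerivAt.fderiv
    have this' : fderiv ℂ (fun z => H z - L z) w = _ := this
    rw [this']; ext; simp
  have hdc : DiffContOnCl ℂ H (Metric.ball c R) := by
    have hsub : Metric.closedBall c R ⊆ V := Metric.closedBall_subset_ball (by linarith)
    refine ⟨hHd.mono (Metric.ball_subset_closedBall.trans hsub), ?_⟩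
    rw [closure_ball _ hR0.ne']
    exact hHd.continuousOn.mono hsub
  have main := third_diff_id (H := H) (c := c) (R := R) (h := 4) (by norm_num) (by linarith) hdc
  have hLH : L c - 3 * L (c + 4) + 3 * L (c + 8) - L (c + 12) = H c - 3 * H (c + ((4:ℝ):ℂ)) + 3 * H (c + 2 * ((4:ℝ):ℂ)) - H (c + 3 * ((4:ℝ):ℂ)) := by
    have k1 := hcon _ (hmem 4 (by norm_num) (by norm_num))
    have k2 := hcon _ (hmem 8 (by norm_num) (by norm_num))
    have k3 := hcon _ (hmem 12 (by norm_num) (by norm_num))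
    push_cast at k1 k2 k3 ⊢
    norm_num
    linear_combination -3 * k1 * (-1) - 3 * k2 + k3
  rw [hLH]
  refine main.trans ?_
  obtain ⟨i1, b1⟩ := hC1 c R T hR0 hT hc hw
  obtain ⟨i2, b2⟩ := hC2 c R T hR0 hT hc hw
  have hsphV : Metric.sphere c |R| ⊆ V := by
    rw [habs]; exact Metric.sphere_subset_closedBall.trans (Metric.closedBall_subset_ball (by linarith))
  have hav : circleAverage (fun z => |(H z).re|) c R = circleAverage (fun z => |Real.log ‖G0 z‖|) c R := by
    apply circleAverage_congr_codiscreteWithin _ hR0.ne'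
    have h1 := codiscreteWithin_mono hsphV (toMeromorphicNFOn_eqOn_codiscrete hG0m)
    filter_upwards [h1, self_mem_codiscreteWithin (Metric.sphere c |R|)] with z hz hzs
    rw [hz, ← hg, ← hH z (hsphV hzs), Complex.norm_exp, Real.log_exp]
  have hle : circleAverage (fun z => |(H z).re|) c R ≤ (q * C1 + C2) * T ^ 2 := by
    rw [hav]
    have i3 : CircleIntegrable (fun z => |Real.log ‖G0 z‖|) c R := by
      have : CircleIntegrable (fun z => Real.log ‖G0 z‖) c R :=
        MeromorphicOn.circleIntegrable_log_norm (fun z _ => h.mero0 z)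
      exact IntervalIntegrable.abs this
    have i1' : CircleIntegrable (fun z => (q:ℝ) * |Real.log ‖A z‖|) c R := i1.const_smul (a := (q:ℝ))
    have s1 : circleAverage (fun z => |Real.log ‖G0 z‖|) c R ≤ circleAverage (fun z => (q:ℝ) * |Real.log ‖A z‖| + |Real.log ‖B z‖|) c R := by
      apply circleAverage_mono i3 (i1'.add i2)
      intro z hz
      show |Real.log ‖G0 z‖| ≤ (q:ℝ) * |Real.log ‖A z‖| + |Real.log ‖B z‖|
      rw [hG0]
      simp only [norm_div, norm_pow]
      have hq0 : q ≠ 0 := by have := h.hq; omega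
      by_cases hA0 : A z = 0
      · simp [hA0, hq0]
      by_cases hB0 : B z = 0
      · simp [hB0]; positivity
      rw [Real.log_div (pow_ne_zero _ (norm_ne_zero_iff.2 hA0)) (norm_ne_zero_iff.2 hB0), Real.log_pow]
      refine (abs_sub _ _).trans ?_
      rw [abs_mul, Nat.abs_cast]
    rw [circleAverage_fun_add i1' i2] at s1
    have s2 : circleAverage (fun z => (q:ℝ) * |Real.log ‖A z‖|) c R = q * circleAverage (fun z => |Real.log ‖A z‖|) c R :=
      circleAverage_fun_smul (a := (q:ℝ)) (f := fun z => |Real.log ‖A z‖|)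
    rw [s2] at s1
    have s3 : (q:ℝ) * circleAverage (fun z => |Real.log ‖A z‖|) c R ≤ q * (C1 * T ^ 2) := by gcongr
    linarith
  calc _ ≤ 96 * 4 ^ 3 / R ^ 3 * ((q * C1 + C2) * T ^ 2) := by gcongr
    _ = _ := by ring

end dat
end nf
end NB
end

section
open MeasureTheory Set Filter Topology

set_option linter.unusedSectionVars false
set_option linter.unusedSimpArgs false
set_option linter.unusedVariables false
namespace NB
open Matrix NumberField
open scoped ComplexConjugate nonZeroDivisors

section nf
variable {K : Type*} [Field K] [NumberField K]
section dat
variable {q : ℕ} {A B W P L : ℂ → ℂ}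

theorem Dat.contra (h : Dat q A B W P L) {y ε : ℝ} (hε : 0 < ε) (hεy : ε < |y|)
    (hwin : ∀ (N : ℕ) (w : ℂ), |w.im - q ^ N * y| < q ^ N * ε → mm q A B w = 0) : False := by
  obtain ⟨n, hn, d, hd, hlead⟩ := h.L_lead
  have hd0 : 0 < ‖d‖ := norm_pos_iff.2 hd
  obtain ⟨σ, hσ⟩ := hlead (‖d‖ / 2) (by positivity)
  obtain ⟨C, hC0, hC⟩ := h.diff_bound
  set σ0 := max σ 2 with hσ0
  have hσ2 : 2 ≤ σ0 := le_max_right _ _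
  have hσσ : σ ≤ σ0 := le_max_left _ _
  have hn2 : (2:ℝ) ≤ n := by exact_mod_cast hn
  have hn0 : 0 < n := by omega
  have hnp : (0:ℝ) < n := by linarith
  set X : ℝ := (n:ℝ) ^ σ0 with hX
  have hX0 : 0 < X := Real.rpow_pos_of_pos hnp _
  have hq2 := h.q2
  have hpos : ∀ N : ℕ, (0:ℝ) < (q:ℝ) ^ N := fun N => by positivity
  set M : ℝ := σ0 + |y| + ε with hM
  have hM1 : 1 ≤ M := by have := abs_nonneg y; linarith
  set η : ℝ := ‖d‖ / (5 * X) with hη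
  have hη0 : 0 < η := by positivity
  -- lower bound
  have hlow : ∀ c : ℂ, c.re = σ0 → η ≤ ‖L c - 3 * L (c + 4) + 3 * L (c + 8) - L (c + 12)‖ := by
    intro c hc
    have hnorm : ∀ j : ℕ, ‖(n:ℂ) ^ (c + (4 * j : ℕ))‖ = X * ((n:ℝ) ^ 4) ^ j := by
      intro j
      rw [Complex.norm_natCast_cpow_of_pos hn0, ← pow_mul, hX, ← Real.rpow_natCast, ← Real.rpow_add hnp]
      congr 1
      simp [hc]
    have h16 : (16:ℝ) ≤ (n:ℝ) ^ 4 := by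
      calc (16:ℝ) = 2 ^ 4 := by norm_num
        _ ≤ _ := by gcongr
    have hup : ∀ j : ℕ, ‖L (c + (4 * j : ℕ))‖ * X * 16 ^ j ≤ 3 / 2 * ‖d‖ := by
      intro j
      have h1 := hσ (c + (4 * j : ℕ)) (by
        have : (0:ℝ) ≤ ((4 * j : ℕ) : ℝ) := Nat.cast_nonneg _
        rw [Complex.add_re, hc, Complex.natCast_re]; linarith)
      have h2 : ‖L (c + (4 * j : ℕ)) * (n:ℂ) ^ (c + (4 * j : ℕ))‖ ≤ ‖d‖ / 2 + ‖d‖ := by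
        have := norm_le_norm_add_norm_sub' (L (c + (4 * j : ℕ)) * (n:ℂ) ^ (c + (4 * j : ℕ))) d
        linarith
      rw [norm_mul, hnorm] at h2
      calc _ = ‖L (c + (4 * j : ℕ))‖ * (X * 16 ^ j) := by ring
        _ ≤ ‖L (c + (4 * j : ℕ))‖ * (X * ((n:ℝ) ^ 4) ^ j) := by gcongr
        _ ≤ _ := by linarith
    have hlo : ‖d‖ / 2 ≤ ‖L c‖ * X := by
      have h1 := hσ c (by rw [hc]; exact hσσ)
      have h2 := norm_le_norm_add_norm_sub (L c * (n:ℂ) ^ c) d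
      have h3 := hnorm 0
      simp only [mul_zero, Nat.cast_zero, add_zero, pow_zero, mul_one] at h3
      rw [norm_mul, h3] at h2
      linarith
    have u1 := hup 1
    have u2 := hup 2
    have u3 := hup 3
    norm_num at u1 u2 u3
    have t : ‖L c‖ ≤ ‖L c - 3 * L (c + 4) + 3 * L (c + 8) - L (c + 12)‖ + 3 * ‖L (c + 4)‖ + 3 * ‖L (c + 8)‖ + ‖L (c + 12)‖ := by
      have e : L c = (L c - 3 * L (c + 4) + 3 * L (c + 8) - L (c + 12)) + 3 * L (c + 4) - 3 * L (c + 8) + L (c + 12) := by ring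
      have t1 := norm_add_le ((L c - 3 * L (c + 4) + 3 * L (c + 8) - L (c + 12)) + 3 * L (c + 4) - 3 * L (c + 8)) (L (c + 12))
      have t2 := norm_sub_le ((L c - 3 * L (c + 4) + 3 * L (c + 8) - L (c + 12)) + 3 * L (c + 4)) (3 * L (c + 8))
      have t3 := norm_add_le ((L c - 3 * L (c + 4) + 3 * L (c + 8) - L (c + 12))) (3 * L (c + 4))
      rw [← e] at t1
      rw [norm_mul, Complex.norm_ofNat] at t2 t3
      linarith
    rw [hη, div_le_iff₀ (by positivity)]
    have t' := mul_le_mul_of_nonneg_right t hX0.le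
    nlinarith
  -- choice of N
  obtain ⟨N, hN⟩ : ∃ N : ℕ, max (48 / ε) (8 * C * M ^ 2 / ε ^ 3 / η) < (q:ℝ) ^ N :=
    pow_unbounded_of_one_lt _ (by linarith)
  have hN1 := lt_of_le_of_lt (le_max_left _ _) hN
  have hN2 := lt_of_le_of_lt (le_max_right _ _) hN
  have hQ := hpos N
  set Q : ℝ := (q:ℝ) ^ N with hQdef
  rw [div_lt_iff₀ hε] at hN1
  have hQ1 : 1 ≤ Q := one_le_pow₀ (by linarith)
  have hup := hC ⟨σ0, Q * y⟩ (Q * ε / 2) (Q * M) (by linarith) (by nlinarith) hσ2 (by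
    intro w hw
    rw [Metric.mem_closedBall, dist_eq_norm] at hw
    have h1 := Complex.abs_im_le_norm (w - ⟨σ0, Q * y⟩)
    have h2 : |w.im - Q * y| ≤ Q * ε / 2 := by
      have : (w - ⟨σ0, Q * y⟩ : ℂ).im = w.im - Q * y := by simp
      rw [this] at h1; linarith
    have h3 : |Q * y| = Q * |y| := by rw [abs_mul, abs_of_pos hQ]
    constructor
    · have := abs_sub_abs_le_abs_sub (Q * y) w.im
      rw [abs_sub_comm (Q * y)] at this
      nlinarith
    · have h4 := norm_le_norm_add_norm_sub' w ⟨σ0, Q * y⟩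
      have h5 := Complex.norm_le_abs_re_add_abs_im (⟨σ0, Q * y⟩ : ℂ)
      simp only at h5
      rw [abs_of_nonneg (by linarith : (0:ℝ) ≤ σ0), h3] at h5
      have h6 : σ0 ≤ Q * σ0 := le_mul_of_one_le_left (by linarith) hQ1
      rw [hM]
      nlinarith) (by
    intro w hw
    apply hwin N
    rw [Metric.mem_ball, dist_eq_norm] at hw
    have h1 := Complex.abs_im_le_norm (w - ⟨σ0, Q * y⟩)
    have : (w - ⟨σ0, Q * y⟩ : ℂ).im = w.im - Q * y := by simp
    rw [this] at h1; linarith)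
  have hl := (hlow ⟨σ0, Q * y⟩ rfl).trans hup
  have e : C * (Q * M) ^ 2 / (Q * ε / 2) ^ 3 = 8 * C * M ^ 2 / ε ^ 3 / Q := by
    field_simp; ring
  rw [e, le_div_iff₀ hQ] at hl
  rw [div_lt_iff₀ hη0] at hN2
  linarith

end dat
end nf
end NB
end


open NumberField

/-- Let `K/k` be a Galois extension of number fields with `Gal(K/k)` cyclic of prime order
`q`, and let `P_q` be the set of nonzero primes `𝔭` of `𝓞 k` that are unramified and inert
in `K`, with `ζ_{P_q}(s) = ∏_{𝔭 ∈ P_q} (1 - N(𝔭)^(-s))⁻¹` for `Re s > 1`.  Then for every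
`r ≥ 1` there is a meromorphic `F_r` on `{Re s > 1/q^r}` with `F_r = ζ_{P_q}^(q^r)` on
`{Re s > 1}`; moreover if `k` and `K` are abelian over `ℚ`, then `ζ_{P_q}` has a natural
boundary on `Re s = 0`: no such continuation `F_r` extends meromorphically to an open
(connected) neighborhood of any point of the imaginary axis. -/
theorem dedekind_partial_zeta_continuation_and_natural_boundary
    (k K : Type*) [Field k] [NumberField k] [Field K] [NumberField K]
    [Algebra k K] [IsGalois k K] [FiniteDimensional k K]
    (q : ℕ) (hq : q.Prime) (hcard : Fintype.card (K ≃ₐ[k] K) = q)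
    (r : ℕ) (hr : 1 ≤ r) :
    (∃ F : ℂ → ℂ, MeromorphicOn F {s : ℂ | 1 / (q : ℝ) ^ r < s.re} ∧
      ∀ s : ℂ, 1 < s.re →
        F s = (∏' 𝔭 : {𝔭 : Ideal (𝓞 k) // 𝔭 ≠ ⊥ ∧ 𝔭.IsPrime ∧
            (Ideal.map (algebraMap (𝓞 k) (𝓞 K)) 𝔭).IsPrime},
          (1 - (Ideal.absNorm 𝔭.1 : ℂ) ^ (-s))⁻¹) ^ (q ^ r)) ∧
    (IsGalois ℚ k → IsGalois ℚ K →
      (∀ σ τ : k ≃ₐ[ℚ] k, σ * τ = τ * σ) → (∀ σ τ : K ≃ₐ[ℚ] K, σ * τ = τ * σ) →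
      ∀ F : ℂ → ℂ, MeromorphicOn F {s : ℂ | 1 / (q : ℝ) ^ r < s.re} →
        (∀ s : ℂ, 1 < s.re →
          F s = (∏' 𝔭 : {𝔭 : Ideal (𝓞 k) // 𝔭 ≠ ⊥ ∧ 𝔭.IsPrime ∧
              (Ideal.map (algebraMap (𝓞 k) (𝓞 K)) 𝔭).IsPrime},
            (1 - (Ideal.absNorm 𝔭.1 : ℂ) ^ (-s))⁻¹) ^ (q ^ r)) →
        ∀ z : ℂ, z.re = 0 →
          ¬ ∃ (U : Set ℂ) (F' : ℂ → ℂ), IsOpen U ∧ IsConnected U ∧ z ∈ U ∧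
              (U ∩ {s : ℂ | 1 / (q : ℝ) ^ r < s.re}).Nonempty ∧
              MeromorphicOn F' ({s : ℂ | 1 / (q : ℝ) ^ r < s.re} ∪ U) ∧
              ∀ s : ℂ, 1 / (q : ℝ) ^ r < s.re → F' s = F s) := by
  have hcard' : Nat.card (K ≃ₐ[k] K) = q := by rw [Nat.card_eq_fintype_card, hcard]
  obtain ⟨A, B, W, L, h⟩ := NB.exists_dat k K hq hcard'
  refine ⟨⟨NB.En q A B W (NB.ep (NB.nIn k K)) r, h.part1 r, fun s hs => h.En_eq r s hs⟩, ?_⟩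
  rintro - - - - F hF hFs z hz ⟨U, F', hU, hc, hzU, hne, hF', hFF⟩
  obtain ⟨z₂, hz₂, δ, hδ, hball, hT⟩ := h.localize hU hc hz hzU hne hF' hFF hFs
  obtain ⟨y, ε, hε, hεy, hrel⟩ := h.relation hz₂ hδ (fun s hs => hF' s (Or.inr (hball hs))) hT
  obtain ⟨y₁, ε₁, hε₁, hεy₁, hwin⟩ := h.window hε hεy hrel
  exact h.contra hε₁ hεy₁ hwin
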